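/- Let C₁,…,C_{p+1} ⊂ GL(n,ℂ) be conjugacy classes whose eigenvalues are generic and which satisfy r(C₁) + … + r(C_{p+1}) ≥ 2n. Then there exists an irreducible (p+1)-tuple of matrices M_j ∈ C_j with M₁M₂⋯M_{p+1} = I. -/

import Mathlib

open Matrix BigOperators

/-- `B` lies in the conjugacy class of `A` (conjugation by an invertible matrix). -/
def MatConj {n : ℕ} (A B : Matrix (Fin n) (Fin n) ℂ) : Prop :=
  ∃ S : (Matrix (Fin n) (Fin n) ℂ)ˣ, B = S.val * A * (S⁻¹).val

/-- A tuple of `n × n` matrices is irreducible if no subspace of `ℂⁿ` other than `⊥` and `⊤`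
is invariant under all of them. -/
def IrreducibleTuple {q n : ℕ} (M : Fin q → Matrix (Fin n) (Fin n) ℂ) : Prop :=
  ∀ V : Submodule ℂ (Fin n → ℂ),
    (∀ j, V.map (Matrix.mulVecLin (M j)) ≤ V) → V = ⊥ ∨ V = ⊤

/-- `r(A) = min over λ of rank (A - λ·I)`; a conjugation invariant. -/
noncomputable def minRank {n : ℕ} (A : Matrix (Fin n) (Fin n) ℂ) : ℕ :=
  sInf (Set.range fun lam : ℂ => (A - lam • (1 : Matrix (Fin n) (Fin n) ℂ)).rank)

/-- Genericity of the eigenvalues (= roots of the characteristic polynomials, with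
multiplicity): no products of sub-multisets of equal cardinality `κ`, `1 ≤ κ ≤ n-1`, equal `1`. -/
def GenericMulRoots {q n : ℕ} (M : Fin q → Matrix (Fin n) (Fin n) ℂ) : Prop :=
  ∀ κ : ℕ, 1 ≤ κ → κ ≤ n - 1 →
    ∀ Φ : Fin q → Multiset ℂ,
      (∀ j, Φ j ≤ (M j).charpoly.roots ∧ Multiset.card (Φ j) = κ) →
      (∏ j, (Φ j).prod) ≠ 1


section
open Set Filter Topology

namespace RH

/-- primitive on a star-shaped domain -/
noncomputable def prim {E : Type*} [NormedAddCommGroup E] [NormedSpace ℂ E] 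
    (z0 : ℂ) (f : ℂ → E) (z : ℂ) : E :=
  (z - z0) • ∫ t in (0:ℝ)..1, f (z0 + (t:ℂ) * (z - z0))

variable {E : Type*} [NormedAddCommGroup E] [NormedSpace ℂ E] [CompleteSpace E]

lemma star_mem {U : Set ℂ} {z0 : ℂ} (hs : StarConvex ℝ z0 U) {z : ℂ} (hz : z ∈ U) {t : ℝ}
    (h0 : 0 ≤ t) (h1 : t ≤ 1) : z0 + (t:ℂ) * (z - z0) ∈ U := by
  have := hs.add_smul_sub_mem hz h0 h1
  simpa using this

/-- closed hull of ball is compact in U -/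
lemma star_hull {U : Set ℂ} {z0 : ℂ} (hU : IsOpen U) (hs : StarConvex ℝ z0 U) {w : ℂ} (hw : w ∈ U) :
    ∃ ε > 0, Metric.closedBall w ε ⊆ U ∧ ∃ K : Set ℂ, IsCompact K ∧ K ⊆ U ∧
      ∀ z ∈ Metric.closedBall w ε, ∀ t ∈ Icc (0:ℝ) 1, z0 + (t:ℂ) * (z - z0) ∈ K := by
  obtain ⟨ε, he, hb⟩ := Metric.nhds_basis_closedBall.mem_iff.1 (hU.mem_nhds hw)
  refine ⟨ε, he, hb, (fun p : ℂ × ℝ => z0 + (p.2:ℂ) * (p.1 - z0)) '' (Metric.closedBall w ε ×ˢ Icc (0:ℝ) 1),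
    ?_, ?_, ?_⟩
  · apply IsCompact.image ((isCompact_closedBall _ _).prod isCompact_Icc)
    fun_prop
  · rintro _ ⟨⟨z, t⟩, ⟨hz, ht⟩, rfl⟩
    exact star_mem hs (hb hz) ht.1 ht.2
  · intro z hz t ht
    exact ⟨(z, t), ⟨hz, ht⟩, rfl⟩

lemma prim_hasDerivAt {U : Set ℂ} {z0 : ℂ} (hU : IsOpen U) (hs : StarConvex ℝ z0 U) {f : ℂ → E}
    (hf : DifferentiableOn ℂ f U) {w : ℂ} (hw : w ∈ U) : HasDerivAt (prim z0 f) (f w) w := by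
  obtain ⟨ε, he, hb, K, hK, hKU, hmem⟩ := star_hull hU hs hw
  have hf' : DifferentiableOn ℂ (deriv f) U := hf.deriv hU
  obtain ⟨C, hC⟩ := hK.exists_bound_of_continuousOn (hf'.continuousOn.mono hKU)
  have hcont : ∀ z ∈ U, ContinuousOn (fun t : ℝ => f (z0 + (t:ℂ) * (z - z0))) (Icc 0 1) := by
    intro z hz
    apply hf.continuousOn.comp (by fun_prop)
    intro t ht
    exact star_mem hs hz ht.1 ht.2
  have hcont' : ∀ z ∈ U, ContinuousOn (fun t : ℝ => deriv f (z0 + (t:ℂ) * (z - z0))) (Icc 0 1) := by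
    intro z hz
    apply hf'.continuousOn.comp (by fun_prop)
    intro t ht
    exact star_mem hs hz ht.1 ht.2
  have h1 : HasDerivAt (fun z => ∫ t in (0:ℝ)..1, f (z0 + (t:ℂ) * (z - z0)))
      (∫ t in (0:ℝ)..1, (t:ℂ) • deriv f (z0 + (t:ℂ) * (w - z0))) w := by
    refine (intervalIntegral.hasDerivAt_integral_of_dominated_loc_of_deriv_le
      (F := fun z t => f (z0 + ((t:ℝ):ℂ) * (z - z0))) (F' := fun z t => ((t:ℝ):ℂ) • deriv f (z0 + (t:ℂ) * (z - z0)))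
      (bound := fun _ => C)
      (s := Metric.ball w ε) (Metric.ball_mem_nhds w he) ?_ ?_ ?_ ?_ ?_ ?_).2
    · filter_upwards [hU.mem_nhds hw] with z hz
      have := (hcont z hz).mono (Ioc_subset_Icc_self (a := (0:ℝ)) (b := 1))
      rw [uIoc_of_le zero_le_one]
      exact this.aestronglyMeasurable measurableSet_Ioc
    · apply ContinuousOn.intervalIntegrable
      rw [uIcc_of_le zero_le_one]
      exact hcont w hw
    · have := (hcont' w hw).mono (Ioc_subset_Icc_self (a := (0:ℝ)) (b := 1))
      rw [uIoc_of_le zero_le_one]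
      refine ContinuousOn.aestronglyMeasurable ?_ measurableSet_Ioc
      exact (by fun_prop : ContinuousOn (fun t : ℝ => (t:ℂ)) _).smul this
    · refine Eventually.of_forall ?_
      intro t ht z hz
      rw [uIoc_of_le zero_le_one] at ht
      rw [norm_smul]
      have h2 := hC _ (hmem z (Metric.ball_subset_closedBall hz) t ⟨ht.1.le, ht.2⟩)
      have h3 : ‖(t:ℂ)‖ ≤ 1 := by
        rw [Complex.norm_real, Real.norm_of_nonneg ht.1.le]; exact ht.2
      calc _ ≤ 1 * C := mul_le_mul h3 h2 (norm_nonneg _) zero_le_one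
        _ = C := one_mul _
    · simp
    · refine Eventually.of_forall ?_
      intro t ht z hz
      rw [uIoc_of_le zero_le_one] at ht
      have hz' : z0 + (t:ℂ) * (z - z0) ∈ U := star_mem hs (hb (Metric.ball_subset_closedBall hz)) ht.1.le ht.2
      have hd := (hf.differentiableAt (hU.mem_nhds hz')).hasDerivAt
      have hi : HasDerivAt (fun z : ℂ => z0 + (t:ℂ) * (z - z0)) (t:ℂ) z := by
        simpa using (((hasDerivAt_id z).sub_const z0).const_mul (t:ℂ)).const_add z0
      exact hd.scomp z hi
  have h2 := ((hasDerivAt_id w).sub_const z0).smul h1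
  refine h2.congr_deriv ?_
  have key : ∫ t in (0:ℝ)..1, (f (z0 + (t:ℂ) * (w - z0)) + (t:ℂ) • ((w - z0) • deriv f (z0 + (t:ℂ) * (w - z0)))) = f w := by
    have := intervalIntegral.integral_eq_sub_of_hasDerivAt (a := 0) (b := 1)
      (f := fun t : ℝ => (t:ℂ) • f (z0 + (t:ℂ) * (w - z0)))
      (f' := fun t : ℝ => (f (z0 + (t:ℂ) * (w - z0)) + (t:ℂ) • ((w - z0) • deriv f (z0 + (t:ℂ) * (w - z0))))) ?_ ?_
    · rw [this]; simp
    · intro t ht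
      rw [uIcc_of_le zero_le_one] at ht
      have hz' : z0 + (t:ℂ) * (w - z0) ∈ U := star_mem hs hw ht.1 ht.2
      have hd := (hf.differentiableAt (hU.mem_nhds hz')).hasDerivAt
      have hc : HasDerivAt (fun t : ℝ => (t:ℂ)) 1 t := by
        simpa using (hasDerivAt_id t).ofReal_comp
      have hi : HasDerivAt (fun t : ℝ => z0 + (t:ℂ) * (w - z0)) (w - z0) t := by
        simpa using (hc.mul_const (w - z0)).const_add z0
      have := hc.smul (hd.scomp t hi)
      refine (this.congr_deriv ?_)
      simp [add_comm]
    · apply ContinuousOn.intervalIntegrable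
      rw [uIcc_of_le zero_le_one]
      exact (hcont w hw).add ((by fun_prop : ContinuousOn (fun t : ℝ => (t:ℂ)) _).smul ((hcont' w hw).const_smul _))
  rw [intervalIntegral.integral_add] at key
  · rw [← key]
    have : ∫ t in (0:ℝ)..1, (t:ℂ) • ((w - z0) • deriv f (z0 + (t:ℂ) * (w - z0))) = 
      (w - z0) • ∫ t in (0:ℝ)..1, (t:ℂ) • deriv f (z0 + (t:ℂ) * (w - z0)) := by
      rw [← intervalIntegral.integral_smul]
      congr 1; ext t; rw [smul_comm]
    rw [this]; simp [add_comm]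
  · apply ContinuousOn.intervalIntegrable
    rw [uIcc_of_le zero_le_one]
    exact (hcont w hw)
  · apply ContinuousOn.intervalIntegrable
    rw [uIcc_of_le zero_le_one]
    exact ((by fun_prop : ContinuousOn (fun t : ℝ => (t:ℂ)) _).smul ((hcont' w hw).const_smul _))

/-- Picard iterates -/
noncomputable def picard (z0 : ℂ) (L : ℂ → E →L[ℂ] E) (e : E) : ℕ → ℂ → E
  | 0 => fun _ => e
  | m+1 => prim z0 (fun z => L z (picard z0 L e m z))

lemma picard_diff {U : Set ℂ} {z0 : ℂ} (hU : IsOpen U) (hs : StarConvex ℝ z0 U) {L : ℂ → E →L[ℂ] E}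
    (hL : DifferentiableOn ℂ L U) (e : E) (m : ℕ) : DifferentiableOn ℂ (picard z0 L e m) U := by
  induction m with
  | zero => exact differentiableOn_const _
  | succ m ih =>
    intro z hz
    exact (prim_hasDerivAt hU hs (hL.clm_apply ih) hz).differentiableAt.differentiableWithinAt

lemma picard_bound {z0 : ℂ} {L : ℂ → E →L[ℂ] E} (e : E) {C R : ℝ} (hC : 0 ≤ C) {z : ℂ}
    (hR : ‖z - z0‖ ≤ R)
    (hL : ∀ t ∈ Icc (0:ℝ) 1, ‖L (z0 + (t:ℂ) * (z - z0))‖ ≤ C) (m : ℕ) :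
    ∀ t ∈ Icc (0:ℝ) 1, ‖picard z0 L e m (z0 + (t:ℂ) * (z - z0))‖ ≤ (C * R * t) ^ m / m.factorial * ‖e‖ := by
  have hR0 : 0 ≤ R := (norm_nonneg _).trans hR
  induction m with
  | zero => intro t _; simp [picard]
  | succ m ih =>
    intro t ht
    have e1 : picard z0 L e (m+1) (z0 + (t:ℂ) * (z - z0)) = ((t:ℂ) * (z - z0)) •
      ∫ s in (0:ℝ)..1, L (z0 + ((s * t : ℝ):ℂ) * (z - z0)) (picard z0 L e m (z0 + ((s * t : ℝ):ℂ) * (z - z0))) := by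
      simp only [picard, prim]
      simp [mul_assoc]
    rw [e1, norm_smul]
    have hb : ‖∫ s in (0:ℝ)..1, L (z0 + ((s * t : ℝ):ℂ) * (z - z0)) (picard z0 L e m (z0 + ((s * t : ℝ):ℂ) * (z - z0)))‖
      ≤ ∫ s in (0:ℝ)..1, C * ((C * R * t)^m / m.factorial * ‖e‖) * s ^ m := by
      apply intervalIntegral.norm_integral_le_of_norm_le zero_le_one
      · refine Eventually.of_forall ?_
        intro s hs'
        have hst : s * t ∈ Icc (0:ℝ) 1 := ⟨mul_nonneg hs'.1.le ht.1, mul_le_one₀ hs'.2 ht.1 ht.2⟩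
        refine (ContinuousLinearMap.le_opNorm _ _).trans ?_
        refine (mul_le_mul (hL _ hst) (ih _ hst) (norm_nonneg _) hC).trans (le_of_eq ?_)
        rw [show C * R * (s * t) = (C * R * t) * s by ring, mul_pow]; ring
      · apply Continuous.intervalIntegrable; fun_prop
    rw [intervalIntegral.integral_const_mul, integral_pow] at hb
    have ht' : ‖(t:ℂ) * (z - z0)‖ ≤ t * R := by
      rw [norm_mul, Complex.norm_real, Real.norm_of_nonneg ht.1]
      exact mul_le_mul_of_nonneg_left hR ht.1
    refine (mul_le_mul ht' hb (norm_nonneg _) (mul_nonneg ht.1 hR0)).trans (le_of_eq ?_)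
    rw [Nat.factorial_succ]
    have : (m.factorial : ℝ) ≠ 0 := by positivity
    push_cast
    field_simp
    simp
    ring

/-- Linear ODE on star-shaped domain. -/
theorem linear_ode {U : Set ℂ} {z0 : ℂ} (hU : IsOpen U) (h0 : z0 ∈ U) (hs : StarConvex ℝ z0 U) {L : ℂ → E →L[ℂ] E}
    (hL : DifferentiableOn ℂ L U) (e : E) :
    ∃ y : ℂ → E, y z0 = e ∧ ∀ z ∈ U, HasDerivAt y (L z (y z)) z := by
  refine ⟨fun z => ∑' m, picard z0 L e m z, ?_, ?_⟩
  · dsimp only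
    rw [tsum_eq_single 0]
    · rfl
    · intro m hm
      obtain ⟨k, rfl⟩ := Nat.exists_eq_succ_of_ne_zero hm
      simp [picard, prim]
  · intro w hw
    obtain ⟨ε, he, hb, K, hK, hKU, hmem⟩ := star_hull hU hs hw
    obtain ⟨C0, hC0⟩ := hK.exists_bound_of_continuousOn (hL.continuousOn.mono hKU)
    set C := max C0 0
    have hC : 0 ≤ C := le_max_right _ _
    set R := ‖w - z0‖ + ε
    have hR0 : 0 ≤ R := by positivity
    have hLb : ∀ z ∈ Metric.ball w ε, ∀ t ∈ Icc (0:ℝ) 1, ‖L (z0 + (t:ℂ) * (z - z0))‖ ≤ C := fun z hz t ht =>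
      (hC0 _ (hmem z (Metric.ball_subset_closedBall hz) t ht)).trans (le_max_left _ _)
    have hRb : ∀ z ∈ Metric.ball w ε, ‖z - z0‖ ≤ R := by
      intro z hz
      have : z - z0 = (w - z0) + (z - w) := by ring
      rw [this]
      refine (norm_add_le _ _).trans ?_
      have : ‖z - w‖ ≤ ε := by rw [← dist_eq_norm]; exact (Metric.mem_ball.1 hz).le
      simp only [R]; linarith
    have hpb : ∀ m, ∀ z ∈ Metric.ball w ε, ‖picard z0 L e m z‖ ≤ (C * R)^m / m.factorial * ‖e‖ := by
      intro m z hz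
      have := picard_bound e hC (hRb z hz) (hLb z hz) m 1 (by simp)
      simpa using this
    have hsum : Summable fun m : ℕ => (C * R)^m / m.factorial * ‖e‖ :=
      (Real.summable_pow_div_factorial _).mul_right _
    have hwb : w ∈ Metric.ball w ε := Metric.mem_ball_self he
    have hS : ∀ z ∈ Metric.ball w ε, Summable fun m => picard z0 L e m z := fun z hz =>
      Summable.of_norm_bounded hsum (fun m => hpb m z hz)
    have hd : ∀ m, ∀ z ∈ Metric.ball w ε, HasDerivAt (picard z0 L e (m+1)) (L z (picard z0 L e m z)) z := by
      intro m z hz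
      exact prim_hasDerivAt hU hs (hL.clm_apply (picard_diff hU hs hL e m)) (hb (Metric.ball_subset_closedBall hz))
    have hLz : ∀ z ∈ Metric.ball w ε, ‖L z‖ ≤ C := by
      intro z hz
      simpa using hLb z hz 1 (by simp)
    have h1 : HasDerivAt (fun z => ∑' m, picard z0 L e (m+1) z) (∑' m, L w (picard z0 L e m w)) w := by
      have hA : ∀ m, ∀ z ∈ Metric.ball w ε, ‖L z (picard z0 L e m z)‖ ≤ C * ((C * R)^m / m.factorial * ‖e‖) := by
        intro m z hz
        exact (ContinuousLinearMap.le_opNorm _ _).trans (mul_le_mul (hLz z hz) (hpb m z hz) (norm_nonneg _) hC)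
      have hB : Summable fun m => picard z0 L e (m+1) w := (summable_nat_add_iff (f := fun m => picard z0 L e m w) 1).2 (hS w hwb)
      exact hasDerivAt_tsum_of_isPreconnected (g := fun m z => picard z0 L e (m+1) z)
        (g' := fun m z => L z (picard z0 L e m z)) (hsum.mul_left C) Metric.isOpen_ball
        (convex_ball w ε).isPreconnected hd hA hwb hB hwb
    have h2 : (fun z => ∑' m, picard z0 L e m z) =ᶠ[𝓝 w] fun z => e + ∑' m, picard z0 L e (m+1) z := by
      filter_upwards [Metric.ball_mem_nhds w he] with z hz
      rw [(hS z hz).tsum_eq_zero_add]; rfl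
    rw [ContinuousLinearMap.map_tsum _ (hS w hwb)]
    exact (h1.const_add e).congr_of_eventuallyEq h2

end RH
end

section
open Set Filter Topology

namespace RH
section
variable {R : Type*} [NormedRing R] [NormedAlgebra ℂ R] [FiniteDimensional ℂ R]

/-- `m - ad A` -/
noncomputable def adm (A : R) (m : ℕ) : R →ₗ[ℂ] R :=
  (m : ℂ) • LinearMap.id - (LinearMap.mulLeft ℂ A - LinearMap.mulRight ℂ A)

lemma adm_apply (A : R) (m : ℕ) (X : R) : adm A m X = (m:ℂ) • X - (A * X - X * A) := rfl

lemma adm_bound (A : R) (hA : ∀ m : ℕ, 1 ≤ m → ∀ X : R, A * X - X * A = (m:ℂ) • X → X = 0) :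
    ∃ K : ℝ, 0 < K ∧ ∀ m : ℕ, 1 ≤ m → ∀ X : R, ‖X‖ ≤ K * ‖adm A m X‖ := by
  have h1 : ∀ m : ℕ, 1 ≤ m → ∃ K : ℝ, 0 < K ∧ ∀ X : R, ‖X‖ ≤ K * ‖adm A m X‖ := by
    intro m hm
    have hk : (adm A m).ker = ⊥ := by
      rw [LinearMap.ker_eq_bot']
      intro X hX
      rw [adm_apply, sub_eq_zero] at hX
      exact hA m hm X hX.symm
    obtain ⟨K, hK, h⟩ := LinearMap.exists_antilipschitzWith _ hk
    refine ⟨K, hK, fun X => ?_⟩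
    have := h.le_mul_dist X 0
    simpa using this
  have h2 : ∀ M : ℕ, ∃ K : ℝ, 0 < K ∧ ∀ m : ℕ, 1 ≤ m → m ≤ M → ∀ X : R, ‖X‖ ≤ K * ‖adm A m X‖ := by
    intro M
    induction M with
    | zero => exact ⟨1, one_pos, fun m h h' => by omega⟩
    | succ M ih =>
      obtain ⟨K, hK, h⟩ := ih
      obtain ⟨K', hK', h'⟩ := h1 (M+1) (by omega)
      refine ⟨max K K', lt_max_of_lt_left hK, fun m hm hM X => ?_⟩
      rcases Nat.lt_or_ge M m with h3 | h3
      · obtain rfl : m = M + 1 := by omega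
        exact (h' X).trans (mul_le_mul_of_nonneg_right (le_max_right _ _) (norm_nonneg _))
      · exact (h m hm h3 X).trans (mul_le_mul_of_nonneg_right (le_max_left _ _) (norm_nonneg _))
  obtain ⟨M, hM⟩ := exists_nat_ge (2 * ‖A‖ + 1)
  obtain ⟨K, hK, h⟩ := h2 M
  refine ⟨max K 1, lt_max_of_lt_left hK, fun m hm X => ?_⟩
  rcases le_or_gt m M with h3 | h3
  · exact (h m hm h3 X).trans (mul_le_mul_of_nonneg_right (le_max_left _ _) (norm_nonneg _))
  · refine le_trans ?_ (mul_le_mul_of_nonneg_right (le_max_right _ _) (norm_nonneg _))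
    rw [one_mul, adm_apply]
    have e1 : ‖(m:ℂ) • X‖ - ‖A * X - X * A‖ ≤ ‖(m:ℂ) • X - (A * X - X * A)‖ := norm_sub_norm_le _ _
    have e2 : ‖A * X - X * A‖ ≤ 2 * ‖A‖ * ‖X‖ := by
      refine (norm_sub_le _ _).trans ?_
      have := norm_mul_le A X
      have := norm_mul_le X A
      nlinarith
    have e3 : ‖(m:ℂ) • X‖ = m * ‖X‖ := by rw [norm_smul]; simp
    have e4 : (M:ℝ) ≤ m := by exact_mod_cast h3.le
    have := norm_nonneg X
    nlinarith

/-- coefficients of the gauge -/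
lemma coeff_exists (A : R) (hA : ∀ m : ℕ, 1 ≤ m → ∀ X : R, A * X - X * A = (m:ℂ) • X → X = 0)
    (b : ℕ → R) : ∃ P : ℕ → R, P 0 = 1 ∧ ∀ m, adm A (m+1) (P (m+1)) = ∑ k ∈ Finset.range (m+1), b k * P (m - k) := by
  have hsurj : ∀ m : ℕ, ∃ f : R → R, ∀ X, adm A (m+1) (f X) = X := by
    intro m
    have hk : (adm A (m+1)).ker = ⊥ := by
      rw [LinearMap.ker_eq_bot']
      intro X hX
      rw [adm_apply, sub_eq_zero] at hX
      exact hA (m+1) (by omega) X hX.symm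
    have hs : Function.Surjective (adm A (m+1)) := LinearMap.injective_iff_surjective.1 (LinearMap.ker_eq_bot.1 hk)
    exact ⟨fun X => (hs X).choose, fun X => (hs X).choose_spec⟩
  choose f hf using hsurj
  -- build finite approximations
  have key : ∀ N : ℕ, ∃ P : ℕ → R, P 0 = 1 ∧ ∀ m < N, adm A (m+1) (P (m+1)) = ∑ k ∈ Finset.range (m+1), b k * P (m - k) := by
    intro N
    induction N with
    | zero => exact ⟨fun _ => 1, rfl, fun m hm => by omega⟩
    | succ N ih =>
      obtain ⟨P, h0, h⟩ := ih
      refine ⟨Function.update P (N+1) (f N (∑ k ∈ Finset.range (N+1), b k * P (N - k))), ?_, ?_⟩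
      · rw [Function.update_of_ne (by omega)]; exact h0
      · intro m hm
        have hsum : ∑ k ∈ Finset.range (m+1), b k * Function.update P (N+1) (f N (∑ k ∈ Finset.range (N+1), b k * P (N - k))) (m - k) = ∑ k ∈ Finset.range (m+1), b k * P (m - k) := by
          refine Finset.sum_congr rfl fun k _ => ?_
          rw [Function.update_of_ne (by omega)]
        rw [hsum]
        rcases Nat.lt_or_ge m N with h3 | h3
        · rw [Function.update_of_ne (by omega)]; exact h m h3
        · obtain rfl : m = N := by omega
          rw [Function.update_self]
          exact hf _ _
  choose Q h0 hQ using key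
  have inj : ∀ m : ℕ, Function.Injective (adm A (m+1)) := by
    intro m
    rw [← LinearMap.ker_eq_bot, LinearMap.ker_eq_bot']
    intro X hX
    rw [adm_apply, sub_eq_zero] at hX
    exact hA (m+1) (by omega) X hX.symm
  have agree : ∀ m N N', m ≤ N → m ≤ N' → Q N m = Q N' m := by
    intro m
    induction m using Nat.strong_induction_on with
    | _ m ih =>
      intro N N' h h'
      rcases m with _ | m
      · rw [h0, h0]
      · apply inj m
        rw [hQ N m (by omega), hQ N' m (by omega)]
        refine Finset.sum_congr rfl fun k _ => ?_
        rw [ih (m - k) (by omega) N N' (by omega) (by omega)]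
  refine ⟨fun m => Q m m, h0 0, fun m => ?_⟩
  rw [hQ (m+1) m (by omega)]
  refine Finset.sum_congr rfl fun k _ => ?_
  rw [agree (m-k) (m+1) (m-k) (by omega) le_rfl]

lemma coeff_bound [NormOneClass R] (A : R) {K : ℝ} (hK : 0 < K) (hadm : ∀ m : ℕ, 1 ≤ m → ∀ X : R, ‖X‖ ≤ K * ‖adm A m X‖)
    (b P : ℕ → R) {C r : ℝ} (hr : 0 < r) (hC : 0 < C) (hb : ∀ i, ‖b i‖ ≤ C * r ^ i)
    (h0 : P 0 = 1) (hP : ∀ m, adm A (m+1) (P (m+1)) = ∑ k ∈ Finset.range (m+1), b k * P (m - k)) (m : ℕ) :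
    ‖P m‖ ≤ (r + K * C) ^ m := by
  have hQ : 0 < r + K * C := by positivity
  induction m using Nat.strong_induction_on with
  | _ m ih =>
    rcases m with _ | m
    · simp [h0]
    · refine (hadm (m+1) (by omega) _).trans ?_
      rw [hP]
      have h1 : ‖∑ k ∈ Finset.range (m+1), b k * P (m - k)‖ ≤ ∑ k ∈ Finset.range (m+1), C * (r ^ k * (r + K * C) ^ (m + 1 - 1 - k)) := by
        refine norm_sum_le_of_le _ fun k _ => ?_
        refine (norm_mul_le _ _).trans ?_
        rw [← mul_assoc]
        exact mul_le_mul (hb k) (by simpa using ih (m-k) (by omega)) (norm_nonneg _) (by positivity)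
      rw [← Finset.mul_sum] at h1
      have h2 := geom_sum₂_mul r (r + K * C) (m+1)
      have h3 : 0 < r ^ (m+1) := by positivity
      calc K * ‖∑ k ∈ Finset.range (m+1), b k * P (m - k)‖ ≤ K * _ := mul_le_mul_of_nonneg_left h1 hK.le
        _ ≤ _ := by linarith
end
end RH
end

section
open Set Filter Topology

namespace RH
section
variable {R : Type*} [NormedRing R] [NormedAlgebra ℂ R] [FiniteDimensional ℂ R] [CompleteSpace R] [NormOneClass R]

lemma taylor_bound {B : ℂ → R} {ρ : ℝ} (hρ : 0 < ρ) (hB : DifferentiableOn ℂ B (Metric.ball 0 ρ)) :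
    ∃ b : ℕ → R, ∃ C r : ℝ, 0 < C ∧ 0 < r ∧ (∀ i, ‖b i‖ ≤ C * r ^ i) ∧
      ∀ z : ℂ, r * ‖z‖ < 1 → HasSum (fun i => z ^ i • b i) (B z) := by
  obtain ⟨s, hs⟩ : ∃ s : NNReal, (s:ℝ) = ρ / 2 := ⟨⟨ρ/2, by positivity⟩, rfl⟩
  have hs0 : 0 < s := by rw [← NNReal.coe_pos, hs]; positivity
  have h1 : DifferentiableOn ℂ B (Metric.closedBall 0 s) := hB.mono (Metric.closedBall_subset_ball (by rw [hs]; linarith))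
  have h2 := h1.hasFPowerSeriesOnBall hs0
  obtain ⟨t, ht⟩ : ∃ s : NNReal, (s:ℝ) = ρ / 4 := ⟨⟨ρ/4, by positivity⟩, rfl⟩
  have hts : t < s := by rw [← NNReal.coe_lt_coe, hs, ht]; linarith
  have ht0 : (0:ℝ) < t := by rw [ht]; positivity
  have h3 : (t : ENNReal) < (cauchyPowerSeries B 0 s).radius := lt_of_lt_of_le (by exact_mod_cast hts) h2.r_le
  obtain ⟨C, hC, h4⟩ := FormalMultilinearSeries.norm_mul_pow_le_of_lt_radius _ h3
  refine ⟨fun i => (cauchyPowerSeries B 0 s).coeff i, C, (t:ℝ)⁻¹, hC, by positivity, ?_, ?_⟩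
  · intro i
    have := h4 i
    rw [← FormalMultilinearSeries.norm_apply_eq_norm_coef] at *
    rw [inv_pow, ← div_eq_mul_inv, le_div_iff₀ (by positivity)]
    exact this
  · intro z hz
    have hz' : z ∈ Metric.eball (0:ℂ) (s:ENNReal) := by
      rw [Metric.eball_coe, Metric.mem_ball, dist_zero_right]
      rw [inv_mul_lt_iff₀ ht0] at hz
      have : (t:ℝ) < s := by exact_mod_cast hts
      linarith
    have h5 := h2.hasSum hz'
    simpa [FormalMultilinearSeries.apply_eq_pow_smul_coeff] using h5

set_option maxHeartbeats 400000 in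
lemma gauge (A : R) (hA : ∀ m : ℕ, 1 ≤ m → ∀ X : R, A * X - X * A = (m:ℂ) • X → X = 0)
    {B : ℂ → R} {ρ : ℝ} (hρ : 0 < ρ) (hB : DifferentiableOn ℂ B (Metric.ball 0 ρ)) :
    ∃ P : ℂ → R, ∃ δ > 0, δ ≤ ρ ∧ ∀ z ∈ Metric.ball (0:ℂ) δ, IsUnit (P z) ∧
      ∃ P' : R, HasDerivAt P P' z ∧ z • P' = A * P z - P z * A + z • (B z * P z) := by
  obtain ⟨b, C, r, hC, hr, hb, hsum⟩ := taylor_bound hρ hB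
  obtain ⟨K, hK, hadm⟩ := adm_bound A hA
  obtain ⟨P, h0, hP⟩ := coeff_exists A hA b
  have hPb := coeff_bound A hK hadm b P hr hC hb h0 hP
  set Q := r + K * C with hQdef
  have hQ : 0 < Q := by positivity
  have hrQ : r ≤ Q := by simp only [hQdef]; have := mul_pos hK hC; linarith
  set δ := 1 / (2 * Q) with hδ
  have hδ0 : 0 < δ := by positivity
  have hz2 : ∀ z ∈ Metric.ball (0:ℂ) δ, Q * ‖z‖ ≤ 1/2 := by
    intro z hz
    rw [mem_ball_zero_iff] at hz
    have : Q * ‖z‖ ≤ Q * δ := mul_le_mul_of_nonneg_left hz.le hQ.le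
    refine this.trans (le_of_eq ?_)
    rw [hδ]; field_simp
  have hPz : ∀ z ∈ Metric.ball (0:ℂ) δ, ∀ m, ‖z ^ m • P m‖ ≤ (1/2:ℝ)^m := by
    intro z hz m
    rw [norm_smul, norm_pow]
    calc ‖z‖^m * ‖P m‖ ≤ ‖z‖^m * Q^m := mul_le_mul_of_nonneg_left (hPb m) (by positivity)
      _ = (Q * ‖z‖)^m := by rw [mul_pow]; ring
      _ ≤ _ := pow_le_pow_left₀ (by positivity) (hz2 z hz) m
  have hgeo : Summable fun m : ℕ => (1/2:ℝ)^m := summable_geometric_two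
  have hSP : ∀ z ∈ Metric.ball (0:ℂ) δ, Summable fun m => ‖z ^ m • P m‖ := fun z hz =>
    Summable.of_nonneg_of_le (fun _ => norm_nonneg _) (hPz z hz) hgeo
  set F : ℂ → R := fun z => ∑' m, z ^ m • P m with hF
  have hbz : ∀ z ∈ Metric.ball (0:ℂ) δ, ∀ m, ‖z ^ m • b m‖ ≤ C * (1/2:ℝ)^m := by
    intro z hz m
    rw [norm_smul, norm_pow]
    calc ‖z‖^m * ‖b m‖ ≤ ‖z‖^m * (C * r^m) := mul_le_mul_of_nonneg_left (hb m) (by positivity)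
      _ = C * (r * ‖z‖)^m := by rw [mul_pow]; ring
      _ ≤ C * (Q * ‖z‖)^m := by gcongr
      _ ≤ _ := by gcongr; exact hz2 z hz
  have hSb : ∀ z ∈ Metric.ball (0:ℂ) δ, Summable fun m => ‖z ^ m • b m‖ := fun z hz =>
    Summable.of_nonneg_of_le (fun _ => norm_nonneg _) (hbz z hz) (hgeo.mul_left C)
  have hd : ∀ m : ℕ, ∀ z ∈ Metric.ball (0:ℂ) δ, HasDerivAt (fun z : ℂ => z ^ m • P m) (((m:ℂ) * z^(m-1)) • P m) z := by
    intro m z _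
    exact (hasDerivAt_pow m z).smul_const (P m)
  have hdb : ∀ m : ℕ, ∀ z ∈ Metric.ball (0:ℂ) δ, ‖((m:ℂ) * z^(m-1)) • P m‖ ≤ (2 * Q) * ((m:ℝ)^1 * (1/2:ℝ)^m) := by
    intro m z hz
    rcases m with _ | m
    · simp
    rw [norm_smul, norm_mul, norm_pow, Nat.add_sub_cancel]
    calc ‖((m+1:ℕ):ℂ)‖ * ‖z‖^m * ‖P (m+1)‖ ≤ ‖((m+1:ℕ):ℂ)‖ * ‖z‖^m * Q^(m+1) := by gcongr; exact hPb _
      _ = (m+1:ℕ) * Q * (Q * ‖z‖)^m := by rw [mul_pow, Complex.norm_natCast]; ring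
      _ ≤ (m+1:ℕ) * Q * (1/2)^m := by gcongr; exact hz2 z hz
      _ = _ := by ring
  have hdsum : Summable fun m : ℕ => (2 * Q) * ((m:ℝ)^1 * (1/2:ℝ)^m) :=
    (summable_pow_mul_geometric_of_norm_lt_one (R := ℝ) 1 (r := 1/2) (by rw [Real.norm_of_nonneg (by norm_num)]; norm_num)).mul_left _
  have hmem0 : (0:ℂ) ∈ Metric.ball (0:ℂ) δ := Metric.mem_ball_self hδ0
  have hder : ∀ z ∈ Metric.ball (0:ℂ) δ, HasDerivAt F (∑' m : ℕ, ((m:ℂ) * z^(m-1)) • P m) z := by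
    intro z hz
    exact hasDerivAt_tsum_of_isPreconnected (g := fun m z => z ^ m • P m)
      (g' := fun m z => ((m:ℂ) * z^(m-1)) • P m) hdsum Metric.isOpen_ball
      (convex_ball 0 δ).isPreconnected hd hdb hmem0 (hSP 0 hmem0).of_norm hz
  have hF0 : F 0 = 1 := by
    simp only [hF]
    rw [tsum_eq_single 0]
    · simp [h0]
    · intro m hm; simp [hm]
  have hunit : ∀ᶠ z in 𝓝 (0:ℂ), IsUnit (F z) := by
    have hc : ContinuousAt F 0 := (hder 0 hmem0).continuousAt
    have : {x : R | IsUnit x} ∈ 𝓝 (F 0) := Units.isOpen.mem_nhds (by rw [hF0]; exact isUnit_one)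
    exact hc this
  obtain ⟨ε, hε, hεu⟩ := Metric.eventually_nhds_iff_ball.1 hunit
  refine ⟨F, min (min δ ε) ρ, by positivity, min_le_right _ _, fun z hz => ⟨hεu z ?_, _, hder z ?_, ?_⟩⟩
  · exact Metric.ball_subset_ball ((min_le_left _ _).trans (min_le_right _ _)) hz
  · exact Metric.ball_subset_ball ((min_le_left _ _).trans (min_le_left _ _)) hz
  have hzδ : z ∈ Metric.ball (0:ℂ) δ := Metric.ball_subset_ball ((min_le_left _ _).trans (min_le_left _ _)) hz
  have hBz : B z = ∑' m, z ^ m • b m := by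
    refine (hsum z ?_).tsum_eq.symm
    have := hz2 z hzδ
    have h3 : r * ‖z‖ ≤ Q * ‖z‖ := mul_le_mul_of_nonneg_right hrQ (norm_nonneg _)
    linarith
  have hprod := tsum_mul_tsum_eq_tsum_sum_range_of_summable_norm (hSb z hzδ) (hSP z hzδ)
  have hprodS := (summable_norm_sum_mul_range_of_summable_norm (hSb z hzδ) (hSP z hzδ)).of_norm
  have hSd : Summable fun m : ℕ => ((m:ℂ) * z^(m-1)) • P m := Summable.of_norm_bounded hdsum fun m => hdb m z hzδ
  have hSPz := (hSP z hzδ).of_norm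
  have e1 : z • ∑' m : ℕ, ((m:ℂ) * z^(m-1)) • P m = ∑' m : ℕ, z^m • ((m:ℂ) • P m) := by
    rw [← hSd.tsum_const_smul]
    refine tsum_congr fun m => ?_
    rcases m with _ | m
    · simp
    · rw [smul_smul, smul_smul]; congr 1; simp; ring
  have hSd' : Summable fun m : ℕ => z^m • ((m:ℂ) • P m) := by
    refine (hSd.const_smul z).congr fun m => ?_
    rcases m with _ | m
    · simp
    · rw [smul_smul, smul_smul]; congr 1; simp; ring
  have hA1 : A * F z = ∑' m, z^m • (A * P m) := by
    simp only [hF]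
    rw [← hSPz.tsum_mul_left]; exact tsum_congr fun m => by simp
  have hA2 : F z * A = ∑' m, z^m • (P m * A) := by
    simp only [hF]
    rw [← hSPz.tsum_mul_right]; exact tsum_congr fun m => by simp
  have hS1 : Summable fun m => z^m • (A * P m) := (hSPz.mul_left A).congr fun m => by simp
  have hS2 : Summable fun m => z^m • (P m * A) := (hSPz.mul_right A).congr fun m => by simp
  have hlhs : z • ∑' m : ℕ, ((m:ℂ) * z^(m-1)) • P m - (A * F z - F z * A) = ∑' m : ℕ, z^m • adm A m (P m) := by
    rw [e1, hA1, hA2, ← hS1.tsum_sub hS2, ← hSd'.tsum_sub (hS1.sub hS2)]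
    refine tsum_congr fun m => ?_
    rw [adm_apply]; simp only [smul_sub]
  have hSad : Summable fun m : ℕ => z^m • adm A m (P m) := by
    refine (hSd'.sub (hS1.sub hS2)).congr fun m => ?_
    rw [adm_apply]; simp only [smul_sub]
  have hrhs : ∑' m : ℕ, z^m • adm A m (P m) = z • (B z * F z) := by
    rw [hSad.tsum_eq_zero_add, hBz]
    simp only [hF]
    rw [hprod, ← hprodS.tsum_const_smul]
    rw [adm_apply, h0]
    simp only [Nat.cast_zero, zero_smul, mul_one, one_mul, sub_self, smul_zero, zero_add]
    refine tsum_congr fun m => ?_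
    rw [hP, Finset.smul_sum, Finset.smul_sum]
    refine Finset.sum_congr rfl fun k hk => ?_
    rw [Finset.mem_range] at hk
    rw [smul_mul_smul_comm, smul_smul, ← pow_add, show k + (m - k) = m by omega, pow_succ']
  rw [← hrhs, ← hlhs]; abel
end
end RH
end

section
open Set Filter Topology

namespace RH
section
variable {R : Type*} [NormedRing R] [NormedAlgebra ℂ R] [FiniteDimensional ℂ R] [CompleteSpace R] [NormOneClass R]
  [IsDedekindFiniteMonoid R]

/-- invertible solution of the linear system on `V` -/
def Sol (A : ℂ → R) (V : Set ℂ) (Y : ℂ → R) : Prop :=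
  ∀ z ∈ V, HasDerivAt Y (A z * Y z) z ∧ IsUnit (Y z)

lemma Sol.mono {A : ℂ → R} {V W : Set ℂ} {Y : ℂ → R} (h : Sol A V Y) (hW : W ⊆ V) : Sol A W Y :=
  fun z hz => h z (hW hz)

lemma Sol.ratio {A : ℂ → R} {V : Set ℂ} {Y Y2 : ℂ → R} (hV : IsOpen V) (hc : IsPreconnected V) {z0 : ℂ} (hz0 : z0 ∈ V)
    (h : Sol A V Y) (h2 : Sol A V Y2) : ∃ T : Rˣ, ∀ z ∈ V, Y2 z = Y z * T := by
  have hd : ∀ z ∈ V, HasDerivAt (fun z => Ring.inverse (Y z) * Y2 z) 0 z := by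
    intro z hz
    obtain ⟨hY, u, hu⟩ := h z hz
    have h3 := (hasFDerivAt_ringInverse (𝕜 := ℂ) u)
    rw [hu] at h3
    have h4 := (h3.comp_hasDerivAt z hY).mul (h2 z hz).1
    refine h4.congr_deriv ?_
    simp only [Function.comp, ← hu, Ring.inverse_unit, _root_.neg_apply, ContinuousLinearMap.mulLeftRight_apply]
    simp [mul_assoc]
  obtain ⟨T, hT⟩ := hV.exists_is_const_of_deriv_eq_zero (𝕜 := ℂ) hc (fun z hz => (hd z hz).differentiableAt.differentiableWithinAt)
    (fun z hz => (hd z hz).deriv)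
  have hu : IsUnit T := by
    rw [← hT z0 hz0]
    exact (h z0 hz0).2.ringInverse.mul (h2 z0 hz0).2
  obtain ⟨u, rfl⟩ := hu
  refine ⟨u, fun z hz => ?_⟩
  rw [← hT z hz, ← mul_assoc, Ring.mul_inverse_cancel _ (h z hz).2, one_mul]

lemma fund_exists {A : ℂ → R} {U : Set ℂ} {z0 : ℂ} (hU : IsOpen U) (h0 : z0 ∈ U) (hs : StarConvex ℝ z0 U)
    (hA : DifferentiableOn ℂ A U) : ∃ Y, Sol A U Y := by
  obtain ⟨Y, hY0, hY⟩ := linear_ode hU h0 hs (L := fun z => ContinuousLinearMap.mul ℂ R (A z))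
    (fun z hz => ((ContinuousLinearMap.mul ℂ R).differentiableAt).comp_differentiableWithinAt z (hA z hz)) 1
  obtain ⟨W, hW0, hW⟩ := linear_ode hU h0 hs (L := fun z => - (ContinuousLinearMap.mul ℂ R).flip (A z))
    (fun z hz => (((ContinuousLinearMap.mul ℂ R).flip.differentiableAt).comp_differentiableWithinAt z (hA z hz)).neg) 1
  have hd : ∀ z ∈ U, HasDerivAt (fun z => W z * Y z) 0 z := by
    intro z hz
    refine ((hW z hz).mul (hY z hz)).congr_deriv ?_
    simp [mul_assoc]
  have hc : IsPreconnected U := (hs.isPathConnected h0).isConnected.isPreconnected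
  have h1 : ∀ z ∈ U, W z * Y z = 1 := by
    intro z hz
    have := hU.is_const_of_deriv_eq_zero (𝕜 := ℂ) hc (fun z hz => (hd z hz).differentiableAt.differentiableWithinAt)
      (fun z hz => (hd z hz).deriv) hz h0
    simpa [hY0, hW0] using this
  refine ⟨Y, fun z hz => ⟨hY z hz, ?_⟩⟩
  have h2 := mul_eq_one_symm (h1 z hz)
  exact ⟨⟨Y z, W z, h2, h1 z hz⟩, rfl⟩

/-- slit discs -/
def slitR (a : ℂ) (δ : ℝ) : Set ℂ := {z | z - a ∈ Metric.ball 0 δ ∩ Complex.slitPlane}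
def slitL (a : ℂ) (δ : ℝ) : Set ℂ := {z | -(z - a) ∈ Metric.ball 0 δ ∩ Complex.slitPlane}

lemma slit_conn {δ : ℝ} (hδ : 0 < δ) : IsPreconnected (Metric.ball (0:ℂ) δ ∩ Complex.slitPlane) := by
  have h1 : ((δ/2:ℝ):ℂ) ∈ Metric.ball (0:ℂ) δ := by
    rw [mem_ball_zero_iff, Complex.norm_real, Real.norm_of_nonneg (by positivity)]; linarith
  have h2 : ((δ/2:ℝ):ℂ) ∈ Complex.slitPlane := by
    rw [Complex.ofReal_mem_slitPlane]; positivity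
  have := ((convex_ball (0:ℂ) δ).starConvex h1).inter (Complex.starConvex_ofReal_slitPlane (x := δ/2) (by positivity))
  exact (this.isPathConnected (show _ ∈ _ from ⟨h1, h2⟩)).isConnected.isPreconnected

lemma slitR_conn (a : ℂ) {δ : ℝ} (hδ : 0 < δ) : IsPreconnected (slitR a δ) := by
  have := (slit_conn hδ).image (fun z => a + z) (by fun_prop)
  convert this using 1
  ext z
  simp only [slitR, mem_ofPred_eq, mem_image]
  constructor
  · intro h; exact ⟨_, h, by ring⟩
  · rintro ⟨w, h, rfl⟩; simpa using h

lemma slitL_conn (a : ℂ) {δ : ℝ} (hδ : 0 < δ) : IsPreconnected (slitL a δ) := by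
  have := (slit_conn hδ).image (fun z => a - z) (by fun_prop)
  convert this using 1
  ext z
  simp only [slitL, mem_ofPred_eq, mem_image]
  constructor
  · intro h; exact ⟨_, h, by ring⟩
  · rintro ⟨w, h, rfl⟩; simpa using h

lemma slitR_open (a : ℂ) (δ : ℝ) : IsOpen (slitR a δ) :=
  (Metric.isOpen_ball.inter Complex.isOpen_slitPlane).preimage (by fun_prop)
lemma slitL_open (a : ℂ) (δ : ℝ) : IsOpen (slitL a δ) :=
  (Metric.isOpen_ball.inter Complex.isOpen_slitPlane).preimage (by fun_prop)

lemma log_neg_pos {z : ℂ} (hz : 0 < z.im) : Complex.log z = Complex.log (-z) + Real.pi * Complex.I := by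
  simp only [Complex.log, Complex.arg_neg_eq_arg_sub_pi_of_im_pos hz, norm_neg]
  push_cast; ring
lemma log_neg_neg {z : ℂ} (hz : z.im < 0) : Complex.log z = Complex.log (-z) - Real.pi * Complex.I := by
  simp only [Complex.log, Complex.arg_neg_eq_arg_add_pi_of_im_neg hz, norm_neg]
  push_cast; ring

lemma isUnit_exp' (x : R) : IsUnit (NormedSpace.exp x) := by
  letI := NormedAlgebra.restrictScalars ℚ ℂ R
  exact NormedSpace.isUnit_exp x

lemma exp_add' {x y : R} (h : Commute x y) : NormedSpace.exp (x + y) = NormedSpace.exp x * NormedSpace.exp y := by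
  letI := NormedAlgebra.restrictScalars ℚ ℂ R
  exact NormedSpace.exp_add_of_commute h

lemma exp_log_sol {A0 : R} {A B P : ℂ → R} {P' : R} {a z l : ℂ} {L : ℂ → ℂ} (hne : z ≠ a)
    (hL : HasDerivAt L (z - a)⁻¹ z) (hP : HasDerivAt P P' (z - a)) (hu : IsUnit (P (z - a)))
    (hAz : A z = (z - a)⁻¹ • A0 + B (z - a))
    (hPe : (z - a) • P' = A0 * P (z - a) - P (z - a) * A0 + (z - a) • (B (z - a) * P (z - a))) :
    HasDerivAt (fun z => P (z - a) * NormedSpace.exp (L z • A0)) (A z * (P (z - a) * NormedSpace.exp (L z • A0))) z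
     ∧ IsUnit (P (z - a) * NormedSpace.exp (L z • A0)) := by
  refine ⟨?_, hu.mul (isUnit_exp' _)⟩
  have h1 : HasDerivAt (fun z => P (z - a)) P' z := by
    have := hP.scomp z ((hasDerivAt_id z).sub_const a)
    simpa [Function.comp_def] using this
  have h2 : HasDerivAt (fun z => NormedSpace.exp (L z • A0)) ((z - a)⁻¹ • (NormedSpace.exp (L z • A0) * A0)) z := by
    exact (hasDerivAt_exp_smul_const A0 (L z)).scomp z hL
  refine (h1.mul h2).congr_deriv ?_
  have hza : z - a ≠ 0 := sub_ne_zero.2 hne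
  have hcomm : Commute (NormedSpace.exp (L z • A0)) A0 := ((Commute.refl A0).smul_left (L z)).exp_left
  have e : P' = (z - a)⁻¹ • (A0 * P (z - a) - P (z - a) * A0) + B (z - a) * P (z - a) := by
    rw [← inv_smul_smul₀ hza P', hPe, smul_add, inv_smul_smul₀ hza]
  rw [e, hAz, hcomm.eq]
  simp only [add_mul, smul_mul_assoc, mul_smul_comm, sub_mul, mul_assoc, smul_sub]
  abel

lemma local_sols {A0 : R} (hA0 : ∀ m : ℕ, 1 ≤ m → ∀ X : R, A0 * X - X * A0 = (m:ℂ) • X → X = 0)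
    {A B : ℂ → R} {a : ℂ} {ρ : ℝ} (hρ : 0 < ρ) (hB : DifferentiableOn ℂ B (Metric.ball 0 ρ))
    (hA : ∀ z, z ≠ a → z - a ∈ Metric.ball (0:ℂ) ρ → A z = (z - a)⁻¹ • A0 + B (z - a)) :
    ∃ δ > 0, δ ≤ ρ ∧ ∃ Zl Zr : ℂ → R, Sol A (slitL a δ) Zl ∧ Sol A (slitR a δ) Zr ∧
      (∀ z, 0 < (z - a).im → Zr z = Zl z * NormedSpace.exp ((Real.pi * Complex.I) • A0)) ∧
      (∀ z, (z - a).im < 0 → Zr z = Zl z * NormedSpace.exp (-((Real.pi * Complex.I) • A0))) := by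
  obtain ⟨P, δ, hδ, hδρ, hP⟩ := gauge A0 hA0 hρ hB
  refine ⟨δ, hδ, hδρ, fun z => P (z - a) * NormedSpace.exp (Complex.log (-(z - a)) • A0),
    fun z => P (z - a) * NormedSpace.exp (Complex.log (z - a) • A0), ?_, ?_, ?_, ?_⟩
  · intro z hz
    have hb : z - a ∈ Metric.ball (0:ℂ) δ := by have := hz.1; rwa [mem_ball_zero_iff, norm_neg, ← mem_ball_zero_iff] at this
    have hne : z ≠ a := by
      rintro rfl; have := hz.2; simp at this
    obtain ⟨hu, P', hP', hPe⟩ := hP _ hb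
    refine exp_log_sol (L := fun z => Complex.log (-(z - a))) (l := 0) hne ?_ hP' hu (hA z hne (Metric.ball_subset_ball hδρ hb)) hPe
    have := (Complex.hasDerivAt_log hz.2).comp z (((hasDerivAt_id z).sub_const a).neg)
    refine this.congr_deriv ?_
    rw [inv_neg]; simp
  · intro z hz
    have hb : z - a ∈ Metric.ball (0:ℂ) δ := hz.1
    have hne : z ≠ a := by
      rintro rfl; have := hz.2; simp at this
    obtain ⟨hu, P', hP', hPe⟩ := hP _ hb
    refine exp_log_sol (L := fun z => Complex.log (z - a)) (l := 0) hne ?_ hP' hu (hA z hne (Metric.ball_subset_ball hδρ hb)) hPe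
    have := (Complex.hasDerivAt_log hz.2).comp z ((hasDerivAt_id z).sub_const a)
    refine this.congr_deriv ?_
    simp
  · intro z hz
    dsimp only
    rw [log_neg_pos hz, add_smul, exp_add' (((Commute.refl A0).smul_left _).smul_right _), mul_assoc]
  · intro z hz
    dsimp only
    rw [log_neg_neg hz, sub_smul, sub_eq_add_neg (Complex.log (-(z - a)) • A0), exp_add' (((Commute.refl A0).smul_left _).smul_right _).neg_right, mul_assoc]
end
end RH
end

section
open Set Filter Topology

namespace RH
section
variable {R : Type*} [NormedRing R] [NormedAlgebra ℂ R] [FiniteDimensional ℂ R] [CompleteSpace R] [NormOneClass R]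
  [IsDedekindFiniteMonoid R]

/-- plane cut along the real line, reglued along `I` -/
def Dom (I : Set ℝ) : Set ℂ := {z | z.im ≠ 0 ∨ z.re ∈ I}

lemma upper_open : IsOpen {z : ℂ | 0 < z.im} := isOpen_lt continuous_const Complex.continuous_im
lemma lower_open : IsOpen {z : ℂ | z.im < 0} := isOpen_lt Complex.continuous_im continuous_const
lemma upper_conn : IsPreconnected {z : ℂ | 0 < z.im} := (convex_halfSpace_im_gt 0).isPreconnected
lemma lower_conn : IsPreconnected {z : ℂ | z.im < 0} := (convex_halfSpace_im_lt 0).isPreconnected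

lemma cross {A0 : R} (hA0 : ∀ m : ℕ, 1 ≤ m → ∀ X : R, A0 * X - X * A0 = (m:ℂ) • X → X = 0)
    {A B : ℂ → R} {x : ℝ} (hB : DifferentiableOn ℂ B (Metric.ball 0 1))
    (hA : ∀ z : ℂ, z ≠ x → z - x ∈ Metric.ball (0:ℂ) 1 → A z = (z - x)⁻¹ • A0 + B (z - x))
    {Yl Yr : ℂ → R} (hl : Sol A (Dom (Ioo (x-1) x)) Yl) (hr : Sol A (Dom (Ioo x (x+1))) Yr) :
    ∃ Tp Tm u : Rˣ, (∀ z : ℂ, 0 < z.im → Yr z = Yl z * Tp) ∧ (∀ z : ℂ, z.im < 0 → Yr z = Yl z * Tm) ∧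
      (Tp:R) * (Tm⁻¹ : Rˣ) = u * NormedSpace.exp ((2 * Real.pi * Complex.I) • A0) * (u⁻¹ : Rˣ) := by
  obtain ⟨δ, hδ, hδ1, Zl, Zr, hZl, hZr, hp, hm⟩ := local_sols hA0 one_pos hB hA
  have hsubl : slitL (x:ℂ) δ ⊆ Dom (Ioo (x-1) x) := by
    intro z hz
    rcases ne_or_eq z.im 0 with h | h
    · exact Or.inl h
    · right
      have h1 := hz.1
      have h2 := hz.2
      rw [Complex.mem_slitPlane_iff] at h2
      simp [h] at h2
      rw [mem_ball_zero_iff] at h1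
      have h3 := (Complex.abs_re_le_norm _).trans_lt h1
      simp at h3
      rw [abs_lt] at h3
      constructor <;> linarith
  have hsubr : slitR (x:ℂ) δ ⊆ Dom (Ioo x (x+1)) := by
    intro z hz
    rcases ne_or_eq z.im 0 with h | h
    · exact Or.inl h
    · right
      have h1 := hz.1
      have h2 := hz.2
      rw [Complex.mem_slitPlane_iff] at h2
      simp [h] at h2
      rw [mem_ball_zero_iff] at h1
      have h3 := (Complex.abs_re_le_norm _).trans_lt h1
      simp at h3
      rw [abs_lt] at h3
      constructor <;> linarith
  have hpos : ∀ s : ℂ, s.im ≠ 0 → ‖s‖ = 1 → (x:ℂ) + (δ/2:ℝ) * s ∈ slitL (x:ℂ) δ ∧ (x:ℂ) + (δ/2:ℝ) * s ∈ slitR (x:ℂ) δ := by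
    intro s hs hs1
    have hn : ‖((δ/2:ℝ):ℂ) * s‖ < δ := by
      rw [norm_mul, hs1, Complex.norm_real, Real.norm_of_nonneg (by positivity)]; linarith
    have him : (((δ/2:ℝ):ℂ) * s).im ≠ 0 := by
      rw [Complex.im_ofReal_mul]; positivity
    simp only [slitL, slitR, mem_ofPred_eq, add_sub_cancel_left]
    refine ⟨⟨?_, ?_⟩, ?_, ?_⟩
    · rw [mem_ball_zero_iff, norm_neg]; exact hn
    · rw [Complex.mem_slitPlane_iff]; right; simpa using him
    · rw [mem_ball_zero_iff]; exact hn
    · rw [Complex.mem_slitPlane_iff]; right; exact him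
  obtain ⟨hpl, hpr⟩ := hpos Complex.I (by simp) (by simp)
  obtain ⟨hml, hmr⟩ := hpos (-Complex.I) (by simp) (by simp)
  set zp : ℂ := (x:ℂ) + (δ/2:ℝ) * Complex.I with hzp
  set zm : ℂ := (x:ℂ) + (δ/2:ℝ) * (-Complex.I) with hzm
  have hzp0 : 0 < zp.im := by simp [hzp]; positivity
  have hzm0 : zm.im < 0 := by simp [hzm]; positivity
  obtain ⟨Kl, hKl⟩ := Sol.ratio (slitL_open _ _) (slitL_conn _ hδ) hpl hZl (hl.mono hsubl)
  obtain ⟨Kr, hKr⟩ := Sol.ratio (slitR_open _ _) (slitR_conn _ hδ) hpr hZr (hr.mono hsubr)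
  obtain ⟨Tp, hTp⟩ := Sol.ratio upper_open upper_conn hzp0 (hl.mono (fun z hz => Or.inl (ne_of_gt hz))) (hr.mono (fun z hz => Or.inl (ne_of_gt hz)))
  obtain ⟨Tm, hTm⟩ := Sol.ratio lower_open lower_conn hzm0 (hl.mono (fun z hz => Or.inl (ne_of_lt hz))) (hr.mono (fun z hz => Or.inl (ne_of_lt hz)))
  refine ⟨Tp, Tm, Kl⁻¹, hTp, hTm, ?_⟩
  have e1 : (Kl:R) * Tp = NormedSpace.exp ((Real.pi * Complex.I) • A0) * Kr := by
    have := hTp zp hzp0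
    rw [hKr zp hpr, hKl zp hpl, hp zp (by simpa using hzp0), mul_assoc, mul_assoc] at this
    exact ((hZl zp hpl).2.mul_left_cancel this).symm
  have e2 : (Kl:R) * Tm = NormedSpace.exp (-((Real.pi * Complex.I) • A0)) * Kr := by
    have := hTm zm hzm0
    rw [hKr zm hmr, hKl zm hml, hm zm (by simpa using hzm0), mul_assoc, mul_assoc] at this
    exact ((hZl zm hml).2.mul_left_cancel this).symm
  set E := NormedSpace.exp ((Real.pi * Complex.I) • A0) with hE
  have hEE : NormedSpace.exp ((2 * Real.pi * Complex.I) • A0) = E * E := by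
    rw [hE, ← exp_add' (Commute.refl _), ← add_smul]; congr 2; ring
  have hEi : E * NormedSpace.exp (-((Real.pi * Complex.I) • A0)) = 1 := by
    rw [hE, ← exp_add' (Commute.refl _).neg_right, add_neg_cancel, NormedSpace.exp_zero]
  have e3 : E * E * ((Kl:R) * Tm) = (Kl:R) * Tp := by
    rw [e1, e2, mul_assoc E E, ← mul_assoc E _ (Kr:R), hEi, one_mul]
  rw [hEE, inv_inv, Units.mul_inv_eq_iff_eq_mul]
  rw [mul_assoc, mul_assoc, Units.eq_inv_mul_iff_mul_eq, e3]

lemma telescoping {G : Type*} [Group G] (S : ℕ → G) (k : ℕ) :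
    (List.ofFn (fun j : Fin k => (S j)⁻¹ * S (j+1))).prod = (S 0)⁻¹ * S k := by
  induction k with
  | zero => simp
  | succ k ih =>
    rw [List.ofFn_succ']
    simp [List.concat_eq_append, ih]

theorem monodromy (k : ℕ) (A : ℂ → R) (A0 : ℕ → R)
    (hA0 : ∀ j < k, ∀ m : ℕ, 1 ≤ m → ∀ X : R, A0 j * X - X * A0 j = (m:ℂ) • X → X = 0)
    (B : ℕ → ℂ → R) (hB : ∀ j < k, DifferentiableOn ℂ (B j) (Metric.ball 0 1))
    (hA : ∀ j < k, ∀ z : ℂ, z ≠ (j:ℝ) → z - (j:ℝ) ∈ Metric.ball (0:ℂ) 1 → A z = (z - (j:ℝ))⁻¹ • A0 j + B j (z - (j:ℝ)))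
    (Y : ℕ → ℂ → R) (hY : ∀ i ≤ k, Sol A (Dom (Ioo ((i:ℝ)-1) i)) (Y i)) (hk : Y k = Y 0) :
    ∃ M : Fin k → Rˣ, (∀ j, ∃ u : Rˣ, (M j : R) = u * NormedSpace.exp ((2 * Real.pi * Complex.I) • A0 j) * (u⁻¹ : Rˣ)) ∧
      (List.ofFn M).prod = 1 := by
  have h1 : ∀ j : ℕ, ∃ Tp Tm u : Rˣ, j < k → (∀ z : ℂ, 0 < z.im → Y (j+1) z = Y j z * Tp) ∧ (∀ z : ℂ, z.im < 0 → Y (j+1) z = Y j z * Tm) ∧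
      (Tp:R) * (Tm⁻¹ : Rˣ) = u * NormedSpace.exp ((2 * Real.pi * Complex.I) • A0 j) * (u⁻¹ : Rˣ) := by
    intro j
    by_cases hj : j < k
    · obtain ⟨Tp, Tm, u, h⟩ := cross (hA0 j hj) (x := (j:ℝ)) (hB j hj) (hA j hj) (hY j hj.le) (by
        have := hY (j+1) hj
        simpa using this)
      exact ⟨Tp, Tm, u, fun _ => h⟩
    · exact ⟨1, 1, 1, fun h => absurd h hj⟩
  choose Tp Tm u h using h1
  let Qp : ℕ → Rˣ := fun i => Nat.rec 1 (fun j q => q * Tp j) i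
  let Qm : ℕ → Rˣ := fun i => Nat.rec 1 (fun j q => q * Tm j) i
  have hQp : ∀ i ≤ k, ∀ z : ℂ, 0 < z.im → Y i z = Y 0 z * (Qp i).val := by
    intro i
    induction i with
    | zero => intro _ z _; simp [Qp]
    | succ i ih =>
      intro hi z hz
      rw [(h i (by omega)).1 z hz, ih (by omega) z hz, mul_assoc]; simp [Qp]
  have hQm : ∀ i ≤ k, ∀ z : ℂ, z.im < 0 → Y i z = Y 0 z * (Qm i).val := by
    intro i
    induction i with
    | zero => intro _ z _; simp [Qm]
    | succ i ih =>
      intro hi z hz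
      rw [(h i (by omega)).2.1 z hz, ih (by omega) z hz, mul_assoc]; simp [Qm]
  have hp1 : Qp k = 1 := by
    have h2 := hQp k le_rfl Complex.I (by simp)
    rw [hk] at h2
    have hu : IsUnit (Y 0 Complex.I) := (hY 0 (by omega) _ (Or.inl (by simp))).2
    ext
    refine hu.mul_left_cancel ?_
    rw [← h2]; simp
  have hm1 : Qm k = 1 := by
    have h2 := hQm k le_rfl (-Complex.I) (by simp)
    rw [hk] at h2
    have hu : IsUnit (Y 0 (-Complex.I)) := (hY 0 (by omega) _ (Or.inl (by simp))).2
    ext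
    refine hu.mul_left_cancel ?_
    rw [← h2]; simp
  let S : ℕ → Rˣ := fun i => Qp i * (Qm i)⁻¹
  refine ⟨fun j => (S j)⁻¹ * S (j+1), fun j => ⟨Qm j * u j, ?_⟩, ?_⟩
  · have h3 := (h j j.2).2.2
    have e : (S j)⁻¹ * S (j+1) = Qm j * (Tp j * (Tm j)⁻¹) * (Qm j)⁻¹ := by
      simp only [S, Qp, Qm]
      group
    show (((S j)⁻¹ * S (j+1) : Rˣ) : R) = _
    rw [e, Units.val_mul, Units.val_mul, Units.val_mul (Tp j), h3]
    simp only [Units.val_mul, _root_.mul_inv_rev]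
    simp only [mul_assoc]
  · rw [telescoping]
    simp [S, hp1, hm1, Qp, Qm]
end
end RH
end

section
open Set Filter Topology

namespace RH

lemma Dom_open {I : Set ℝ} (hI : IsOpen I) : IsOpen (Dom I) := by
  have h1 : IsOpen {z : ℂ | z.im ≠ 0} := isOpen_ne_fun Complex.continuous_im continuous_const
  exact h1.union (hI.preimage Complex.continuous_re)

lemma Dom_star {I : Set ℝ} (hI : Convex ℝ I) {x : ℝ} (hx : x ∈ I) : StarConvex ℝ (x:ℂ) (Dom I) := by
  intro z hz a b ha hb hab
  rcases hb.eq_or_lt with h | h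
  · right
    obtain rfl : b = 0 := h.symm
    obtain rfl : a = 1 := by linarith
    simpa using hx
  · rcases hz with hz | hz
    · left
      simpa using ⟨h.ne', hz⟩
    · right
      have := hI hx hz ha hb hab
      simpa using this

section
variable {R : Type*} [NormedRing R] [NormedAlgebra ℂ R] [FiniteDimensional ℂ R] [CompleteSpace R] [NormOneClass R]
  [IsDedekindFiniteMonoid R]

lemma outer (P : R) (hP : P * P = P) {A B : ℂ → R} {V : Set ℂ} {c : ℝ} (hc : 0 < c)
    (hV0 : ∀ z ∈ V, z ≠ 0) (hVc : ∀ z ∈ V, z⁻¹ ∈ Dom (Iio c))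
    (hB : DifferentiableOn ℂ B (Dom (Iio c)))
    (hAB : ∀ z ∈ V, P - (z^2)⁻¹ • ((z • P + (1 - P)) * B z⁻¹) = A z * (z • P + (1 - P))) :
    ∃ Y, Sol A V Y := by
  obtain ⟨Y, hY⟩ := fund_exists (Dom_open isOpen_Iio) (Or.inr (by simpa using hc)) (Dom_star (convex_Iio c) (x := 0) hc) hB
  refine ⟨fun z => (z • P + (1 - P)) * Y z⁻¹, fun z hz => ⟨?_, ?_⟩⟩
  · have h0 := hV0 z hz
    have h1 : HasDerivAt (fun z : ℂ => z • P + (1 - P)) P z := by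
      have := ((hasDerivAt_id z).smul_const P).add_const (1 - P)
      simpa using this
    have h2 : HasDerivAt (fun z : ℂ => Y z⁻¹) ((-(z^2)⁻¹) • (B z⁻¹ * Y z⁻¹)) z :=
      (hY z⁻¹ (hVc z hz)).1.scomp z (hasDerivAt_inv h0)
    refine (h1.mul h2).congr_deriv ?_
    rw [← mul_assoc (A z), ← hAB z hz]
    simp only [sub_mul, neg_smul, mul_neg, smul_mul_assoc, mul_smul_comm, mul_assoc]
    abel
  · refine IsUnit.mul ?_ (hY z⁻¹ (hVc z hz)).2
    have h0 := hV0 z hz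
    have hP2 : P * (1 - P) = 0 := by rw [mul_sub, hP, mul_one, sub_self]
    have hP3 : (1 - P) * P = 0 := by rw [sub_mul, hP, one_mul, sub_self]
    have hP4 : (1 - P) * (1 - P) = 1 - P := by rw [mul_sub, hP3, mul_one, sub_zero]
    refine ⟨⟨z • P + (1 - P), z⁻¹ • P + (1 - P), ?_, ?_⟩, rfl⟩
    · simp only [add_mul, mul_add, hP, smul_mul_assoc, mul_smul_comm, hP2, hP3, hP4]
      rw [add_zero, smul_zero, zero_add]
      first | rw [inv_smul_smul₀ h0] | rw [smul_inv_smul₀ h0]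
      abel
    · simp only [add_mul, mul_add, hP, smul_mul_assoc, mul_smul_comm, hP2, hP3, hP4]
      rw [add_zero, smul_zero, zero_add]
      first | rw [inv_smul_smul₀ h0] | rw [smul_inv_smul₀ h0]
      abel

theorem rh_abs (k : ℕ) (hk : 2 ≤ k) (A0 : ℕ → R) (C : ℕ → R) (P : R) (hP : P * P = P)
    (hA0 : ∀ j < k, ∀ m : ℕ, 1 ≤ m → ∀ X : R, A0 j * X - X * A0 j = (m:ℂ) • X → X = 0)
    (hAC : ∀ z : ℂ, z ≠ 0 → (∀ j < k, z ≠ (j:ℂ)) → P - (z^2)⁻¹ • ((z • P + (1 - P)) * ∑ j ∈ Finset.range k, (1 - j * z⁻¹)⁻¹ • C j)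
       = (∑ j ∈ Finset.range k, (z - j)⁻¹ • A0 j) * (z • P + (1 - P))) :
    ∃ M : Fin k → Rˣ, (∀ j, ∃ u : Rˣ, (M j : R) = u * NormedSpace.exp ((2 * Real.pi * Complex.I) • A0 j) * (u⁻¹ : Rˣ)) ∧
      (List.ofFn M).prod = 1 := by
  set A : ℂ → R := fun z => ∑ j ∈ Finset.range k, (z - j)⁻¹ • A0 j with hA
  have hk0 : (0:ℝ) < k - 1 := by have : (2:ℝ) ≤ k := by exact_mod_cast hk
                                 linarith
  -- outer solution
  obtain ⟨Yo, hYo⟩ := outer P hP (A := A) (B := fun w => ∑ j ∈ Finset.range k, (1 - j * w)⁻¹ • C j)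
    (V := Dom (Iio 0 ∪ Ioi ((k:ℝ)-1))) (c := ((k:ℝ)-1)⁻¹) (by positivity)
    (by
      rintro z hz rfl
      rcases hz with h | h | h
      · simp at h
      · simp at h
      · simp at h; linarith)
    (by
      intro z hz
      rcases ne_or_eq z.im 0 with h | h
      · left
        rw [Complex.inv_im]
        have : Complex.normSq z ≠ 0 := by
          rw [Complex.normSq_apply]; have := mul_self_pos.2 h; have := mul_self_nonneg z.re; positivity
        exact div_ne_zero (neg_ne_zero.2 h) this
      · right
        obtain ⟨x, rfl⟩ : ∃ x : ℝ, z = x := ⟨z.re, Complex.ext rfl h⟩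
        rcases hz with hz | hz | hz
        · exact absurd h hz
        · rw [← Complex.ofReal_inv, Complex.ofReal_re, mem_Iio]
          have : x < 0 := hz
          have h2 : x⁻¹ < 0 := inv_lt_zero.2 this
          have : 0 < ((k:ℝ)-1)⁻¹ := by positivity
          linarith
        · rw [← Complex.ofReal_inv, Complex.ofReal_re, mem_Iio]
          exact inv_strictAnti₀ hk0 hz)
    (by
      refine DifferentiableOn.fun_sum fun j hj => ?_
      intro w hw
      refine DifferentiableAt.differentiableWithinAt ?_
      refine DifferentiableAt.smul_const ?_ _
      refine DifferentiableAt.inv (by fun_prop) ?_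
      intro h0
      rw [Finset.mem_range] at hj
      have hj0 : (j:ℂ) ≠ 0 := by rintro h; rw [h] at h0; simp at h0
      have hw' : w = ((j:ℝ)⁻¹ : ℝ) := by
        push_cast
        exact eq_inv_of_mul_eq_one_left (by linear_combination -h0)
      rcases hw with h | h
      · rw [hw'] at h; simp only [Complex.ofReal_im, ne_eq, not_true_eq_false] at h
      · rw [hw', Complex.ofReal_re, mem_Iio] at h
        have hj' : (j:ℝ) ≤ k - 1 := by
          have : (j:ℝ) + 1 ≤ k := by exact_mod_cast hj
          linarith
        have hjp : (0:ℝ) < j := by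
          have : j ≠ 0 := by exact_mod_cast hj0
          positivity
        have := inv_anti₀ hjp hj'
        linarith)
    (by
      intro z hz
      refine hAC z ?_ ?_
      · rintro rfl
        rcases hz with h | h | h
        · simp at h
        · simp at h
        · simp at h; linarith
      · rintro j hj rfl
        rcases hz with h | h | h
        · simp at h
        · simp at h
          linarith [(Nat.cast_nonneg j : (0:ℝ) ≤ j)]
        · simp at h
          have : (j:ℝ) + 1 ≤ k := by exact_mod_cast hj
          linarith)
  have hgap : ∀ i : ℕ, ∃ Y, Sol A (Dom (Ioo ((i:ℝ)-1) i)) Y := by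
    intro i
    refine fund_exists (z0 := (((i:ℝ) - 1/2 : ℝ) : ℂ)) (Dom_open isOpen_Ioo) (Or.inr ?_) (Dom_star (convex_Ioo _ _) ?_) ?_
    · rw [Complex.ofReal_re]; constructor <;> linarith
    · constructor <;> linarith
    · refine DifferentiableOn.fun_sum fun j hj => ?_
      intro w hw
      refine DifferentiableAt.differentiableWithinAt ?_
      refine DifferentiableAt.smul_const ?_ _
      refine DifferentiableAt.inv (by fun_prop) ?_
      intro h0
      rw [sub_eq_zero] at h0
      subst h0
      rcases hw with h | h
      · simp at h
      · simp at h
        have h1 : i < j + 1 := by have := h.1; exact_mod_cast (by linarith : (i:ℝ) < j + 1)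
        have h2 := h.2
        omega
  choose Yg hYg using hgap
  refine monodromy k A A0 hA0 (fun j z => ∑ i ∈ (Finset.range k).erase j, (z + j - i)⁻¹ • A0 i) ?_ ?_
    (fun i => if i = 0 ∨ i = k then Yo else Yg i) ?_ (by simp)
  · intro j hj
    refine DifferentiableOn.fun_sum fun i hi => ?_
    intro w hw
    refine DifferentiableAt.differentiableWithinAt ?_
    refine DifferentiableAt.smul_const ?_ _
    refine DifferentiableAt.inv (by fun_prop) ?_
    intro h0
    have hw' : w = (((i:ℤ) - j : ℤ) : ℂ) := by push_cast; linear_combination h0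
    rw [hw', mem_ball_zero_iff, Complex.norm_intCast] at hw
    have hne : i ≠ j := (Finset.mem_erase.1 hi).1
    have : (1:ℤ) ≤ |(i:ℤ) - j| := Int.one_le_abs (by omega)
    rw [← Int.cast_abs] at hw
    have hw2 : |(i:ℤ) - j| < 1 := by exact_mod_cast hw
    omega
  · intro j hj z hz hb
    simp only [hA]
    rw [← Finset.add_sum_erase _ _ (Finset.mem_range.2 hj)]
    simp
  · intro i hi
    by_cases h : i = 0 ∨ i = k
    · simp only [h, if_true]
      refine hYo.mono ?_
      rintro z (hz | hz)
      · exact Or.inl hz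
      · right
        rcases h with rfl | rfl
        · left; simpa using hz.2
        · right; exact hz.1
    · simp only [h, if_false]
      exact hYg i
end

open scoped Matrix.Norms.Operator in
/-- Riemann–Hilbert: monodromy of a Fuchsian system on `O(1)^d + O^(n-d)`. -/
theorem rh (n k : ℕ) (hn : 0 < n) (hk : 2 ≤ k) (A : Fin k → Matrix (Fin n) (Fin n) ℂ) (S : Fin n → Prop) [DecidablePred S]
    (hA0 : ∀ j, ∀ m : ℕ, 1 ≤ m → ∀ X : Matrix (Fin n) (Fin n) ℂ, A j * X - X * A j = (m:ℂ) • X → X = 0)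
    (h1 : ∀ a b, (S a ↔ S b) → ∑ j, A j a b = if a = b ∧ S a then 1 else 0)
    (h2 : ∀ a b, ¬ S a → S b → ∑ j, A j a b = 0)
    (h3 : ∀ a b, ¬ S a → S b → ∑ j : Fin k, ((j:ℕ):ℂ) * A j a b = 0) :
    ∃ M : Fin k → Matrix (Fin n) (Fin n) ℂ,
      (∀ j, ∃ u : (Matrix (Fin n) (Fin n) ℂ)ˣ, M j = u.val * NormedSpace.exp ((2 * Real.pi * Complex.I) • A j) * (u⁻¹).val) ∧
      (List.ofFn M).prod = 1 := by
  haveI : Nonempty (Fin n) := ⟨⟨0, hn⟩⟩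
  let c : Fin n → Fin n → ℕ → ℂ := fun a b j => if S a then (if S b then j else 1) else (if S b then (j:ℂ)^2 else j)
  let A0 : ℕ → Matrix (Fin n) (Fin n) ℂ := fun j => if h : j < k then A ⟨j, h⟩ else 0
  have hA0j : ∀ j : Fin k, A0 j = A j := fun j => by simp [A0]
  have hsum : ∀ (f : ℕ → ℂ) (a b : Fin n), ∑ j ∈ Finset.range k, f j * A0 j a b = ∑ j : Fin k, f j * A j a b := by
    intro f a b
    rw [Finset.sum_range]
    simp only [hA0j]
  obtain ⟨M, hM, hprod⟩ := rh_abs k hk A0 (fun j => Matrix.of fun a b => - (c a b j * A0 j a b))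
    (Matrix.diagonal fun a => if S a then 1 else 0) (by
      rw [Matrix.diagonal_mul_diagonal]; congr 1; ext a; split_ifs <;> simp) (by
      intro j hj
      simp only [A0, hj, dif_pos]
      exact hA0 ⟨j, hj⟩) (by
      intro z hz hzj
      have hG : z • (Matrix.diagonal fun a => if S a then (1:ℂ) else 0) + (1 - (Matrix.diagonal fun a => if S a then (1:ℂ) else 0)) = 
        Matrix.diagonal fun a : Fin n => if S a then z else 1 := by
        ext a b
        by_cases hab : a = b
        · subst hab; by_cases h : S a <;> simp [h]
        · simp [hab]
      rw [hG]
      ext a b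
      simp only [Matrix.sub_apply, Matrix.smul_apply, Matrix.diagonal_mul, Matrix.mul_diagonal, Matrix.sum_apply, Matrix.of_apply, smul_eq_mul, Matrix.diagonal_apply]
      simp only [mul_neg, ← mul_assoc]
      rw [hsum (fun j => (z - j)⁻¹) a b]
      rw [Finset.sum_neg_distrib, hsum (fun j => (1 - j * z⁻¹)⁻¹ * c a b j) a b]
      have hzj' : ∀ j : Fin k, z - (j:ℕ) ≠ 0 := fun j => sub_ne_zero.2 (hzj j j.2)
      have hinv : ∀ j : Fin k, (1 - (j:ℕ) * z⁻¹)⁻¹ = z * (z - (j:ℕ))⁻¹ := by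
        intro j
        have := hzj' j
        rw [show 1 - ((j:ℕ):ℂ) * z⁻¹ = (z - (j:ℕ)) * z⁻¹ by field_simp, mul_inv, inv_inv, mul_comm]
      simp only [hinv]
      by_cases hSa : S a <;> by_cases hSb : S b
      · have e := h1 a b (by simp [hSa, hSb])
        simp only [hSa, hSb, if_true, c, and_true] at e ⊢
        rw [← e, Finset.sum_mul, mul_neg, Finset.mul_sum, sub_neg_eq_add, ← Finset.sum_add_distrib]
        refine Finset.sum_congr rfl fun j _ => ?_
        have := hzj' j
        field_simp
        ring
      · simp only [hSa, hSb, if_true, if_false, c]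
        have hab : a ≠ b := fun h => by subst h; exact hSb hSa
        simp only [hab, if_false]
        rw [Finset.sum_mul, mul_neg, Finset.mul_sum, zero_sub, neg_neg]
        refine Finset.sum_congr rfl fun j _ => ?_
        have := hzj' j
        field_simp
      · have e2 := h2 a b hSa hSb
        have e3 := h3 a b hSa hSb
        simp only [hSa, hSb, if_true, if_false, c]
        have hab : a ≠ b := fun h => by subst h; exact hSa hSb
        simp only [hab, if_false]
        have e4 : (∑ j : Fin k, (z - (j:ℕ))⁻¹ * A j a b) * z = (∑ j : Fin k, (z - (j:ℕ))⁻¹ * A j a b) * z - ∑ j, A j a b - z⁻¹ * ∑ j : Fin k, ((j:ℕ):ℂ) * A j a b := by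
          rw [e2, e3]; simp
        rw [e4, Finset.sum_mul, mul_neg, Finset.mul_sum, Finset.mul_sum, zero_sub, neg_neg, ← Finset.sum_sub_distrib, ← Finset.sum_sub_distrib]
        refine Finset.sum_congr rfl fun j _ => ?_
        have := hzj' j
        field_simp
        ring
      · have e := h1 a b (by simp [hSa, hSb])
        simp only [hSa, hSb, if_false, c, and_false] at e ⊢
        have e4 : (∑ j : Fin k, (z - (j:ℕ))⁻¹ * A j a b) * 1 = (∑ j : Fin k, (z - (j:ℕ))⁻¹ * A j a b) - z⁻¹ * ∑ j, A j a b := by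
          rw [e]; simp
        rw [e4, mul_neg, Finset.mul_sum, Finset.mul_sum, ← Finset.sum_sub_distrib]
        simp only [ite_self, zero_sub, neg_neg]
        refine Finset.sum_congr rfl fun j _ => ?_
        have := hzj' j
        field_simp
        ring)
  refine ⟨fun j => (M j).val, fun j => ?_, ?_⟩
  · obtain ⟨u, hu⟩ := hM j
    exact ⟨u, by show (M j).val = _; rw [hu, hA0j]; rfl⟩
  · have := congrArg Units.val hprod
    rw [← Units.coeHom_apply, map_list_prod, List.map_ofFn] at this
    simpa [Function.comp_def] using this
end RH
end

section
open Set Filter Topology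
namespace RH
section small
variable {R : Type*} [NormedRing R] [NormedAlgebra ℂ R] [FiniteDimensional ℂ R]

/-- Sets of dimension less than the full dimension. -/
def Small (X : Set R) : Prop := dimH X ≤ ((2 * Module.finrank ℂ R - 1 : ℕ) : ENNReal)

theorem Small.mono {X Y : Set R} (h : X ⊆ Y) (hY : Small Y) : Small X := (dimH_mono h).trans hY

theorem small_iUnion {ι : Type*} [Countable ι] {X : ι → Set R} (h : ∀ i, Small (X i)) : Small (⋃ i, X i) := by
  unfold Small
  rw [dimH_iUnion]
  exact iSup_le h

theorem small_biUnion {ι : Type*} {T : Set ι} (hT : T.Countable) {X : ι → Set R} (h : ∀ i ∈ T, Small (X i)) : Small (⋃ i ∈ T, X i) := by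
  unfold Small
  rw [dimH_bUnion hT]
  exact iSup₂_le h

theorem small_range {E : Type*} [NormedAddCommGroup E] [NormedSpace ℂ E] [FiniteDimensional ℂ E]
    {F : E → R} (hF : ContDiff ℝ 1 F) (h : Module.finrank ℂ E < Module.finrank ℂ R) : Small (range F) := by
  have : FiniteDimensional ℝ E := FiniteDimensional.complexToReal E
  refine hF.dimH_range_le.trans ?_
  rw [finrank_real_of_complex]
  exact_mod_cast (by omega)

theorem exists_unit_not_mem [Nontrivial R] {X : Set R} (hX : Small X) : ∃ g : Rˣ, (g : R) ∉ X := by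
  have : FiniteDimensional ℝ R := FiniteDimensional.complexToReal R
  have : CompleteSpace R := FiniteDimensional.complete ℂ R
  have hpos : 0 < Module.finrank ℂ R := Module.finrank_pos
  have hd : Dense Xᶜ := by
    refine dense_compl_of_dimH_lt_finrank (hX.trans_lt ?_)
    rw [finrank_real_of_complex]
    exact_mod_cast (by omega)
  obtain ⟨x, ⟨g, rfl⟩, hx2⟩ := hd.inter_open_nonempty {x : R | IsUnit x} Units.isOpen ⟨1, isUnit_one⟩
  exact ⟨g, hx2⟩
end small

section chart
variable {R : Type*} [NormedRing R] [NormedAlgebra ℂ R] [FiniteDimensional ℂ R]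

theorem inv_mem_subalgebra (B : Subalgebra ℂ R) (u : Rˣ) (hu : (u:R) ∈ B) : ((u⁻¹ : Rˣ) : R) ∈ B := by
  let f : B →ₗ[ℂ] B := LinearMap.mulLeft ℂ (⟨u, hu⟩ : B)
  have hf : Function.Injective f := by
    intro x y hxy
    have := congrArg (fun z : B => ((u⁻¹ : Rˣ) : R) * z) hxy
    simpa [f] using this
  obtain ⟨z, hz⟩ := (LinearMap.injective_iff_surjective.1 hf) 1
  have : (u : R) * z = 1 := congrArg Subtype.val hz
  rw [Units.inv_eq_of_mul_eq_one_right this]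
  exact z.2

/-- Gauss decomposition relative to an idempotent. -/
theorem gauss (B : Subalgebra ℂ R) (D : R) (hD : D * D = D) (hDB : D ∈ B) (y a : Rˣ) (hy : (y:R) ∈ B)
    (ha : (a : R) = D * y * D + (1 - D)) :
    ∃ N M : R, ∃ c : Rˣ, N ∈ B ∧ M ∈ B ∧ (c:R) ∈ B ∧ N = (1 - D) * N * D ∧ M = D * M * (1 - D) ∧
      (c:R) * D = D * c ∧ (y:R) = (1 + N) * (1 + M) * c := by
  have h1D : (1 - D) ∈ B := B.sub_mem B.one_mem hDB
  have haB : (a:R) ∈ B := by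
    rw [ha]; exact B.add_mem (B.mul_mem (B.mul_mem hDB hy) hDB) h1D
  have haB' := inv_mem_subalgebra B a haB
  have hD2 : D * (1 - D) = 0 := by rw [mul_sub, hD, mul_one, sub_self]
  have hD3 : (1 - D) * D = 0 := by rw [sub_mul, hD, one_mul, sub_self]
  have hD4 : (1 - D) * (1 - D) = 1 - D := by rw [mul_sub, hD3, mul_one, sub_zero]
  -- commutation of a with D
  have haD : (a:R) * D = D * y * D := by rw [ha, add_mul, hD3, add_zero, mul_assoc, mul_assoc, hD, mul_assoc]
  have hDa : D * (a:R) = D * y * D := by rw [ha, mul_add, hD2, add_zero, ← mul_assoc, ← mul_assoc, hD]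
  have hcom : D * ((a⁻¹ : Rˣ) : R) = ((a⁻¹ : Rˣ) : R) * D := by
    have : (a:R) * D = D * a := haD.trans hDa.symm
    rw [Units.eq_inv_mul_iff_mul_eq, ← mul_assoc, this, mul_assoc, Units.mul_inv, mul_one]
  set ai : R := ((a⁻¹ : Rˣ) : R) with hai
  have hcom' : (1 - D) * ai = ai * (1 - D) := by rw [sub_mul, mul_sub, hcom, one_mul, mul_one]
  set N : R := (1 - D) * y * D * ai with hN
  set Q : R := ai * D * y * (1 - D) with hQ
  have hNN : N * N = 0 := by
    rw [hN]
    calc (1 - D) * y * D * ai * ((1 - D) * y * D * ai) = (1 - D) * y * D * (ai * (1 - D)) * (y * D * ai) := by noncomm_ring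
      _ = (1 - D) * y * (D * (1 - D)) * ai * (y * D * ai) := by rw [← hcom']; noncomm_ring
      _ = 0 := by rw [hD2]; simp
  have hQQ : Q * Q = 0 := by
    rw [hQ]
    calc ai * D * y * (1 - D) * (ai * D * y * (1 - D)) = ai * D * y * ((1 - D) * ai) * (D * y * (1 - D)) := by noncomm_ring
      _ = ai * D * y * ai * ((1 - D) * D) * (y * (1 - D)) := by rw [hcom']; noncomm_ring
      _ = 0 := by rw [hD3]; simp
  have hNB : N ∈ B := B.mul_mem (B.mul_mem (B.mul_mem h1D hy) hDB) haB'
  have hQB : Q ∈ B := B.mul_mem (B.mul_mem (B.mul_mem haB' hDB) hy) h1D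
  have hN1 : N = (1 - D) * N * D := by
    rw [hN, show (1 - D) * ((1 - D) * y * D * ai) * D = ((1 - D) * (1 - D)) * y * D * (ai * D) by noncomm_ring, hD4, ← hcom,
      show (1 - D) * (y:R) * D * (D * ai) = (1 - D) * y * (D * D) * ai by noncomm_ring, hD]
  have hQ1 : Q = D * Q * (1 - D) := by
    rw [hQ, show D * (ai * D * y * (1 - D)) * (1 - D) = (D * ai) * D * y * ((1 - D) * (1 - D)) by noncomm_ring, hD4, hcom,
      show ai * D * D * (y:R) * (1 - D) = ai * (D * D) * y * (1 - D) by noncomm_ring, hD]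
  let u : Rˣ := ⟨1 - N, 1 + N, by rw [sub_mul, mul_add, one_mul, mul_add, hNN]; simp, by rw [add_mul, mul_sub, one_mul, mul_sub, hNN]; simp⟩
  let v : Rˣ := ⟨1 - Q, 1 + Q, by rw [sub_mul, mul_add, one_mul, mul_add, hQQ]; simp, by rw [add_mul, mul_sub, one_mul, mul_sub, hQQ]; simp⟩
  let c : Rˣ := u * y * v
  have hc : (c:R) = (1 - N) * y * (1 - Q) := rfl
  have hcB : (c:R) ∈ B := by
    rw [hc]; exact B.mul_mem (B.mul_mem (B.sub_mem B.one_mem hNB) hy) (B.sub_mem B.one_mem hQB)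
  -- off-diagonal parts vanish
  have hND : N * D * y * D = (1 - D) * y * D := by
    have : N * a = (1 - D) * y * D := by rw [hN, mul_assoc, Units.inv_mul, mul_one]
    rw [← this, ha]
    have hN0 : N * (1 - D) = 0 := by rw [hN1, mul_assoc, hD2, mul_zero]
    rw [mul_add, hN0, add_zero]; noncomm_ring
  have hDQ : D * y * D * Q = D * y * (1 - D) := by
    have : a * Q = D * y * (1 - D) := by rw [hQ, ← mul_assoc, ← mul_assoc, ← mul_assoc, Units.mul_inv, one_mul]
    rw [← this, ha]
    have hQ0 : (1 - D) * Q = 0 := by rw [hQ1, ← mul_assoc, ← mul_assoc, hD3, zero_mul, zero_mul]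
    rw [add_mul, hQ0, add_zero]
  have hDN : D * N = 0 := by rw [hN1, ← mul_assoc, ← mul_assoc, hD2, zero_mul, zero_mul]
  have hQD : Q * D = 0 := by rw [hQ1, mul_assoc, hD3, mul_zero]
  have hND' : N * D = N := by rw [hN1, mul_assoc, hD]
  have hDQ' : D * Q = Q := by rw [hQ1, ← mul_assoc, ← mul_assoc, hD]
  have hcD : (c:R) * D = D * y * D := by
    rw [hc, mul_assoc, sub_mul 1 Q, hQD, one_mul, sub_zero]
    have : N * y * D = N * D * y * D := by rw [hND']
    rw [sub_mul, sub_mul, this, hND]; noncomm_ring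
  have hDc : D * (c:R) = D * y * D := by
    rw [hc, ← mul_assoc, ← mul_assoc, mul_sub D, hDN, mul_one, sub_zero, mul_sub]
    have : D * y * Q = D * y * D * Q := by rw [mul_assoc _ D Q, hDQ']
    rw [this, hDQ]; noncomm_ring
  have hcc : (c:R) * D = D * c := hcD.trans hDc.symm
  have hcB' := inv_mem_subalgebra B c hcB
  have hci : D * ((c⁻¹ : Rˣ) : R) = ((c⁻¹ : Rˣ) : R) * D := by
    rw [Units.eq_inv_mul_iff_mul_eq, ← mul_assoc, hcc, mul_assoc, Units.mul_inv, mul_one]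
  refine ⟨N, c * Q * ((c⁻¹ : Rˣ) : R), c, hNB, B.mul_mem (B.mul_mem hcB hQB) hcB', hcB, hN1, ?_, hcc, ?_⟩
  · have hci' : ((c⁻¹ : Rˣ) : R) * (1 - D) = (1 - D) * ((c⁻¹ : Rˣ) : R) := by rw [sub_mul, mul_sub, hci, one_mul, mul_one]
    have e1 : Q * (1 - D) = Q := by rw [mul_sub, mul_one, hQD, sub_zero]
    have : D * ((c:R) * Q * ((c⁻¹ : Rˣ) : R)) * (1 - D) = (D * c) * Q * (((c⁻¹ : Rˣ) : R) * (1 - D)) := by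
      simp only [mul_assoc]
    rw [this, hci', ← hcc, mul_assoc (c:R) D Q, hDQ', ← mul_assoc ((c:R) * Q) (1 - D), mul_assoc (c:R) Q (1 - D), e1]
  · have h1 : (y:R) = (1 + N) * c * (1 + Q) := by
      have : y = u⁻¹ * c * v⁻¹ := by simp [c, mul_assoc]
      rw [this]; rfl
    have h2 : (1 + (c:R) * Q * ((c⁻¹ : Rˣ) : R)) * c = c * (1 + Q) := by
      rw [add_mul, one_mul, mul_assoc, Units.inv_mul, mul_one, mul_add, mul_one]
    rw [h1, mul_assoc (1 + N), mul_assoc (1 + N), h2]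

theorem chart (B : Subalgebra ℂ R) (D : R) (hD : D * D = D) (hDB : D ∈ B) :
    ∃ H : Set Rˣ, H.Countable ∧ ∀ x : Rˣ, (x:R) ∈ B → ∃ h ∈ H, ∃ N M : R, ∃ c : Rˣ,
      N ∈ B ∧ M ∈ B ∧ (c:R) ∈ B ∧ N = (1 - D) * N * D ∧ M = D * M * (1 - D) ∧
      (c:R) * D = D * c ∧ (x:R) = h * ((1 + N) * (1 + M) * c) := by
  have : CompleteSpace R := FiniteDimensional.complete ℂ R
  have hsep : TopologicalSpace.SeparableSpace B := by
    have : FiniteDimensional ℝ R := FiniteDimensional.complexToReal R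
    have : ProperSpace R := FiniteDimensional.proper ℝ R
    have : SecondCountableTopology R := inferInstance
    exact inferInstance
  obtain ⟨T, hTc, hTd⟩ := TopologicalSpace.exists_countable_dense B
  refine ⟨{h : Rˣ | ∃ b ∈ T, ((h⁻¹ : Rˣ) : R) = b}, ?_, ?_⟩
  · refine Set.Countable.mono (s₂ := (fun h : Rˣ => (((h⁻¹ : Rˣ) : R))) ⁻¹' ((fun b : B => (b:R)) '' T)) ?_ ?_
    · rintro h ⟨b, hb, hh⟩; exact ⟨b, hb, hh.symm⟩
    · refine Set.Countable.preimage_of_injOn (hTc.image _) ?_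
      intro a _ b _ hab
      exact inv_injective (Units.ext hab)
  · intro x hx
    have hopen : IsOpen {b : B | IsUnit (b:R) ∧ IsUnit (D * ((b:R) * x) * D + (1 - D))} := by
      refine IsOpen.inter ?_ ?_
      · exact Units.isOpen.preimage continuous_subtype_val
      · exact Units.isOpen.preimage (f := fun b : B => D * ((b:R) * x) * D + (1 - D)) (by fun_prop)
    obtain ⟨b, ⟨⟨h, hh⟩, ⟨a, ha⟩⟩, hbT⟩ := hTd.inter_open_nonempty _ hopen
      ⟨⟨((x⁻¹ : Rˣ) : R), inv_mem_subalgebra B x hx⟩, x⁻¹.isUnit, by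
        simp only [Units.inv_mul, mul_one, hD]; simp⟩
    have hy : ((h * x : Rˣ) : R) ∈ B := by
      rw [Units.val_mul, hh]; exact B.mul_mem b.2 hx
    obtain ⟨N, M, c, h1, h2, h3, h4, h5, h6, h7⟩ := gauss B D hD hDB (h * x) a hy (by rw [ha, Units.val_mul, hh])
    refine ⟨h⁻¹, ⟨b, hbT, by rw [inv_inv, hh]⟩, N, M, c, h1, h2, h3, h4, h5, h6, ?_⟩
    rw [← h7]; simp
end chart
end RH
end

section
open Set Filter Topology
namespace RH
section bad
variable {R : Type*} [NormedRing R] [NormedAlgebra ℂ R] [FiniteDimensional ℂ R]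

theorem small_core (h h' : R) (W1 W2 W3 W4 W5 : Submodule ℂ R)
    (hs : Module.finrank ℂ W1 + Module.finrank ℂ W2 + Module.finrank ℂ W3 + Module.finrank ℂ W4 + Module.finrank ℂ W5 < Module.finrank ℂ R) :
    Small {g : R | ∃ M ∈ W1, ∃ N ∈ W2, ∃ y ∈ W3, ∃ M' ∈ W4, ∃ N' ∈ W5,
      g = h * ((1 + N) * (1 + M) * y * ((1 + M') * (1 + N'))) * h'} := by
  have := small_range (R := R) (E := W1 × W2 × W3 × W4 × W5)
    (F := fun x => h * ((1 + (x.2.1 : R)) * (1 + (x.1 : R)) * (x.2.2.1 : R) * ((1 + (x.2.2.2.1 : R)) * (1 + (x.2.2.2.2 : R)))) * h') ?_ ?_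
  · refine this.mono ?_
    rintro g ⟨M, hM, N, hN, y, hy, M', hM', N', hN', rfl⟩
    exact ⟨(⟨M, hM⟩, ⟨N, hN⟩, ⟨y, hy⟩, ⟨M', hM'⟩, ⟨N', hN'⟩), rfl⟩
  · have hc : ∀ W : Submodule ℂ R, ContDiff ℝ 1 (fun x : W => (x : R)) := fun W =>
      ((W.subtypeL).restrictScalars ℝ).contDiff
    have h1 : ContDiff ℝ 1 (fun x : W1 × W2 × W3 × W4 × W5 => (x.1 : R)) := (hc W1).comp contDiff_fst
    have h2 : ContDiff ℝ 1 (fun x : W1 × W2 × W3 × W4 × W5 => (x.2.1 : R)) := (hc W2).comp (contDiff_fst.comp contDiff_snd)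
    have h3 : ContDiff ℝ 1 (fun x : W1 × W2 × W3 × W4 × W5 => (x.2.2.1 : R)) := (hc W3).comp (contDiff_fst.comp (contDiff_snd.comp contDiff_snd))
    have h4 : ContDiff ℝ 1 (fun x : W1 × W2 × W3 × W4 × W5 => (x.2.2.2.1 : R)) :=
      (hc W4).comp (contDiff_fst.comp (contDiff_snd.comp (contDiff_snd.comp contDiff_snd)))
    have h5 : ContDiff ℝ 1 (fun x : W1 × W2 × W3 × W4 × W5 => (x.2.2.2.2 : R)) :=
      (hc W5).comp (contDiff_snd.comp (contDiff_snd.comp (contDiff_snd.comp contDiff_snd)))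
    exact (contDiff_const.mul ((((contDiff_const.add h2).mul (contDiff_const.add h1)).mul h3).mul
      ((contDiff_const.add h4).mul (contDiff_const.add h5)))).mul contDiff_const
  · simp only [Module.finrank_prod]; omega

/-- Off-diagonal part of `B` relative to `D`. -/
def offd (B : Subalgebra ℂ R) (D : R) : Submodule ℂ R where
  carrier := {M | M ∈ B ∧ M = D * M * (1 - D)}
  add_mem' := by
    rintro a b ⟨ha, ha'⟩ ⟨hb, hb'⟩
    refine ⟨B.add_mem ha hb, ?_⟩
    rw [mul_add, add_mul, ← ha', ← hb']
  zero_mem' := ⟨B.zero_mem, by simp⟩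
  smul_mem' := by
    rintro c a ⟨ha, ha'⟩
    refine ⟨B.smul_mem ha c, ?_⟩
    rw [mul_smul_comm, smul_mul_assoc, ← ha']

def intw (D0 D : R) : Submodule ℂ R where
  carrier := {y | D0 * y = y * D}
  add_mem' := by
    intro a b ha hb
    simp only [mem_ofPred_eq] at *
    rw [mul_add, add_mul, ha, hb]
  zero_mem' := by simp
  smul_mem' := by
    intro c a ha
    simp only [mem_ofPred_eq] at *
    rw [mul_smul_comm, smul_mul_assoc, ha]

def Bad (A P : Subalgebra ℂ R) (D0 D : R) : Set R :=
  {g | ∃ x y p : Rˣ, (x:R) ∈ A ∧ (p:R) ∈ P ∧ D0 * y = y * D ∧ g = x * y * p}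

theorem mem_offd {B : Subalgebra ℂ R} {D M : R} : M ∈ offd B D ↔ M ∈ B ∧ M = D * M * (1 - D) := Iff.rfl

theorem bad_swap (A P : Subalgebra ℂ R) (D0 D : R) : Bad A P D0 D ⊆ Bad A P (1 - D0) (1 - D) := by
  rintro g ⟨x, y, p, hx, hp, hy, rfl⟩
  exact ⟨x, y, p, hx, hp, by rw [sub_mul, mul_sub, hy, one_mul, mul_one], rfl⟩

theorem offd_mul {B B' : Subalgebra ℂ R} {D M M' : R} (hD : D * D = D) (h : M ∈ offd B D) (h' : M' ∈ offd B' D) : M * M' = 0 := by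
  rw [mem_offd] at h h'
  have hD2 : D * (1 - D) = 0 := by rw [mul_sub, hD, mul_one, sub_self]
  have hD3 : (1 - D) * D = 0 := by rw [sub_mul, hD, one_mul, sub_self]
  rw [h.2, h'.2, show D * M * (1 - D) * (D * M' * (1 - D)) = D * M * ((1 - D) * D) * (M' * (1 - D)) by simp only [mul_assoc], hD3]
  simp

/-- normal form of bad elements -/
theorem bad_normal (A P : Subalgebra ℂ R) (D0 D : R) (hD0 : D0 * D0 = D0) (hD : D * D = D) (hD0A : D0 ∈ A) (hDP : D ∈ P) :
    ∃ H : Set (Rˣ × Rˣ), H.Countable ∧ ∀ g ∈ Bad A P D0 D, ∃ h ∈ H, ∃ M ∈ offd A D0, ∃ N ∈ offd A (1 - D0), ∃ y : Rˣ,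
      (y:R) ∈ intw D0 D ∧ ∃ M' ∈ offd P D, ∃ N' ∈ offd P (1 - D), g = h.1 * ((1 + N) * (1 + M) * y * ((1 + M') * (1 + N'))) * h.2 := by
  obtain ⟨H1, hH1, h1⟩ := chart A D0 hD0 hD0A
  obtain ⟨H2, hH2, h2⟩ := chart P D hD hDP
  refine ⟨H1 ×ˢ (Inv.inv '' H2), hH1.prod (hH2.image _), ?_⟩
  rintro g ⟨x, y, p, hx, hp, hy, rfl⟩
  obtain ⟨h, hh, N, M, c, a1, a2, a3, a4, a5, a6, a7⟩ := h1 x hx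
  obtain ⟨h', hh', N', M', c', b1, b2, b3, b4, b5, b6, b7⟩ := h2 p⁻¹ (inv_mem_subalgebra P p hp)
  have m1 : M ∈ offd A D0 := ⟨a2, a5⟩
  have m2 : N ∈ offd A (1 - D0) := ⟨a1, by rw [sub_sub_cancel]; exact a4⟩
  have m1' : M' ∈ offd P D := ⟨b2, b5⟩
  have m2' : N' ∈ offd P (1 - D) := ⟨b1, by rw [sub_sub_cancel]; exact b4⟩
  have hD' : (1 - D) * (1 - D) = 1 - D := by rw [mul_sub, mul_one, sub_mul, one_mul, hD, sub_self, sub_zero]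
  have z1 := offd_mul hD m1' m1'
  have z2 := offd_mul hD' m2' m2'
  refine ⟨(h, h'⁻¹), ⟨hh, ⟨h', hh', rfl⟩⟩, M, m1, N, m2, c * y * c'⁻¹, ?_, -M', neg_mem m1', -N', neg_mem m2', ?_⟩
  · show D0 * ((c * y * c'⁻¹ : Rˣ) : R) = ((c * y * c'⁻¹ : Rˣ) : R) * D
    have hci : D * ((c'⁻¹ : Rˣ) : R) = ((c'⁻¹ : Rˣ) : R) * D := by
      rw [Units.eq_inv_mul_iff_mul_eq, ← mul_assoc, b6, mul_assoc, Units.mul_inv, mul_one]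
    simp only [Units.val_mul]
    rw [mul_assoc _ _ D, ← hci, ← mul_assoc, ← mul_assoc, ← a6, mul_assoc (c:R), hy]
    simp only [mul_assoc]
  · let U : Rˣ := ⟨1 + N', 1 - N', by rw [add_mul, mul_sub, mul_sub, z2]; simp, by rw [sub_mul, mul_add, mul_add, z2]; simp⟩
    let V : Rˣ := ⟨1 + M', 1 - M', by rw [add_mul, mul_sub, mul_sub, z1]; simp, by rw [sub_mul, mul_add, mul_add, z1]; simp⟩
    have hp' : p⁻¹ = h' * (U * V * c') := Units.ext (by rw [b7]; rfl)
    have hp2 : p = c'⁻¹ * (V⁻¹ * U⁻¹) * h'⁻¹ := by rw [← inv_inv p, hp']; simp [mul_assoc]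
    have hV : ((V⁻¹ : Rˣ) : R) = 1 + -M' := by rw [← sub_eq_add_neg]; rfl
    have hU : ((U⁻¹ : Rˣ) : R) = 1 + -N' := by rw [← sub_eq_add_neg]; rfl
    rw [a7, hp2, ← hV, ← hU]
    simp only [Units.val_mul, mul_assoc]

theorem bad_small1 (A P : Subalgebra ℂ R) (D0 D : R) (hD0 : D0 * D0 = D0) (hD : D * D = D) (hD0A : D0 ∈ A) (hDP : D ∈ P)
    (hs : Module.finrank ℂ (offd A D0) + Module.finrank ℂ (offd A (1 - D0)) + Module.finrank ℂ (intw D0 D)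
      + Module.finrank ℂ (offd P D) + Module.finrank ℂ (offd P (1 - D)) < Module.finrank ℂ R) : Small (Bad A P D0 D) := by
  obtain ⟨H, hH, hb⟩ := bad_normal A P D0 D hD0 hD hD0A hDP
  refine (small_biUnion hH (fun h _ => small_core (h.1 : R) (h.2 : R) _ _ _ _ _ hs)).mono ?_
  intro g hg
  obtain ⟨h, hh, M, hM, N, hN, y, hy, M', hM', N', hN', rfl⟩ := hb g hg
  exact mem_biUnion hh ⟨M, hM, N, hN, y, hy, M', hM', N', hN', rfl⟩

theorem bad_small2 (A P : Subalgebra ℂ R) (D0 D : R) (hD0 : D0 * D0 = D0) (hD : D * D = D) (hD0A : D0 ∈ A) (hDP : D ∈ P)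
    (hs : Module.finrank ℂ (offd A D0) + Module.finrank ℂ (offd A (1 - D0)) + Module.finrank ℂ (intw D0 D)
      + Module.finrank ℂ (offd P D) + Module.finrank ℂ (offd P (1 - D)) ≤ Module.finrank ℂ R)
    (hk : Module.finrank ℂ (offd (⊤ : Subalgebra ℂ R) D) < Module.finrank ℂ (offd A D0) + Module.finrank ℂ (offd P D)) :
    Small (Bad A P D0 D) := by
  obtain ⟨H, hH, hb⟩ := bad_normal A P D0 D hD0 hD hD0A hDP
  let W := offd A D0
  let bs := Module.finBasis ℂ W
  let W' : Fin (Module.finrank ℂ W) → Submodule ℂ R := fun i => (LinearMap.ker (bs.coord i)).map W.subtype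
  have hW' : ∀ i, Module.finrank ℂ (W' i) < Module.finrank ℂ W := by
    intro i
    have e1 : Module.finrank ℂ (W' i) = Module.finrank ℂ (LinearMap.ker (bs.coord i)) :=
      (LinearEquiv.finrank_eq (Submodule.equivMapOfInjective _ W.injective_subtype _)).symm
    rw [e1]
    refine Submodule.finrank_lt ?_
    intro htop
    have : bs i ∈ LinearMap.ker (bs.coord i) := by rw [htop]; trivial
    rw [LinearMap.mem_ker, Module.Basis.coord_apply, Module.Basis.repr_self] at this
    simp at this
  refine (small_biUnion hH (fun h _ => small_iUnion (fun i => small_core (h.1 : R) (h.2 : R) (W' i) (offd A (1 - D0)) (intw D0 D)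
    (offd P D) (offd P (1 - D)) (by have := hW' i; simp only [W] at this; omega)))).mono ?_
  intro g hg
  obtain ⟨h, hh, M, hM, N, hN, y, hy, M', hM', N', hN', rfl⟩ := hb g hg
  refine mem_biUnion hh (mem_iUnion.2 ?_)
  -- find f
  have hy' : D0 * (y:R) = y * D := hy
  have hyi : ((y⁻¹ : Rˣ) : R) * D0 = D * ((y⁻¹ : Rˣ) : R) := by
    rw [Units.inv_mul_eq_iff_eq_mul, ← mul_assoc, ← hy', mul_assoc, Units.mul_inv, mul_one]
  let cj : R →ₗ[ℂ] R := (LinearMap.mulLeft ℂ ((y⁻¹ : Rˣ) : R)).comp (LinearMap.mulRight ℂ (y:R))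
  have hcj : ∀ x, cj x = ((y⁻¹ : Rˣ) : R) * (x * y) := fun x => rfl
  have hcinj : Function.Injective cj := by
    intro a b hab
    simp only [hcj] at hab
    simpa using hab
  have hsub : W.map cj ≤ offd (⊤ : Subalgebra ℂ R) D := by
    rintro _ ⟨f, hf, rfl⟩
    refine ⟨trivial, ?_⟩
    rw [hcj]
    conv_lhs => rw [(mem_offd.1 hf).2]
    have e1 : (1 - D0) * (y:R) = y * (1 - D) := by rw [sub_mul, mul_sub, hy']; simp
    calc ((y⁻¹ : Rˣ) : R) * (D0 * f * (1 - D0) * y) = (((y⁻¹ : Rˣ) : R) * D0) * f * ((1 - D0) * y) := by simp only [mul_assoc]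
      _ = _ := by rw [e1, hyi]; simp only [mul_assoc]
  have hsub2 : offd P D ≤ offd (⊤ : Subalgebra ℂ R) D := fun x hx => ⟨trivial, hx.2⟩
  have hWf : Module.finrank ℂ (W.map cj) = Module.finrank ℂ W :=
    (LinearEquiv.finrank_eq (Submodule.equivMapOfInjective _ hcinj _)).symm
  obtain ⟨f', hf', hf0⟩ : ∃ f' ∈ W.map cj ⊓ offd P D, f' ≠ 0 := by
    rw [← Submodule.ne_bot_iff]
    intro hbot
    have h1 := Submodule.finrank_sup_add_finrank_inf_eq (W.map cj) (offd P D)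
    rw [hbot, finrank_bot, hWf] at h1
    have h2 := Submodule.finrank_mono (sup_le hsub hsub2)
    change _ = Module.finrank ℂ (offd A D0) + _ at h1
    omega
  obtain ⟨⟨f, hf, hff⟩, hfP⟩ := hf'
  have hfne : f ≠ 0 := by rintro rfl; exact hf0 (by rw [← hff]; simp)
  obtain ⟨i, hi⟩ : ∃ i, bs.repr ⟨f, hf⟩ i ≠ 0 := by
    by_contra hcon
    push Not at hcon
    have : bs.repr ⟨f, hf⟩ = 0 := Finsupp.ext hcon
    rw [LinearEquiv.map_eq_zero_iff] at this
    exact hfne (congrArg Subtype.val this)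
  set t : ℂ := - (bs.repr ⟨M, hM⟩ i / bs.repr ⟨f, hf⟩ i) with ht
  refine ⟨i, M + t • f, ?_, N, hN, y, hy, M' - t • f', sub_mem hM' (Submodule.smul_mem _ _ hfP), N', hN', ?_⟩
  · refine ⟨⟨M, hM⟩ + t • ⟨f, hf⟩, ?_, rfl⟩
    rw [SetLike.mem_coe, LinearMap.mem_ker, Module.Basis.coord_apply, map_add, map_smul, Finsupp.add_apply, Finsupp.smul_apply, smul_eq_mul, ht]
    field_simp
    ring
  · have k1 : (1 + M) * (1 + t • f) = 1 + (M + t • f) := by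
      rw [add_mul, mul_add, mul_add, mul_smul_comm t M, offd_mul hD0 hM hf]; simp; abel
    have k2 : (1 - t • f') * (1 + M') = 1 + (M' - t • f') := by
      rw [sub_mul, mul_add, mul_add, smul_mul_assoc, smul_mul_assoc, offd_mul hD hfP hM']; simp; abel
    have hf1 : (y:R) * f' = f * y := by rw [← hff, hcj]; simp
    have hff0 : f * f = 0 := offd_mul hD0 hf hf
    have k3 : (1 + t • f) * y * (1 - t • f') = y := by
      have : (y:R) * (1 - t • f') = (1 - t • f) * y := by
        rw [mul_sub, sub_mul, mul_smul_comm, hf1, smul_mul_assoc]; simp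
      rw [mul_assoc, this, ← mul_assoc]
      have : (1 + t • f) * (1 - t • f) = 1 := by
        rw [add_mul, mul_sub, mul_sub, smul_mul_smul_comm, hff0]; simp
      rw [this, one_mul]
    rw [← k1, ← k2]
    congr 2
    calc (1 + N) * (1 + M) * y * ((1 + M') * (1 + N')) = (1 + N) * (1 + M) * ((1 + t • f) * y * (1 - t • f')) * ((1 + M') * (1 + N')) := by rw [k3]
      _ = _ := by simp only [mul_assoc]

theorem bad_small (A P : Subalgebra ℂ R) (D0 D : R) (hD0 : D0 * D0 = D0) (hD : D * D = D) (hD0A : D0 ∈ A) (hDP : D ∈ P)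
    (hs : Module.finrank ℂ (offd A D0) + Module.finrank ℂ (offd A (1 - D0)) + Module.finrank ℂ (intw D0 D)
      + Module.finrank ℂ (offd P D) + Module.finrank ℂ (offd P (1 - D)) < Module.finrank ℂ R ∨
      (Module.finrank ℂ (offd A D0) + Module.finrank ℂ (offd A (1 - D0)) + Module.finrank ℂ (intw D0 D)
      + Module.finrank ℂ (offd P D) + Module.finrank ℂ (offd P (1 - D)) ≤ Module.finrank ℂ R ∧
      (Module.finrank ℂ (offd (⊤ : Subalgebra ℂ R) D) < Module.finrank ℂ (offd A D0) + Module.finrank ℂ (offd P D) ∨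
       Module.finrank ℂ (offd (⊤ : Subalgebra ℂ R) (1 - D)) < Module.finrank ℂ (offd A (1 - D0)) + Module.finrank ℂ (offd P (1 - D))))) :
    Small (Bad A P D0 D) := by
  rcases hs with h | ⟨h, h' | h'⟩
  · exact bad_small1 A P D0 D hD0 hD hD0A hDP h
  · exact bad_small2 A P D0 D hD0 hD hD0A hDP h h'
  · refine (bad_small2 A P (1 - D0) (1 - D) ?_ ?_ (A.sub_mem A.one_mem hD0A) (P.sub_mem P.one_mem hDP) ?_ h').mono (bad_swap A P D0 D)
    · rw [mul_sub, mul_one, sub_mul, one_mul, hD0, sub_self, sub_zero]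
    · rw [mul_sub, mul_one, sub_mul, one_mul, hD, sub_self, sub_zero]
    · have : intw (1 - D0) (1 - D) = intw D0 D := by
        ext y
        show (1 - D0) * y = y * (1 - D) ↔ D0 * y = y * D
        rw [sub_mul, mul_sub, one_mul, mul_one, sub_right_inj]
      rw [this, sub_sub_cancel, sub_sub_cancel]
      omega
end bad
end RH
end

section
open Set Filter Topology
namespace RH
open scoped Matrix.Norms.Operator
section conc
variable {k n : ℕ}

/-- The algebra of tuples of matrices. -/
abbrev RR (k n : ℕ) := Fin k → Matrix (Fin n) (Fin n) ℂ

def pat (τ : Fin n → ℕ) : Subalgebra ℂ (Matrix (Fin n) (Fin n) ℂ) where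
  carrier := {M | ∀ a b, ¬ τ b ≤ τ a → M a b = 0}
  add_mem' := by intro x y hx hy a b h; simp [hx a b h, hy a b h]
  mul_mem' := by
    intro x y hx hy a b h
    rw [Matrix.mul_apply]
    refine Finset.sum_eq_zero fun c _ => ?_
    by_cases h1 : τ c ≤ τ a
    · rw [hy c b (by omega), mul_zero]
    · rw [hx a c h1, zero_mul]
  algebraMap_mem' := by
    intro r a b h
    rw [Matrix.algebraMap_matrix_apply, if_neg]
    rintro rfl; exact h le_rfl

theorem mem_pat {τ : Fin n → ℕ} {M : Matrix (Fin n) (Fin n) ℂ} : M ∈ pat τ ↔ ∀ a b, ¬ τ b ≤ τ a → M a b = 0 := Iff.rfl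

def PP (τ : Fin k → Fin n → ℕ) : Subalgebra ℂ (RR k n) where
  carrier := {F | ∀ j, F j ∈ pat (τ j)}
  add_mem' := fun hx hy j => (pat (τ j)).add_mem (hx j) (hy j)
  mul_mem' := fun hx hy j => (pat (τ j)).mul_mem (hx j) (hy j)
  algebraMap_mem' := fun r j => (pat (τ j)).algebraMap_mem r

theorem mem_PP {τ : Fin k → Fin n → ℕ} {F : RR k n} : F ∈ PP τ ↔ ∀ j, F j ∈ pat (τ j) := Iff.rfl

def AA (k : ℕ) (S : Finset (Fin n)) : Subalgebra ℂ (RR k n) where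
  carrier := {F | ∃ p q : Matrix (Fin n) (Fin n) ℂ, (∀ j : Fin k, F j = p + ((j:ℕ):ℂ) • q) ∧ (∀ a b, a ∉ S → b ∈ S → p a b = 0) ∧
    (∀ a b, ¬ (a ∈ S ∧ b ∉ S) → q a b = 0)}
  add_mem' := by
    rintro x y ⟨p, q, h1, h2, h3⟩ ⟨p', q', h1', h2', h3'⟩
    refine ⟨p + p', q + q', ?_, ?_, ?_⟩
    · intro j; rw [Pi.add_apply, h1, h1', smul_add]; abel
    · intro a b h h'; simp [h2 a b h h', h2' a b h h']
    · intro a b h; simp [h3 a b h, h3' a b h]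
  mul_mem' := by
    rintro x y ⟨p, q, h1, h2, h3⟩ ⟨p', q', h1', h2', h3'⟩
    have hqq : q * q' = 0 := by
      ext a b
      rw [Matrix.mul_apply]
      refine Finset.sum_eq_zero fun c _ => ?_
      by_cases hc : c ∈ S
      · rw [h3 a c (by tauto), zero_mul]
      · rw [h3' c b (by tauto), mul_zero]
    refine ⟨p * p', p * q' + q * p', ?_, ?_, ?_⟩
    · intro j; rw [Pi.mul_apply, h1, h1', add_mul, mul_add, mul_add, smul_mul_smul_comm, hqq, smul_zero, smul_add, smul_mul_assoc, mul_smul_comm]; abel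
    · intro a b h h'
      rw [Matrix.mul_apply]
      refine Finset.sum_eq_zero fun c _ => ?_
      by_cases hc : c ∈ S
      · rw [h2 a c h hc, zero_mul]
      · rw [h2' c b hc h', mul_zero]
    · intro a b h
      rw [Matrix.add_apply, Matrix.mul_apply, Matrix.mul_apply, ← Finset.sum_add_distrib]
      refine Finset.sum_eq_zero fun c _ => ?_
      have e1 : p a c * q' c b = 0 := by
        by_cases hc : c ∈ S ∧ b ∉ S
        · rw [h2 a c (by tauto) hc.1, zero_mul]
        · rw [h3' c b hc, mul_zero]
      have e2 : q a c * p' c b = 0 := by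
        by_cases hc : a ∈ S ∧ c ∉ S
        · rw [h2' c b hc.2 (by tauto), mul_zero]
        · rw [h3 a c hc, zero_mul]
      rw [e1, e2, add_zero]
  algebraMap_mem' := by
    intro r
    refine ⟨algebraMap ℂ _ r, 0, ?_, ?_, ?_⟩
    · intro j; simp
    · intro a b ha hb
      rw [Matrix.algebraMap_matrix_apply, if_neg]
      rintro rfl; exact ha hb
    · intro a b _; rfl

def dg (B : Fin k → Finset (Fin n)) : RR k n := fun j => Matrix.diagonal (fun a => if a ∈ B j then 1 else 0)

theorem dg_mul (B : Fin k → Finset (Fin n)) (M : RR k n) (j : Fin k) (a b : Fin n) : (dg B * M) j a b = if a ∈ B j then M j a b else 0 := by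
  simp [dg, Matrix.diagonal_mul]

theorem mul_dg (B : Fin k → Finset (Fin n)) (M : RR k n) (j : Fin k) (a b : Fin n) : (M * dg B) j a b = if b ∈ B j then M j a b else 0 := by
  simp [dg, Matrix.mul_diagonal]

theorem one_sub_dg (B : Fin k → Finset (Fin n)) : 1 - dg B = dg (fun j => (B j)ᶜ) := by
  funext j
  ext a b
  by_cases h : a = b
  · subst h
    by_cases h2 : a ∈ B j <;> simp [dg, h2]
  · simp [dg, h]

theorem dg_idem (B : Fin k → Finset (Fin n)) : dg B * dg B = dg B := by
  funext j; ext a b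
  rw [dg_mul]
  by_cases h : a = b
  · subst h; simp [dg]
  · simp [dg, h]

theorem dg_mem_PP (τ : Fin k → Fin n → ℕ) (B : Fin k → Finset (Fin n)) : dg B ∈ PP τ := by
  intro j a b h
  have : a ≠ b := by rintro rfl; exact h le_rfl
  simp [dg, this]

theorem dg_mem_AA (S B : Finset (Fin n)) : dg (fun _ => B) ∈ AA k S := by
  refine ⟨Matrix.diagonal (fun a => if a ∈ B then 1 else 0), 0, fun j => by simp [dg], ?_, by simp⟩
  intro a b ha hb
  have : a ≠ b := by rintro rfl; exact ha hb
  simp [this]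

theorem offd_iff (B : Fin k → Finset (Fin n)) (M : RR k n) : M = dg B * M * (1 - dg B) ↔ ∀ j a b, ¬ (a ∈ B j ∧ b ∉ B j) → M j a b = 0 := by
  rw [one_sub_dg]
  have key : ∀ j a b, (dg B * M * dg (fun j => (B j)ᶜ)) j a b = if a ∈ B j ∧ b ∉ B j then M j a b else 0 := by
    intro j a b
    rw [mul_dg, dg_mul]
    by_cases h1 : a ∈ B j <;> by_cases h2 : b ∈ B j <;> simp [h1, h2]
  constructor
  · intro h j a b hn
    rw [h, key, if_neg hn]
  · intro h
    funext j; ext a b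
    rw [key]
    split_ifs with hh
    · rfl
    · exact h j a b hh

theorem finrank_supp (W : Submodule ℂ (RR k n)) (T : Fin k → Fin n → Fin n → Prop) [∀ j a b, Decidable (T j a b)]
    (hW : ∀ M, M ∈ W ↔ ∀ j a b, ¬ T j a b → M j a b = 0) :
    Module.finrank ℂ W = ∑ j, ∑ a, ∑ b, if T j a b then 1 else 0 := by
  let ι := {x : Fin k × Fin n × Fin n // T x.1 x.2.1 x.2.2}
  let L : (ι → ℂ) →ₗ[ℂ] RR k n :=
    { toFun := fun v j => Matrix.of fun a b => if h : T j a b then v ⟨(j, a, b), h⟩ else 0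
      map_add' := by
        intro x y; funext j; ext a b
        by_cases h : T j a b <;> simp [h]
      map_smul' := by
        intro c x; funext j; ext a b
        by_cases h : T j a b <;> simp [h] }
  have hL : ∀ v j a b, L v j a b = if h : T j a b then v ⟨(j, a, b), h⟩ else 0 := fun _ _ _ _ => rfl
  have hinj : Function.Injective L := by
    intro x y hxy
    funext ⟨⟨j, a, b⟩, h⟩
    have := congrFun (congrFun (congrFun hxy j) a) b
    rw [hL, hL] at this
    simpa [h] using this
  have hr : LinearMap.range L = W := by
    ext M
    rw [hW]
    constructor
    · rintro ⟨v, rfl⟩ j a b h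
      rw [hL, dif_neg h]
    · intro h
      refine ⟨fun x => M x.1.1 x.1.2.1 x.1.2.2, ?_⟩
      funext j; ext a b
      rw [hL]
      split_ifs with hh
      · rfl
      · exact (h j a b hh).symm
  rw [← hr, LinearMap.finrank_range_of_inj hinj, Module.finrank_fintype_fun_eq_card, Fintype.card_subtype, Finset.card_filter,
    Fintype.sum_prod_type]
  refine Finset.sum_congr rfl fun j _ => ?_
  rw [Fintype.sum_prod_type]

theorem finrank_AA (hk : 2 ≤ k) (S B : Finset (Fin n)) :
    Module.finrank ℂ (offd (AA k S) (dg (fun _ => B))) =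
      ∑ a, ∑ b, if a ∈ B ∧ b ∉ B then ((if ¬ (a ∉ S ∧ b ∈ S) then 1 else 0) + (if a ∈ S ∧ b ∉ S then 1 else 0)) else 0 := by
  let T : Bool → Fin n → Fin n → Prop := fun i a b => (a ∈ B ∧ b ∉ B) ∧ if i then a ∈ S ∧ b ∉ S else ¬ (a ∉ S ∧ b ∈ S)
  have : ∀ i a b, Decidable (T i a b) := fun i a b => by unfold T; infer_instance
  let ι := {x : Bool × Fin n × Fin n // T x.1 x.2.1 x.2.2}
  let L : (ι → ℂ) →ₗ[ℂ] RR k n :=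
    { toFun := fun v j => Matrix.of fun a b => (if h : T false a b then v ⟨(false, a, b), h⟩ else 0) +
        ((j:ℕ):ℂ) * (if h : T true a b then v ⟨(true, a, b), h⟩ else 0)
      map_add' := by
        intro x y; funext j; ext a b
        by_cases h : T false a b <;> by_cases h' : T true a b <;> simp [h, h'] <;> ring
      map_smul' := by
        intro c x; funext j; ext a b
        by_cases h : T false a b <;> by_cases h' : T true a b <;> simp [h, h'] <;> ring }
  have hL : ∀ v j a b, L v j a b = (if h : T false a b then v ⟨(false, a, b), h⟩ else 0) +
        ((j:ℕ):ℂ) * (if h : T true a b then v ⟨(true, a, b), h⟩ else 0) := fun _ _ _ _ => rfl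
  have hinj : Function.Injective L := by
    rw [← LinearMap.ker_eq_bot, LinearMap.ker_eq_bot']
    intro x hx
    have h0 : ∀ a b, (if h : T false a b then x ⟨(false, a, b), h⟩ else 0) = 0 := by
      intro a b
      have := congrFun (congrFun (congrFun hx ⟨0, by omega⟩) a) b
      rw [hL] at this
      simpa using this
    have h1 : ∀ a b, (if h : T true a b then x ⟨(true, a, b), h⟩ else 0) = 0 := by
      intro a b
      have := congrFun (congrFun (congrFun hx ⟨1, by omega⟩) a) b
      rw [hL, h0] at this
      simpa using this
    funext ⟨⟨i, a, b⟩, h⟩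
    cases i
    · have := h0 a b
      rw [dif_pos h] at this; exact this
    · have := h1 a b
      rw [dif_pos h] at this; exact this
  have hr : LinearMap.range L = offd (AA k S) (dg (fun _ => B)) := by
    ext M
    rw [mem_offd, offd_iff]
    constructor
    · rintro ⟨v, rfl⟩
      refine ⟨⟨Matrix.of fun a b => (if h : T false a b then v ⟨(false, a, b), h⟩ else 0), Matrix.of fun a b => (if h : T true a b then v ⟨(true, a, b), h⟩ else 0), ?_, ?_, ?_⟩, ?_⟩
      · intro j; ext a b; rw [hL]; rfl
      · intro a b ha hb
        exact dif_neg (fun h => h.2 ⟨ha, hb⟩)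
      · intro a b h
        exact dif_neg (fun h' => h h'.2)
      · intro j a b h
        rw [hL, dif_neg (fun h' => h h'.1), dif_neg (fun h' => h h'.1)]; simp
    · rintro ⟨⟨p, q, h1, h2, h3⟩, h4⟩
      have hp : ∀ a b, ¬ (a ∈ B ∧ b ∉ B) → p a b = 0 := by
        intro a b h
        have := h4 ⟨0, by omega⟩ a b h
        rw [h1] at this; simpa using this
      have hq : ∀ a b, ¬ (a ∈ B ∧ b ∉ B) → q a b = 0 := by
        intro a b h
        have := h4 ⟨1, by omega⟩ a b h
        rw [h1] at this; simpa [hp a b h] using this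
      refine ⟨fun x => if x.1.1 then q x.1.2.1 x.1.2.2 else p x.1.2.1 x.1.2.2, ?_⟩
      funext j; ext a b
      rw [hL, h1, Matrix.add_apply, Matrix.smul_apply, smul_eq_mul]
      congr 1
      · split_ifs with hh hh2
        · exact absurd hh2 (by decide)
        · rfl
        · by_cases h5 : a ∈ B ∧ b ∉ B
          · by_cases h6 : a ∉ S ∧ b ∈ S
            · exact (h2 a b h6.1 h6.2).symm
            · exact absurd ⟨h5, h6⟩ hh
          · exact (hp a b h5).symm
      · congr 1
        split_ifs with hh hh2
        · rfl
        · exact absurd rfl hh2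
        · by_cases h5 : a ∈ B ∧ b ∉ B
          · by_cases h6 : a ∈ S ∧ b ∉ S
            · exact absurd ⟨h5, h6⟩ hh
            · exact (h3 a b h6).symm
          · exact (hq a b h5).symm
  rw [← hr, LinearMap.finrank_range_of_inj hinj, Module.finrank_fintype_fun_eq_card, Fintype.card_subtype, Finset.card_filter,
    Fintype.sum_prod_type, Fintype.sum_bool, Fintype.sum_prod_type, Fintype.sum_prod_type, ← Finset.sum_add_distrib]
  refine Finset.sum_congr rfl fun a _ => ?_
  rw [← Finset.sum_add_distrib]
  refine Finset.sum_congr rfl fun b _ => ?_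
  simp only [T]
  by_cases h5 : a ∈ B ∧ b ∉ B
  · simp [h5, add_comm]
  · simp [h5]

theorem finrank_PP (τ : Fin k → Fin n → ℕ) (B : Fin k → Finset (Fin n)) :
    Module.finrank ℂ (offd (PP τ) (dg B)) = ∑ j, ∑ a, ∑ b, if (a ∈ B j ∧ b ∉ B j) ∧ τ j b ≤ τ j a then 1 else 0 := by
  refine finrank_supp _ (fun j a b => (a ∈ B j ∧ b ∉ B j) ∧ τ j b ≤ τ j a) ?_
  intro M
  rw [mem_offd, offd_iff]
  constructor
  · rintro ⟨h1, h2⟩ j a b h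
    by_cases h3 : a ∈ B j ∧ b ∉ B j
    · exact h1 j a b (fun h4 => h ⟨h3, h4⟩)
    · exact h2 j a b h3
  · intro h
    exact ⟨fun j a b h1 => h j a b (fun h2 => h1 h2.2), fun j a b h1 => h j a b (fun h2 => h1 h2.1)⟩

theorem finrank_top (B : Fin k → Finset (Fin n)) :
    Module.finrank ℂ (offd (⊤ : Subalgebra ℂ (RR k n)) (dg B)) = ∑ j, ∑ a, ∑ b, if (a ∈ B j ∧ b ∉ B j) then 1 else 0 := by
  refine finrank_supp _ (fun j a b => (a ∈ B j ∧ b ∉ B j)) ?_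
  intro M
  rw [mem_offd, offd_iff]
  exact ⟨fun h => h.2, fun h => ⟨trivial, h⟩⟩

theorem finrank_intw (B C : Fin k → Finset (Fin n)) :
    Module.finrank ℂ (intw (dg B) (dg C)) = ∑ j, ∑ a, ∑ b, if (a ∈ B j ↔ b ∈ C j) then 1 else 0 := by
  refine finrank_supp _ (fun j a b => (a ∈ B j ↔ b ∈ C j)) ?_
  intro M
  show dg B * M = M * dg C ↔ _
  constructor
  · intro h j a b h1
    have := congrFun (congrFun (congrFun h j) a) b
    rw [dg_mul, mul_dg] at this
    by_cases h2 : a ∈ B j <;> by_cases h3 : b ∈ C j <;> simp_all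
  · intro h
    funext j; ext a b
    rw [dg_mul, mul_dg]
    have := h j a b
    by_cases h2 : a ∈ B j <;> by_cases h3 : b ∈ C j <;> simp_all

theorem finrank_RR : Module.finrank ℂ (RR k n) = k * (n * n) := by
  rw [Module.finrank_pi_fintype]
  simp [Module.finrank_matrix]
end conc
end RH
end

section
open Set Filter Topology
namespace RH
section count
variable {n : ℕ}

theorem fiber_sum {K : Type*} [CommRing K] (w : Fin n → K) (τ : Fin n → ℕ) (F : ℕ → K) :
    ∑ a, w a * F (τ a) = ∑ i ∈ Finset.univ.image τ, (∑ a, if τ a = i then w a else 0) * F i := by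
  simp only [Finset.sum_mul]
  rw [Finset.sum_comm]
  refine Finset.sum_congr rfl fun a _ => ?_
  rw [Finset.sum_eq_single (τ a)]
  · simp
  · intro i _ hi; rw [if_neg (Ne.symm hi), zero_mul]
  · intro h; exact absurd (Finset.mem_image_of_mem _ (Finset.mem_univ a)) h

theorem fiber0 {K : Type*} [CommRing K] (w : Fin n → K) (τ : Fin n → ℕ)
    (h : ∀ i, (∑ a, if τ a = i then w a else 0) = 0) (F : ℕ → K) : ∑ a, w a * F (τ a) = 0 := by
  rw [fiber_sum]; simp [h]

variable (u : Fin n → ℤ) (τ : Fin n → ℕ) (b : ℤ)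

theorem eq_sum : ∑ x, ∑ y, u x * (1 - u y) * (if τ x = τ y then 1 else 0) =
    ∑ i ∈ Finset.univ.image τ, (∑ a, if τ a = i then u a else 0) * (∑ a, if τ a = i then (1 - u a) else 0) := by
  have : ∀ x, ∑ y, u x * (1 - u y) * (if τ x = τ y then (1:ℤ) else 0) = u x * (fun i => ∑ a, if τ a = i then (1 - u a) else 0) (τ x) := by
    intro x
    simp only [Finset.mul_sum]
    refine Finset.sum_congr rfl fun y _ => ?_
    by_cases h : τ x = τ y
    · simp [h]
    · simp [h, Ne.symm h]
  simp only [this]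
  exact fiber_sum u τ (fun i => ∑ a, if τ a = i then (1 - u a) else 0)

theorem eq_ident (c : ℤ) : (b + c) ^ 2 * (∑ x, ∑ y, u x * (1 - u y) * (if τ x = τ y then 1 else 0)) =
    ∑ i ∈ Finset.univ.image τ, ((∑ a, if τ a = i then (1:ℤ) else 0) * (∑ a, if τ a = i then (c ^ 2 * u a + b ^ 2 * (1 - u a)) else 0)
     - (∑ a, if τ a = i then (c * u a - b * (1 - u a)) else 0) ^ 2) := by
  rw [eq_sum, Finset.mul_sum]
  refine Finset.sum_congr rfl fun i _ => ?_
  have h1 : (∑ a, if τ a = i then (1:ℤ) else 0) = (∑ a, if τ a = i then u a else 0) + (∑ a, if τ a = i then (1 - u a) else 0) := by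
    rw [← Finset.sum_add_distrib]; refine Finset.sum_congr rfl fun a _ => ?_; split_ifs <;> ring
  have h2 : (∑ a, if τ a = i then (c ^ 2 * u a + b ^ 2 * (1 - u a)) else 0) = c ^ 2 * (∑ a, if τ a = i then u a else 0) + b ^ 2 * (∑ a, if τ a = i then (1 - u a) else 0) := by
    rw [Finset.mul_sum, Finset.mul_sum, ← Finset.sum_add_distrib]; refine Finset.sum_congr rfl fun a _ => ?_; split_ifs <;> ring
  have h3 : (∑ a, if τ a = i then (c * u a - b * (1 - u a)) else 0) = c * (∑ a, if τ a = i then u a else 0) - b * (∑ a, if τ a = i then (1 - u a) else 0) := by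
    rw [Finset.mul_sum, Finset.mul_sum, ← Finset.sum_sub_distrib]; refine Finset.sum_congr rfl fun a _ => ?_; split_ifs <;> ring
  rw [h1, h2, h3]; ring

theorem eq_bound (c m : ℤ) (hu : ∀ a, u a = 0 ∨ u a = 1) (hb : 0 < b) (hc : 0 < c) (hsum : ∑ a, u a = b) (hsum' : ∑ a, (1 - u a) = c)
    (hm : ∀ i, (∑ a, if τ a = i then (1:ℤ) else 0) ≤ m) :
    (b + c) * (∑ x, ∑ y, u x * (1 - u y) * (if τ x = τ y then 1 else 0)) ≤ m * b * c ∧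
    ((b + c) * (∑ x, ∑ y, u x * (1 - u y) * (if τ x = τ y then 1 else 0)) = m * b * c →
      ∀ i, (∑ a, if τ a = i then (c * u a - b * (1 - u a)) else 0) = 0) := by
  have id := eq_ident u τ b c
  rw [Finset.sum_sub_distrib] at id
  have tot : ∑ i ∈ Finset.univ.image τ, (∑ a, if τ a = i then (c ^ 2 * u a + b ^ 2 * (1 - u a)) else 0) = b * c * (b + c) := by
    have := fiber_sum (fun a => c ^ 2 * u a + b ^ 2 * (1 - u a)) τ (fun _ => 1)
    simp only [mul_one] at this
    rw [← this, Finset.sum_add_distrib, ← Finset.mul_sum, ← Finset.mul_sum, hsum, hsum']; ring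
  have le : ∑ i ∈ Finset.univ.image τ, ((∑ a, if τ a = i then (1:ℤ) else 0) * (∑ a, if τ a = i then (c ^ 2 * u a + b ^ 2 * (1 - u a)) else 0)) ≤ m * (b * c * (b + c)) := by
    rw [← tot, Finset.mul_sum]
    refine Finset.sum_le_sum fun i _ => mul_le_mul_of_nonneg_right (hm i) (Finset.sum_nonneg fun a _ => ?_)
    split_ifs
    · rcases hu a with h | h <;> rw [h] <;> nlinarith
    · rfl
  have sqn : 0 ≤ ∑ i ∈ Finset.univ.image τ, (∑ a, if τ a = i then (c * u a - b * (1 - u a)) else 0) ^ 2 :=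
    Finset.sum_nonneg fun i _ => sq_nonneg _
  set Q := ∑ x, ∑ y, u x * (1 - u y) * (if τ x = τ y then (1:ℤ) else 0)
  have hbc : 0 < b + c := by linarith
  constructor
  · have : (b + c) * ((b + c) * Q) ≤ (b + c) * (m * b * c) := by nlinarith
    exact le_of_mul_le_mul_left this hbc
  · intro heq i
    have : (b + c) ^ 2 * Q = (b + c) * (m * b * c) := by rw [← heq]; ring
    have s0 : ∑ i ∈ Finset.univ.image τ, (∑ a, if τ a = i then (c * u a - b * (1 - u a)) else 0) ^ 2 = 0 := by nlinarith
    by_cases hi : i ∈ Finset.univ.image τ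
    · have := (Finset.sum_eq_zero_iff_of_nonneg (fun i _ => sq_nonneg _)).1 s0 i hi
      exact pow_eq_zero_iff (two_ne_zero) |>.1 this
    · refine Finset.sum_eq_zero fun a _ => if_neg ?_
      rintro rfl; exact hi (Finset.mem_image_of_mem _ (Finset.mem_univ a))

theorem lt_eq_gt (c : ℤ) (hc : 0 < c) (h : ∀ i, (∑ a, if τ a = i then (c * u a - b * (1 - u a)) else 0) = 0) :
    ∑ x, ∑ y, u x * (1 - u y) * (if τ x < τ y then 1 else 0) = ∑ x, ∑ y, u x * (1 - u y) * (if τ y < τ x then 1 else 0) := by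
  have key : ∀ G : ℕ → ℕ → ℤ, c * ∑ x, ∑ y, u x * (1 - u y) * G (τ x) (τ y) = b * ∑ y, ∑ x, (1 - u x) * (1 - u y) * G (τ x) (τ y) := by
    intro G
    rw [Finset.sum_comm, Finset.mul_sum, Finset.mul_sum]
    refine Finset.sum_congr rfl fun y _ => ?_
    have := fiber0 _ τ h (fun i => G i (τ y))
    have h2 : ∑ a, (c * u a - b * (1 - u a)) * G (τ a) (τ y) * (1 - u y) = 0 := by rw [← Finset.sum_mul, this, zero_mul]
    rw [Finset.mul_sum, Finset.mul_sum, ← sub_eq_zero, ← Finset.sum_sub_distrib, ← h2]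
    refine Finset.sum_congr rfl fun x _ => ?_
    ring
  have k1 := key (fun i j => if i < j then 1 else 0)
  have k2 := key (fun i j => if j < i then 1 else 0)
  refine mul_left_cancel₀ hc.ne' (k1.trans (Eq.trans ?_ k2.symm))
  congr 1
  rw [Finset.sum_comm]
  refine Finset.sum_congr rfl fun x _ => Finset.sum_congr rfl fun y _ => ?_
  ring

theorem sum_uu (c : ℤ) (hsum : ∑ a, u a = b) (hsum' : ∑ a, (1 - u a) = c) : ∑ x, ∑ y, u x * (1 - u y) = b * c := by
  rw [← Finset.sum_mul_sum, hsum, hsum']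

theorem tri (c : ℤ) (hsum : ∑ a, u a = b) (hsum' : ∑ a, (1 - u a) = c) :
    ∑ x, ∑ y, u x * (1 - u y) * (if τ x < τ y then 1 else 0) + ∑ x, ∑ y, u x * (1 - u y) * (if τ x = τ y then 1 else 0)
     + ∑ x, ∑ y, u x * (1 - u y) * (if τ y < τ x then 1 else 0) = b * c := by
  rw [← sum_uu u b c hsum hsum']
  simp only [← Finset.sum_add_distrib]
  refine Finset.sum_congr rfl fun x _ => Finset.sum_congr rfl fun y _ => ?_
  rcases lt_trichotomy (τ x) (τ y) with h | h | h
  · simp [h, h.ne, h.le.not_gt]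
  · simp [h]
  · simp [h, h.ne', h.le.not_gt]
end count

section main
open scoped Matrix.Norms.Operator
variable {k n : ℕ}
/-- indicator -/
def ind (B : Finset (Fin n)) (a : Fin n) : ℤ := if a ∈ B then 1 else 0

theorem ind_cases (B : Finset (Fin n)) (a : Fin n) : ind B a = 0 ∨ ind B a = 1 := by
  unfold ind; split_ifs <;> simp

theorem sum_ind (B : Finset (Fin n)) : ∑ a, ind B a = B.card := by
  unfold ind; simp

theorem sum_ind' (B : Finset (Fin n)) : ∑ a, (1 - ind B a) = (n:ℤ) - B.card := by
  rw [Finset.sum_sub_distrib, sum_ind]; simp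

theorem ind_compl (B : Finset (Fin n)) (a : Fin n) : ind Bᶜ a = 1 - ind B a := by
  unfold ind; by_cases h : a ∈ B <;> simp [h]

theorem fr_A (hk : 2 ≤ k) (S B : Finset (Fin n)) :
    (Module.finrank ℂ (offd (AA k S) (dg (fun _ => B))) : ℤ) = ∑ x, ∑ y, ind B x * (1 - ind B y) * (1 + ind S x - ind S y) := by
  rw [finrank_AA hk]
  push_cast
  refine Finset.sum_congr rfl fun x _ => Finset.sum_congr rfl fun y _ => ?_
  unfold ind
  by_cases h1 : x ∈ B <;> by_cases h2 : y ∈ B <;> by_cases h3 : x ∈ S <;> by_cases h4 : y ∈ S <;> simp [h1, h2, h3, h4]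

theorem fr_P (τ : Fin k → Fin n → ℕ) (B : Fin k → Finset (Fin n)) :
    (Module.finrank ℂ (offd (PP τ) (dg B)) : ℤ) = ∑ j, ∑ x, ∑ y, ind (B j) x * (1 - ind (B j) y) * (if τ j y ≤ τ j x then 1 else 0) := by
  rw [finrank_PP]
  push_cast
  refine Finset.sum_congr rfl fun j _ => Finset.sum_congr rfl fun x _ => Finset.sum_congr rfl fun y _ => ?_
  unfold ind
  by_cases h1 : x ∈ B j <;> by_cases h2 : y ∈ B j <;> simp [h1, h2]

theorem fr_top (B : Fin k → Finset (Fin n)) (b : ℕ) (hB : ∀ j, (B j).card = b) :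
    (Module.finrank ℂ (offd (⊤ : Subalgebra ℂ (RR k n)) (dg B)) : ℤ) = k * (b * (n - b)) := by
  rw [finrank_top]
  push_cast
  have : ∀ j, ∑ x, ∑ y, (if (x ∈ B j ∧ y ∉ B j) then (1:ℤ) else 0) = b * (n - b) := by
    intro j
    rw [← sum_uu (ind (B j)) b (n - b) (by rw [sum_ind, hB]) (by rw [sum_ind', hB])]
    refine Finset.sum_congr rfl fun x _ => Finset.sum_congr rfl fun y _ => ?_
    unfold ind
    by_cases h1 : x ∈ B j <;> by_cases h2 : y ∈ B j <;> simp [h1, h2]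
  rw [Finset.sum_congr rfl fun j _ => this j]; simp

theorem fr_int (B C : Fin k → Finset (Fin n)) (b : ℕ) (hB : ∀ j, (B j).card = b) (hC : ∀ j, (C j).card = b) :
    (Module.finrank ℂ (intw (dg B) (dg C)) : ℤ) = k * (b * b + (n - b) * (n - b)) := by
  rw [finrank_intw]
  push_cast
  have : ∀ j, ∑ x, ∑ y, (if (x ∈ B j ↔ y ∈ C j) then (1:ℤ) else 0) = b * b + (n - b) * (n - b) := by
    intro j
    have h1 : (b:ℤ) * b + (n - b) * (n - b) = ∑ x, ∑ y, (ind (B j) x * ind (C j) y + (1 - ind (B j) x) * (1 - ind (C j) y)) := by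
      simp only [Finset.sum_add_distrib]
      rw [← Finset.sum_mul_sum, ← Finset.sum_mul_sum, sum_ind, sum_ind, sum_ind', sum_ind', hB, hC]
    rw [h1]
    refine Finset.sum_congr rfl fun x _ => Finset.sum_congr rfl fun y _ => ?_
    unfold ind
    by_cases h1 : x ∈ B j <;> by_cases h2 : y ∈ C j <;> simp [h1, h2]
  rw [Finset.sum_congr rfl fun j _ => this j]; simp

set_option maxHeartbeats 2000000 in
theorem type_small (hk : 2 ≤ k) (τ : Fin k → Fin n → ℕ) (r : Fin k → ℕ) (ξ : Fin k → Fin n → ℂ)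
    (hτ : ∀ j i, (Finset.univ.filter fun a => τ j a = i).card + r j ≤ n) (hr : 2 * n ≤ ∑ j, r j)
    (hξ : ∀ j a b, τ j a = τ j b → ξ j a = ξ j b)
    (S : Finset (Fin n)) (hS : ∑ j, ∑ a, ξ j a = S.card)
    (hgen : ∀ (B : Fin k → Finset (Fin n)) (b : ℕ), 0 < b → b < n → (∀ j, (B j).card = b) → ∀ m : ℤ, ∑ j, ∑ a ∈ B j, ξ j a ≠ m)
    (B0 : Finset (Fin n)) (B : Fin k → Finset (Fin n)) (hb0 : 0 < B0.card) (hbn : B0.card < n) (hB : ∀ j, (B j).card = B0.card) :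
    Small (Bad (AA k S) (PP τ) (dg fun _ => B0) (dg B)) := by
  refine bad_small _ _ _ _ (dg_idem _) (dg_idem _) (dg_mem_AA _ _) (dg_mem_PP _ _) ?_
  obtain ⟨b, hb⟩ : ∃ b : ℕ, B0.card = b := ⟨_, rfl⟩
  obtain ⟨c, hc⟩ : ∃ c : ℕ, b + c = n := ⟨n - b, by omega⟩
  have hc' : (n:ℤ) - b = c := by omega
  rw [hb] at hb0 hbn hB
  have hbz : (0:ℤ) < b := by omega
  have hcz : (0:ℤ) < c := by omega
  have su : ∀ j, ∑ a, ind (B j) a = b := fun j => by rw [sum_ind, hB]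
  have su' : ∀ j, ∑ a, (1 - ind (B j) a) = c := fun j => by rw [sum_ind', hB, hc']
  have e10 := fr_A hk S B0
  have e01 := fr_A hk S B0ᶜ
  have eP := fr_P τ B
  have eP' := fr_P τ (fun j => (B j)ᶜ)
  have eI := fr_int (fun _ => B0) B b (fun _ => hb) hB
  have eT := fr_top B b hB
  have eT' := fr_top (fun j => (B j)ᶜ) c (fun j => by rw [Finset.card_compl, hB, Fintype.card_fin]; omega)
  have eR := finrank_RR (k := k) (n := n)
  rw [one_sub_dg, one_sub_dg]
  generalize Module.finrank ℂ (offd (AA k S) (dg fun _ => B0)) = fA at *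
  generalize Module.finrank ℂ (offd (AA k S) (dg fun _ => B0ᶜ)) = fA' at *
  generalize Module.finrank ℂ (offd (PP τ) (dg B)) = fP at *
  generalize Module.finrank ℂ (offd (PP τ) (dg fun j => (B j)ᶜ)) = fP' at *
  generalize Module.finrank ℂ (intw (dg fun _ => B0) (dg B)) = fI at *
  generalize Module.finrank ℂ (offd (⊤ : Subalgebra ℂ (RR k n)) (dg B)) = fT at *
  generalize Module.finrank ℂ (offd (⊤ : Subalgebra ℂ (RR k n)) (dg fun j => (B j)ᶜ)) = fT' at *
  generalize Module.finrank ℂ (RR k n) = fR at *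
  set s : ℤ := ∑ x, ind B0 x * ind S x with hs
  have sS : ∑ x, ind S x = S.card := sum_ind S
  -- A dims
  have sB0 : ∑ a, ind B0 a = b := by rw [sum_ind, hb]
  have sB0' : ∑ a, (1 - ind B0 a) = c := by rw [sum_ind', hb, hc']
  have sA : (fA:ℤ) = b * c + s * c - b * (S.card - s) := by
    have h1 : ∑ x, ∑ y, ind B0 x * (1 - ind B0 y) * (1 + ind S x - ind S y) = ∑ x, ∑ y, (ind B0 x * (1 - ind B0 y)
       + (ind B0 x * ind S x) * (1 - ind B0 y) - ind B0 x * ((1 - ind B0 y) * ind S y)) :=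
      Finset.sum_congr rfl fun x _ => Finset.sum_congr rfl fun y _ => by ring
    have h2 : ∑ y, (1 - ind B0 y) * ind S y = S.card - s := by
      rw [← sS, hs, ← Finset.sum_sub_distrib]; exact Finset.sum_congr rfl fun y _ => by ring
    rw [e10, h1]
    simp only [Finset.sum_add_distrib, Finset.sum_sub_distrib]
    rw [← Finset.sum_mul_sum, ← Finset.sum_mul_sum, ← Finset.sum_mul_sum, sB0, sB0', h2]
  have sA' : (fA:ℤ) + fA' = 2 * (b * c) := by
    have h1 : ∑ x, ∑ y, ind B0ᶜ x * (1 - ind B0ᶜ y) * (1 + ind S x - ind S y) = ∑ x, ∑ y, ind B0 x * (1 - ind B0 y) * (1 + ind S y - ind S x) := by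
      rw [Finset.sum_comm]
      refine Finset.sum_congr rfl fun x _ => Finset.sum_congr rfl fun y _ => ?_
      rw [ind_compl, ind_compl]; ring
    rw [e10, e01, h1, ← sum_uu (ind B0) b c sB0 sB0', two_mul, ← Finset.sum_add_distrib, ← Finset.sum_add_distrib]
    refine Finset.sum_congr rfl fun x _ => ?_
    rw [← Finset.sum_add_distrib, ← Finset.sum_add_distrib]
    exact Finset.sum_congr rfl fun y _ => by ring
  -- P dims
  let lt : Fin k → ℤ := fun j => ∑ x, ∑ y, ind (B j) x * (1 - ind (B j) y) * (if τ j x < τ j y then 1 else 0)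
  let eq : Fin k → ℤ := fun j => ∑ x, ∑ y, ind (B j) x * (1 - ind (B j) y) * (if τ j x = τ j y then 1 else 0)
  let gt : Fin k → ℤ := fun j => ∑ x, ∑ y, ind (B j) x * (1 - ind (B j) y) * (if τ j y < τ j x then 1 else 0)
  have htri : ∀ j, lt j + eq j + gt j = b * c := fun j => tri (ind (B j)) (τ j) b c (su j) (su' j)
  have sP : (fP:ℤ) = ∑ j, (eq j + gt j) := by
    rw [eP]
    refine Finset.sum_congr rfl fun j _ => ?_
    simp only [eq, gt, ← Finset.sum_add_distrib]
    refine Finset.sum_congr rfl fun x _ => Finset.sum_congr rfl fun y _ => ?_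
    rcases lt_trichotomy (τ j x) (τ j y) with h | h | h
    · simp [h.ne, h.le.not_gt, h.not_ge]
    · simp [h]
    · simp [h, h.ne', h.le]
  have sP' : (fP':ℤ) = ∑ j, (eq j + lt j) := by
    rw [eP']
    refine Finset.sum_congr rfl fun j _ => ?_
    rw [Finset.sum_comm]
    simp only [eq, lt, ← Finset.sum_add_distrib]
    refine Finset.sum_congr rfl fun x _ => Finset.sum_congr rfl fun y _ => ?_
    rw [ind_compl, ind_compl]
    rcases lt_trichotomy (τ j x) (τ j y) with h | h | h
    · simp [h.ne, h, h.le]; ring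
    · simp [h]; ring
    · simp [h.ne', h.le.not_gt, h.not_ge]
  have hbd : ∀ j, ((b:ℤ) + c) * eq j ≤ (n - r j) * b * c ∧ (((b:ℤ) + c) * eq j = (n - r j) * b * c →
      ∀ i, (∑ a, if τ j a = i then ((c:ℤ) * ind (B j) a - b * (1 - ind (B j) a)) else 0) = 0) := by
    intro j
    refine eq_bound (ind (B j)) (τ j) b c (n - r j) (ind_cases _) hbz hcz (su j) (su' j) ?_
    intro i
    have := hτ j i
    rw [Finset.card_filter] at this
    have h2 : ((∑ a, if τ j a = i then 1 else 0 : ℕ) : ℤ) = ∑ a, if τ j a = i then (1:ℤ) else 0 := by push_cast; rfl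
    rw [← h2]; omega
  have hsumeq : ((b:ℤ) + c) * ∑ j, eq j ≤ ∑ j, ((n:ℤ) - r j) * b * c := by
    rw [Finset.mul_sum]; exact Finset.sum_le_sum fun j _ => (hbd j).1
  have hR : ∑ j, ((n:ℤ) - r j) * b * c = (k * n - ∑ j, (r j : ℤ)) * (b * c) := by
    simp only [mul_assoc]
    rw [← Finset.sum_mul, Finset.sum_sub_distrib]; simp
  have hr' : 2 * (n:ℤ) ≤ ∑ j, (r j : ℤ) := by exact_mod_cast hr
  have hn' : (b:ℤ) + c = n := by exact_mod_cast hc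
  have hnpos : (0:ℤ) < n := by omega
  have hbc : (0:ℤ) < b * c := mul_pos hbz hcz
  have hle2 : (k * (n:ℤ) - ∑ j, (r j : ℤ)) * (b * c) ≤ n * ((k - 2) * (b * c)) := by nlinarith
  have hEle : ∑ j, eq j ≤ (k - 2) * (b * c) := by
    rw [hR, hn'] at hsumeq
    exact le_of_mul_le_mul_left (hsumeq.trans hle2) hnpos
  have hsumtri : ∑ j, lt j + ∑ j, eq j + ∑ j, gt j = k * (b * c) := by
    rw [← Finset.sum_add_distrib, ← Finset.sum_add_distrib]
    simp only [htri]; simp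
  rw [Finset.sum_add_distrib] at sP sP'
  have eR' : (fR:ℤ) = k * ((b + c) * (b + c)) := by rw [eR, ← hc]; push_cast; ring
  rw [hc'] at eI eT
  have eT2 : (fT':ℤ) = k * (b * c) := by rw [eT', ← hn']; ring
  have total : (fA:ℤ) + fA' + fI + fP + fP' = fR + (2 * (b * c) + ∑ j, eq j - k * (b * c)) := by
    rw [sA', sP, sP', eI, eR']
    linarith [hsumtri]
  rcases hEle.lt_or_eq with hlt | heq
  · left; zify; linarith
  · right
    refine ⟨by zify; linarith, ?_⟩
    have hall : ∀ j, ((b:ℤ) + c) * eq j = (n - r j) * b * c := by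
      have : ((b:ℤ) + c) * ∑ j, eq j = ∑ j, ((n:ℤ) - r j) * b * c := by
        refine le_antisymm hsumeq ?_
        rw [heq, hn', hR]; exact hle2
      rw [Finset.mul_sum] at this
      intro j
      exact (Finset.sum_eq_sum_iff_of_le (fun j _ => (hbd j).1)).1 this j (Finset.mem_univ j)
    have hfib := fun j => (hbd j).2 (hall j)
    have hlg : ∀ j, lt j = gt j := fun j => lt_eq_gt (ind (B j)) (τ j) b c hcz (hfib j)
    have hlgs : ∑ j, lt j = ∑ j, gt j := Finset.sum_congr rfl fun j _ => hlg j
    have hgts : ∑ j, gt j = b * c := by linarith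
    have hne : s * n ≠ b * S.card := by
      intro hcon
      refine hgen B b hb0 hbn hB s ?_
      -- n * sum = b * sum ξ
      have key : ∀ j, (n:ℂ) * ∑ a ∈ B j, ξ j a = b * ∑ a, ξ j a := by
        intro j
        obtain ⟨F, hF⟩ : ∃ F : ℕ → ℂ, ∀ a, F (τ j a) = ξ j a := by
          refine ⟨fun i => if h : ∃ a, τ j a = i then ξ j h.choose else 0, fun a => ?_⟩
          have hex : ∃ a', τ j a' = τ j a := ⟨a, rfl⟩
          simp only [hex, dif_pos]
          exact hξ j _ _ hex.choose_spec
        have h0 := fiber0 (K := ℂ) (fun a => ((((c:ℤ) * ind (B j) a - b * (1 - ind (B j) a) : ℤ)) : ℂ)) (τ j) (by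
          intro i
          have := congrArg (Int.cast : ℤ → ℂ) (hfib j i)
          rw [Int.cast_sum, Int.cast_zero] at this
          refine Eq.trans (Finset.sum_congr rfl fun a _ => ?_) this
          split_ifs <;> simp) F
        have h1 : ∑ a ∈ B j, ξ j a = ∑ a, (ind (B j) a : ℂ) * ξ j a := by
          simp [ind, Finset.sum_ite_mem]
        rw [h1, ← sub_eq_zero, Finset.mul_sum, Finset.mul_sum, ← Finset.sum_sub_distrib, ← h0]
        refine Finset.sum_congr rfl fun a _ => ?_
        have hnC : (n:ℂ) = b + c := by exact_mod_cast hc.symm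
        rw [hF, hnC]; push_cast; ring
      have hsum : (n:ℂ) * ∑ j, ∑ a ∈ B j, ξ j a = b * S.card := by
        rw [Finset.mul_sum, ← hS, Finset.mul_sum]; exact Finset.sum_congr rfl fun j _ => key j
      have hcon' : (s:ℂ) * n = b * S.card := by exact_mod_cast congrArg (Int.cast : ℤ → ℂ) hcon
      have hn0 : (n:ℂ) ≠ 0 := by exact_mod_cast (by omega : n ≠ 0)
      refine mul_left_cancel₀ hn0 (hsum.trans ?_)
      rw [← hcon']; ring
    have hsc : (fA:ℤ) = b * c + (s * n - b * S.card) := by rw [sA, ← hn']; ring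
    rcases lt_or_gt_of_ne hne with h | h
    · right; zify; rw [eT2, sP', hlgs, hgts, heq]; linarith
    · left; zify; rw [eT, sP, hgts, heq]; linarith
end main
end RH
end

section
open Set Filter Topology
namespace RH
section idem
open scoped Matrix.Norms.Operator
variable {k n : ℕ}

/-- the candidate diagonalizer -/
def vv (e : RR k n) (B : Fin k → Finset (Fin n)) : RR k n := e * dg B + (1 - e) * (1 - dg B)

theorem vv_entry (e : RR k n) (B : Fin k → Finset (Fin n)) (j : Fin k) (a b : Fin n) :
    vv e B j a b = if b ∈ B j then e j a b else (1 - e) j a b := by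
  unfold vv
  rw [one_sub_dg, Pi.add_apply, Matrix.add_apply, mul_dg, mul_dg]
  by_cases h : b ∈ B j <;> simp [h]

theorem exists_det (e : Matrix (Fin n) (Fin n) ℂ) : ∃ B : Finset (Fin n),
    (Matrix.of fun a b => if b ∈ B then e a b else (1 - e) a b).det ≠ 0 := by
  by_contra! hcon
  have h := MultilinearMap.map_add_univ (Matrix.detRowAlternating (R := ℂ) (n := Fin n)).toMultilinearMap e.transpose (1 - e).transpose
  have h1 : (e.transpose + (1 - e).transpose) = (1 : Matrix (Fin n) (Fin n) ℂ) := by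
    rw [← Matrix.transpose_add]; simp
  have h2 : ∀ B : Finset (Fin n), Matrix.det (B.piecewise e.transpose (1 - e).transpose : Matrix (Fin n) (Fin n) ℂ) = 0 := by
    intro B
    rw [← hcon B, ← Matrix.det_transpose]
    congr 1
    ext a b
    show (B.piecewise e.transpose (1 - e).transpose) a b = if a ∈ B then e b a else (1 - e) b a
    unfold Finset.piecewise
    split_ifs <;> rfl
  have h3 : Matrix.det (e.transpose + (1 - e).transpose) = ∑ B : Finset (Fin n), Matrix.det (B.piecewise e.transpose (1 - e).transpose : Matrix (Fin n) (Fin n) ℂ) := h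
  rw [h1, Matrix.det_one, Finset.sum_eq_zero (fun B _ => h2 B)] at h3
  exact one_ne_zero h3

theorem vv_conj (e : RR k n) (he : e * e = e) (B : Fin k → Finset (Fin n)) : e * vv e B = vv e B * dg B := by
  have hd := dg_idem B
  have h1 : e * (1 - e) = 0 := by rw [mul_sub, mul_one, he, sub_self]
  have h2 : (1 - dg B) * dg B = 0 := by rw [sub_mul, one_mul, hd, sub_self]
  unfold vv
  rw [mul_add, add_mul, ← mul_assoc, ← mul_assoc, he, h1, mul_assoc e, hd, mul_assoc (1 - e), h2]; simp

theorem vv_mem (A : Subalgebra ℂ (RR k n)) (e : RR k n) (he : e ∈ A) (B : Fin k → Finset (Fin n)) (hB : dg B ∈ A) : vv e B ∈ A :=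
  A.add_mem (A.mul_mem he hB) (A.mul_mem (A.sub_mem A.one_mem he) (A.sub_mem A.one_mem hB))

theorem isUnit_of_det (v : RR k n) (h : ∀ j, (v j).det ≠ 0) : IsUnit v := by
  rw [Pi.isUnit_iff]
  intro j
  rw [Matrix.isUnit_iff_isUnit_det]
  exact (h j).isUnit

theorem exists_vv (e : RR k n) : ∃ B, IsUnit (vv e B) := by
  choose B hB using fun j => exists_det (e j)
  refine ⟨B, isUnit_of_det _ fun j => ?_⟩
  convert hB j using 2
  ext a b; rw [vv_entry]; rfl

theorem det_block (S : Finset (Fin n)) (p q : Matrix (Fin n) (Fin n) ℂ) (h2 : ∀ a b, a ∉ S → b ∈ S → p a b = 0)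
    (h3 : ∀ a b, ¬ (a ∈ S ∧ b ∉ S) → q a b = 0) (c : ℂ) : (p + c • q).det = p.det := by
  rw [Matrix.twoBlockTriangular_det (p + c • q) (fun a => a ∈ S), Matrix.twoBlockTriangular_det p (fun a => a ∈ S)]
  · have e1 : (p + c • q).toSquareBlockProp (fun a => a ∈ S) = p.toSquareBlockProp (fun a => a ∈ S) := by
      ext a b
      show p a b + c * q a b = p a b
      rw [h3 a b (fun h => h.2 b.2), mul_zero, add_zero]
    have e2 : (p + c • q).toSquareBlockProp (fun a => ¬ a ∈ S) = p.toSquareBlockProp (fun a => ¬ a ∈ S) := by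
      ext a b
      show p a b + c * q a b = p a b
      rw [h3 a b (fun h => a.2 h.1), mul_zero, add_zero]
    rw [e1, e2]
  · intro a ha b hb
    exact h2 a b ha hb
  · intro a ha b hb
    show p a b + c * q a b = 0
    rw [h2 a b ha hb, h3 a b (fun h => ha h.1), mul_zero, add_zero]

theorem det_AA (hk : 0 < k) (S : Finset (Fin n)) (v : RR k n) (hv : v ∈ AA k S) (j : Fin k) : (v j).det = (v ⟨0, hk⟩).det := by
  obtain ⟨p, q, h1, h2, h3⟩ := hv
  rw [h1, h1, det_block S p q h2 h3, det_block S p q h2 h3]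

theorem exists_vv_AA (hk : 0 < k) (S : Finset (Fin n)) (e : RR k n) (he : e ∈ AA k S) : ∃ B : Finset (Fin n), IsUnit (vv e (fun _ => B)) := by
  obtain ⟨B, hB⟩ := exists_det (e ⟨0, hk⟩)
  refine ⟨B, isUnit_of_det _ fun j => ?_⟩
  rw [det_AA hk S _ (vv_mem _ e he _ (dg_mem_AA S B))]
  convert hB using 2
  ext a b; rw [vv_entry]; rfl

theorem trace_dg (B : Fin k → Finset (Fin n)) (j : Fin k) : (dg B j).trace = (B j).card := by
  simp [dg, Matrix.trace_diagonal]

theorem mem_bad (hk : 0 < k) (S : Finset (Fin n)) (τ : Fin k → Fin n → ℕ) (g : (RR k n)ˣ) (e : RR k n) (he : e ∈ AA k S) (hee : e * e = e)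
    (hp : (g⁻¹ : (RR k n)ˣ).val * e * g.val ∈ PP τ) (h0 : e ≠ 0) (h1 : e ≠ 1) :
    ∃ B0 : Finset (Fin n), ∃ B : Fin k → Finset (Fin n), 0 < B0.card ∧ B0.card < n ∧ (∀ j, (B j).card = B0.card) ∧
      g.val ∈ Bad (AA k S) (PP τ) (dg fun _ => B0) (dg B) := by
  obtain ⟨B0, x, hx⟩ := exists_vv_AA hk S e he
  set e' := (g⁻¹ : (RR k n)ˣ).val * e * g.val with he'
  obtain ⟨B, p, hp'⟩ := exists_vv e'
  have hee' : e' * e' = e' := by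
    rw [he', show (g⁻¹ : (RR k n)ˣ).val * e * g.val * ((g⁻¹ : (RR k n)ˣ).val * e * g.val) = (g⁻¹ : (RR k n)ˣ).val * e * (g.val * (g⁻¹ : (RR k n)ˣ).val) * e * g.val by simp only [mul_assoc], Units.mul_inv, mul_one, mul_assoc _ e e, hee]
  have hxA : x.val ∈ AA k S := by rw [hx]; exact vv_mem _ e he _ (dg_mem_AA S B0)
  have hpP : p.val ∈ PP τ := by rw [hp']; exact vv_mem _ e' hp _ (dg_mem_PP τ B)
  have cx : e * x.val = x.val * dg (fun _ => B0) := by rw [hx]; exact vv_conj e hee _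
  have cp : e' * p.val = p.val * dg B := by rw [hp']; exact vv_conj e' hee' _
  have cg : g.val * e' = e * g.val := by
    rw [he', ← mul_assoc, ← mul_assoc, Units.mul_inv, one_mul]
  set y : (RR k n)ˣ := x⁻¹ * g * p with hy
  have cy : dg (fun _ => B0) * y.val = y.val * dg B := by
    have hx2 : dg (fun _ => B0) * (x⁻¹ : (RR k n)ˣ).val = (x⁻¹ : (RR k n)ˣ).val * e := by
      rw [Units.mul_inv_eq_iff_eq_mul, mul_assoc, cx, Units.inv_mul_cancel_left]
    calc dg (fun _ => B0) * y.val = (dg (fun _ => B0) * (x⁻¹ : (RR k n)ˣ).val) * g.val * p.val := by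
          rw [hy]; push_cast; simp only [mul_assoc]
      _ = (x⁻¹ : (RR k n)ˣ).val * (g.val * e') * p.val := by rw [hx2, cg]; simp only [mul_assoc]
      _ = (x⁻¹ : (RR k n)ˣ).val * g.val * (e' * p.val) := by simp only [mul_assoc]
      _ = y.val * dg B := by rw [cp, hy]; push_cast; simp only [mul_assoc]
  have hcard : ∀ j, (B j).card = B0.card := by
    intro j
    have h3 : dg (fun _ => B0) = y.val * dg B * (y⁻¹ : (RR k n)ˣ).val := by rw [← cy, Units.mul_inv_cancel_right]
    have h4 := congrArg (fun F : RR k n => (F j).trace) h3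
    simp only [Pi.mul_apply] at h4
    rw [Matrix.trace_mul_cycle, trace_dg, ← Pi.mul_apply, Units.inv_mul, Pi.one_apply, one_mul, trace_dg] at h4
    exact_mod_cast h4.symm
  have hex : e = x.val * dg (fun _ => B0) * (x⁻¹ : (RR k n)ˣ).val := by rw [← cx, Units.mul_inv_cancel_right]
  refine ⟨B0, B, ?_, ?_, hcard, x, y, p⁻¹, hxA, ?_, cy, ?_⟩
  · rw [Finset.card_pos]
    by_contra hcon
    rw [Finset.not_nonempty_iff_eq_empty] at hcon
    apply h0
    have : dg (fun _ : Fin k => B0) = 0 := by funext j; simp [dg, hcon]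
    rw [hex, this]; simp
  · have hle : B0.card ≤ n := by simpa using B0.card_le_univ
    refine lt_of_le_of_ne hle fun hcon => h1 ?_
    have hB0 : B0 = Finset.univ := by rw [← Finset.card_eq_iff_eq_univ]; simpa using hcon
    have : dg (fun _ : Fin k => B0) = 1 := by funext j; simp [dg, hB0]
    rw [hex, this]; simp
  · exact inv_mem_subalgebra _ _ hpP
  · rw [hy]; push_cast; simp [mul_assoc]
    
theorem exists_good (hn : 0 < n) (hk : 2 ≤ k) (τ : Fin k → Fin n → ℕ) (r : Fin k → ℕ) (ξ : Fin k → Fin n → ℂ)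
    (hτ : ∀ j i, (Finset.univ.filter fun a => τ j a = i).card + r j ≤ n) (hr : 2 * n ≤ ∑ j, r j)
    (hξ : ∀ j a b, τ j a = τ j b → ξ j a = ξ j b)
    (S : Finset (Fin n)) (hS : ∑ j, ∑ a, ξ j a = S.card)
    (hgen : ∀ (B : Fin k → Finset (Fin n)) (b : ℕ), 0 < b → b < n → (∀ j, (B j).card = b) → ∀ m : ℤ, ∑ j, ∑ a ∈ B j, ξ j a ≠ m) :
    ∃ g : (RR k n)ˣ, ∀ e ∈ AA k S, e * e = e → (g⁻¹ : (RR k n)ˣ).val * e * g.val ∈ PP τ → e = 0 ∨ e = 1 := by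
  haveI : Nonempty (Fin n) := ⟨⟨0, hn⟩⟩
  haveI : Nonempty (Fin k) := ⟨⟨0, by omega⟩⟩
  have : Small (⋃ t : {t : Finset (Fin n) × (Fin k → Finset (Fin n)) // 0 < t.1.card ∧ t.1.card < n ∧ ∀ j, (t.2 j).card = t.1.card},
      Bad (AA k S) (PP τ) (dg fun _ => t.1.1) (dg t.1.2)) :=
    small_iUnion fun t => type_small hk τ r ξ hτ hr hξ S hS hgen t.1.1 t.1.2 t.2.1 t.2.2.1 t.2.2.2
  obtain ⟨g, hg⟩ := exists_unit_not_mem this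
  refine ⟨g, fun e he hee hp => ?_⟩
  by_contra! hcon
  obtain ⟨B0, B, b1, b2, b3, b4⟩ := mem_bad (by omega) S τ g e he hee hp hcon.1 hcon.2
  exact hg (mem_iUnion.2 ⟨⟨(B0, B), b1, b2, b3⟩, b4⟩)
end idem
end RH
end

section
open Set Filter Topology
namespace RH
section nil
open scoped Matrix.Norms.Operator
variable {k n : ℕ}

theorem exists_nilp {R : Type*} [Ring R] [Algebra ℂ R] [FiniteDimensional ℂ R] [Nontrivial R] (Q : Subalgebra ℂ R)
    (hQ : ∀ e ∈ Q, e * e = e → e = 0 ∨ e = 1) (φ : R) (hφ : φ ∈ Q) : ∃ t : ℂ, IsNilpotent (φ - algebraMap ℂ R t) := by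
  have hintg : IsIntegral ℂ φ := IsIntegral.of_finite ℂ φ
  have hne : minpoly ℂ φ ≠ 0 := minpoly.ne_zero hintg
  obtain ⟨t, ht⟩ := Complex.exists_root (minpoly.degree_pos hintg)
  obtain ⟨q, hq, hqd⟩ := Polynomial.exists_eq_pow_rootMultiplicity_mul_and_not_dvd (minpoly ℂ φ) hne t
  set m := (minpoly ℂ φ).rootMultiplicity t
  have hm : 0 < m := (Polynomial.rootMultiplicity_pos hne).2 ht
  have hirr : Irreducible (Polynomial.X - Polynomial.C t) := Polynomial.irreducible_X_sub_C t
  have hcop : IsCoprime ((Polynomial.X - Polynomial.C t) ^ m) q := (hirr.coprime_iff_not_dvd.2 hqd).pow_left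
  obtain ⟨u, w, huw⟩ := hcop
  have h1 : Polynomial.aeval φ u * Polynomial.aeval φ ((Polynomial.X - Polynomial.C t) ^ m) + Polynomial.aeval φ w * Polynomial.aeval φ q = 1 := by
    rw [← map_mul, ← map_mul, ← map_add, huw, map_one]
  have h0 : Polynomial.aeval φ ((Polynomial.X - Polynomial.C t) ^ m) * Polynomial.aeval φ q = 0 := by
    rw [← map_mul, ← hq, minpoly.aeval]
  have hc : ∀ f h : Polynomial ℂ, Polynomial.aeval φ f * Polynomial.aeval φ h = Polynomial.aeval φ h * Polynomial.aeval φ f := by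
    intro f h; rw [← map_mul, mul_comm, map_mul]
  set P := Polynomial.aeval φ ((Polynomial.X - Polynomial.C t) ^ m) with hP
  set e := Polynomial.aeval φ u * P with he
  have hee : e * e = e := by
    have : e * (Polynomial.aeval φ w * Polynomial.aeval φ q) = 0 := by
      rw [he, hP, hc w q, mul_assoc, ← mul_assoc P, h0]; simp
    calc e * e = e * (e + Polynomial.aeval φ w * Polynomial.aeval φ q) := by rw [mul_add, this, add_zero]
      _ = e := by rw [h1, mul_one]
  have hmem : e ∈ Q := by
    rw [he, hP, ← map_mul]
    exact Algebra.adjoin_le (by simpa using hφ) (Polynomial.aeval_mem_adjoin_singleton ℂ φ)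
  rcases hQ e hmem hee with h | h
  · refine ⟨t, m, ?_⟩
    have hPz : P = 0 := by
      calc P = P * (e + Polynomial.aeval φ w * Polynomial.aeval φ q) := by rw [h1, mul_one]
        _ = 0 := by rw [h, zero_add, hc w q, ← mul_assoc, h0, zero_mul]
    rw [← hPz, hP]; simp
  · exfalso
    have hwq : Polynomial.aeval φ w * Polynomial.aeval φ q = 0 := by rw [h] at h1; simpa using h1
    have hqz : Polynomial.aeval φ q = 0 := by
      calc Polynomial.aeval φ q = e * Polynomial.aeval φ q := by rw [h, one_mul]
        _ = 0 := by rw [he, mul_assoc, h0, mul_zero]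
    have hdvd := minpoly.dvd ℂ φ hqz
    apply hqd
    refine (dvd_trans ?_ hdvd)
    rw [hq]
    exact dvd_mul_of_dvd_left (dvd_pow_self _ hm.ne') _

/-- block of a matrix -/
def blk (τ : Fin n → ℕ) (i : ℕ) (M : Matrix (Fin n) (Fin n) ℂ) : Matrix (Fin n) (Fin n) ℂ :=
  Matrix.of fun a b => if τ a = i ∧ τ b = i then M a b else 0

theorem blk_mul (τ : Fin n → ℕ) (i : ℕ) (M N : Matrix (Fin n) (Fin n) ℂ) (hM : M ∈ pat τ) (hN : N ∈ pat τ) :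
    blk τ i (M * N) = blk τ i M * blk τ i N := by
  ext a b
  simp only [blk, Matrix.of_apply, Matrix.mul_apply]
  by_cases h : τ a = i ∧ τ b = i
  · rw [if_pos h]
    refine Finset.sum_congr rfl fun c _ => ?_
    by_cases hc : τ c = i
    · simp [h, hc]
    · by_cases h2 : τ c ≤ τ a
      · rw [hN c b (by omega)]; simp
      · rw [hM a c h2]; simp
  · rw [if_neg h]
    symm
    refine Finset.sum_eq_zero fun c _ => ?_
    by_cases ha : τ a = i
    · rw [if_neg (c := τ c = i ∧ τ b = i) (by tauto), mul_zero]
    · rw [if_neg (c := τ a = i ∧ τ c = i) (by tauto), zero_mul]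

theorem blk_pow (τ : Fin n → ℕ) (i : ℕ) (M : Matrix (Fin n) (Fin n) ℂ) (hM : M ∈ pat τ) (m : ℕ) :
    blk τ i (M ^ (m + 1)) = blk τ i M ^ (m + 1) := by
  induction m with
  | zero => simp
  | succ m ih => rw [pow_succ, blk_mul τ i _ _ (Subalgebra.pow_mem _ hM _) hM, ih, ← pow_succ]

theorem blk_trace (τ : Fin n → ℕ) (i : ℕ) (M : Matrix (Fin n) (Fin n) ℂ) (hM : M ∈ pat τ) (h : IsNilpotent M) :
    (∑ a, if τ a = i then M a a else 0) = 0 := by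
  obtain ⟨m, hm⟩ := h
  have h2 : IsNilpotent (blk τ i M) := ⟨m + 1, by rw [← blk_pow τ i M hM, pow_succ, hm]; ext a b; simp [blk]⟩
  have h3 := (Matrix.isNilpotent_trace_of_isNilpotent h2).eq_zero
  refine Eq.trans ?_ h3
  simp [Matrix.trace, blk]

theorem wtrace (τ : Fin n → ℕ) (M : Matrix (Fin n) (Fin n) ℂ) (hM : M ∈ pat τ) (h : IsNilpotent M) (ξ : Fin n → ℂ)
    (hξ : ∀ a b, τ a = τ b → ξ a = ξ b) : ∑ a, ξ a * M a a = 0 := by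
  obtain ⟨F, hF⟩ : ∃ F : ℕ → ℂ, ∀ a, F (τ a) = ξ a := by
    refine ⟨fun i => if h : ∃ a, τ a = i then ξ h.choose else 0, fun a => ?_⟩
    have hex : ∃ a', τ a' = τ a := ⟨a, rfl⟩
    simp only [hex, dif_pos]
    exact hξ _ _ hex.choose_spec
  rw [← fiber0 (fun a => M a a) τ (fun i => blk_trace τ i M hM h) F]
  refine Finset.sum_congr rfl fun a _ => ?_
  rw [hF, mul_comm]

/-- the stabilizer algebra -/
def QQ (S : Finset (Fin n)) (τ : Fin k → Fin n → ℕ) (g : (RR k n)ˣ) : Subalgebra ℂ (RR k n) where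
  carrier := {φ | φ ∈ AA k S ∧ (g⁻¹ : (RR k n)ˣ).val * φ * g.val ∈ PP τ}
  add_mem' := by
    rintro x y ⟨h1, h2⟩ ⟨h3, h4⟩
    exact ⟨add_mem h1 h3, by rw [mul_add, add_mul]; exact add_mem h2 h4⟩
  mul_mem' := by
    rintro x y ⟨h1, h2⟩ ⟨h3, h4⟩
    refine ⟨mul_mem h1 h3, ?_⟩
    have : (g⁻¹ : (RR k n)ˣ).val * (x * y) * g.val = ((g⁻¹ : (RR k n)ˣ).val * x * g.val) * ((g⁻¹ : (RR k n)ˣ).val * y * g.val) := by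
      simp [mul_assoc]
    rw [this]; exact mul_mem h2 h4
  algebraMap_mem' := by
    intro r
    refine ⟨(AA k S).algebraMap_mem r, ?_⟩
    rw [← Algebra.commutes, mul_assoc, Units.inv_mul, mul_one]; exact (PP τ).algebraMap_mem r

theorem alg_entry (t : ℂ) (j : Fin k) (a : Fin n) : (algebraMap ℂ (RR k n) t) j a a = t := by
  simp [Pi.algebraMap_apply, Matrix.algebraMap_matrix_apply]

theorem ell_zero (hn : 0 < n) (hk : 0 < k) (τ : Fin k → Fin n → ℕ) (ξ : Fin k → Fin n → ℂ)
    (hξ : ∀ j a b, τ j a = τ j b → ξ j a = ξ j b)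
    (S : Finset (Fin n)) (hS : ∑ j, ∑ a, ξ j a = S.card) (g : (RR k n)ˣ)
    (hg : ∀ e ∈ AA k S, e * e = e → (g⁻¹ : (RR k n)ˣ).val * e * g.val ∈ PP τ → e = 0 ∨ e = 1)
    (φ : RR k n) (h1 : φ ∈ AA k S) (h2 : (g⁻¹ : (RR k n)ˣ).val * φ * g.val ∈ PP τ) :
    ∑ a ∈ S, φ ⟨0, hk⟩ a a = ∑ j, ∑ a, ξ j a * ((g⁻¹ : (RR k n)ˣ).val * φ * g.val) j a a := by
  haveI : Nonempty (Fin n) := ⟨⟨0, hn⟩⟩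
  haveI : Nonempty (Fin k) := ⟨⟨0, by omega⟩⟩
  obtain ⟨t, m, ht⟩ := exists_nilp (QQ S τ g) (fun e he hee => hg e he.1 hee he.2) φ ⟨h1, h2⟩
  have e1 : ∑ a ∈ S, φ ⟨0, hk⟩ a a = S.card * t := by
    have hp : (φ - algebraMap ℂ (RR k n) t) ⟨0, hk⟩ ∈ pat (fun a => if a ∈ S then 1 else 0) := by
      obtain ⟨p, q, hp, hp2, hp3⟩ := (AA k S).sub_mem h1 ((AA k S).algebraMap_mem t)
      intro a b hab
      rw [hp]
      have hb : b ∈ S := by by_contra hb; simp [hb] at hab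
      have ha : a ∉ S := by intro ha; simp [hb, ha] at hab
      simp [hp2 a b ha hb]
    have := wtrace _ _ hp ⟨m, by rw [← Pi.pow_apply, ht]; rfl⟩ (fun a => if a ∈ S then 1 else 0) (by
      intro a b hab
      by_cases ha : a ∈ S <;> by_cases hb : b ∈ S <;> simp [ha, hb] at hab ⊢)
    simp only [Pi.sub_apply, Matrix.sub_apply, alg_entry, ite_mul, one_mul, zero_mul, Finset.sum_ite_mem, Finset.univ_inter, Finset.sum_sub_distrib] at this
    rw [sub_eq_zero] at this
    rw [this]; simp
  have hψ : (g⁻¹ : (RR k n)ˣ).val * (φ - algebraMap ℂ (RR k n) t) * g.val = (g⁻¹ : (RR k n)ˣ).val * φ * g.val - algebraMap ℂ (RR k n) t := by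
    rw [mul_sub, sub_mul, ← Algebra.commutes t (g⁻¹ : (RR k n)ˣ).val, mul_assoc (algebraMap ℂ (RR k n) t), Units.inv_mul, mul_one]
  have hψn : ((g⁻¹ : (RR k n)ˣ).val * φ * g.val - algebraMap ℂ (RR k n) t) ^ m = 0 := by
    have h5 := Units.conj_pow' g (φ - algebraMap ℂ (RR k n) t) m
    rw [← hψ, h5, ht]; simp
  have hψp := (PP τ).sub_mem h2 ((PP τ).algebraMap_mem t)
  set ψ := (g⁻¹ : (RR k n)ˣ).val * φ * g.val
  have e2 : ∀ j, ∑ a, ξ j a * ψ j a a = (∑ a, ξ j a) * t := by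
    intro j
    have := wtrace (τ j) _ (hψp j) ⟨m, by rw [← Pi.pow_apply, hψn]; rfl⟩ (ξ j) (hξ j)
    simp only [Pi.sub_apply, Matrix.sub_apply, alg_entry, mul_sub, Finset.sum_sub_distrib] at this
    rw [sub_eq_zero] at this
    rw [this, Finset.sum_mul]
  rw [e1, Finset.sum_congr rfl (fun j _ => e2 j), ← Finset.sum_mul, hS]

theorem exists_dual {V W : Type*} [AddCommGroup V] [Module ℂ V] [AddCommGroup W] [Module ℂ W] (f : V →ₗ[ℂ] W) (l : V →ₗ[ℂ] ℂ)
    (h : ∀ v, f v = 0 → l v = 0) : ∃ m : W →ₗ[ℂ] ℂ, ∀ v, l v = m (f v) := by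
  have : l ∈ LinearMap.range f.dualMap := by
    rw [LinearMap.range_dualMap_eq_dualAnnihilator_ker, Submodule.mem_dualAnnihilator]
    exact fun v hv => h v hv
  obtain ⟨m, hm⟩ := this
  exact ⟨m, fun v => by rw [← hm]; rfl⟩

theorem trace_eq (hn : 0 < n) (hk : 0 < k) (τ : Fin k → Fin n → ℕ) (ξ : Fin k → Fin n → ℂ)
    (hξ : ∀ j a b, τ j a = τ j b → ξ j a = ξ j b)
    (S : Finset (Fin n)) (hS : ∑ j, ∑ a, ξ j a = S.card) (g : (RR k n)ˣ)
    (hg : ∀ e ∈ AA k S, e * e = e → (g⁻¹ : (RR k n)ˣ).val * e * g.val ∈ PP τ → e = 0 ∨ e = 1) :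
    ∃ u : RR k n, (∀ j a b, ¬ τ j b < τ j a → u j a b = 0) ∧
      ∀ φ ∈ AA k S, ∑ j, (((g.val j) * (Matrix.diagonal (ξ j) + u j) * (g⁻¹ : (RR k n)ˣ).val j) * φ j).trace = ∑ a ∈ S, φ ⟨0, hk⟩ a a := by
  let cj : AA k S →ₗ[ℂ] RR k n := (LinearMap.mulRight ℂ g.val ∘ₗ LinearMap.mulLeft ℂ (g⁻¹ : (RR k n)ˣ).val) ∘ₗ (AA k S).val.toLinearMap
  have hcj : ∀ φ : AA k S, cj φ = (g⁻¹ : (RR k n)ˣ).val * φ.1 * g.val := fun φ => rfl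
  let f : AA k S →ₗ[ℂ] (Fin k × Fin n × Fin n → ℂ) := 
    { toFun := fun φ x => if τ x.1 x.2.2 ≤ τ x.1 x.2.1 then 0 else cj φ x.1 x.2.1 x.2.2
      map_add' := by
        intro φ ψ; funext x
        by_cases h : τ x.1 x.2.2 ≤ τ x.1 x.2.1 <;> simp [h]
      map_smul' := by
        intro c ψ; funext x
        by_cases h : τ x.1 x.2.2 ≤ τ x.1 x.2.1 <;> simp [h] }
  let l : AA k S →ₗ[ℂ] ℂ := 
    { toFun := fun φ => ∑ a ∈ S, φ.1 ⟨0, hk⟩ a a - ∑ j, ∑ a, ξ j a * cj φ j a a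
      map_add' := by
        intro φ ψ
        simp only [map_add, Pi.add_apply, Matrix.add_apply, mul_add, Finset.sum_add_distrib, Subalgebra.coe_add]; ring
      map_smul' := by
        intro c ψ
        simp only [map_smul, Pi.smul_apply, Matrix.smul_apply, Subalgebra.coe_smul, smul_eq_mul, RingHom.id_apply, mul_sub, Finset.mul_sum]
        congr 1
        refine Finset.sum_congr rfl fun j _ => Finset.sum_congr rfl fun a _ => ?_
        ring }
  obtain ⟨m, hm⟩ := exists_dual f l (by
    intro φ hφ
    show ∑ a ∈ S, φ.1 ⟨0, hk⟩ a a - ∑ j, ∑ a, ξ j a * cj φ j a a = 0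
    rw [sub_eq_zero]
    refine ell_zero hn hk τ ξ hξ S hS g hg φ.1 φ.2 ?_
    intro j a b hab
    have := congrFun hφ (j, a, b)
    simpa [f, hab, hcj] using this)
  let u : RR k n := fun j => Matrix.of fun b a => if τ j b ≤ τ j a then 0 else m (Pi.single (j, a, b) 1)
  refine ⟨u, ?_, ?_⟩
  · intro j a b h
    simp only [u, Matrix.of_apply]
    rw [if_pos (by omega)]
  · intro φ hφ
    have h1 := hm ⟨φ, hφ⟩
    have h2 : ∀ v : Fin k × Fin n × Fin n → ℂ, m v = ∑ x, v x * m (Pi.single x 1) := by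
      intro v
      conv_lhs => rw [pi_eq_sum_univ' v]
      rw [map_sum]
      refine Finset.sum_congr rfl fun x _ => ?_
      rw [map_smul, smul_eq_mul]
    set ψ := cj ⟨φ, hφ⟩ with hψ
    have h3 : m (f ⟨φ, hφ⟩) = ∑ j, (u j * ψ j).trace := by
      rw [h2, Fintype.sum_prod_type]
      refine Finset.sum_congr rfl fun j _ => ?_
      rw [Fintype.sum_prod_type, Finset.sum_comm]
      simp only [Matrix.trace, Matrix.diag_apply, Matrix.mul_apply]
      refine Finset.sum_congr rfl fun b _ => Finset.sum_congr rfl fun a _ => ?_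
      simp only [u, f, Matrix.of_apply, LinearMap.coe_mk, AddHom.coe_mk]
      split_ifs
      · simp
      · rw [mul_comm]
    have h4 : ∀ j, (Matrix.diagonal (ξ j) * ψ j).trace = ∑ a, ξ j a * ψ j a a := by
      intro j; simp [Matrix.trace, Matrix.diagonal_mul]
    have h5 : ∀ j, (((g.val j) * (Matrix.diagonal (ξ j) + u j) * (g⁻¹ : (RR k n)ˣ).val j) * φ j).trace = (∑ a, ξ j a * ψ j a a) + (u j * ψ j).trace := by
      intro j
      rw [← h4, ← Matrix.trace_add, ← add_mul, mul_assoc, mul_assoc, Matrix.trace_mul_comm, mul_assoc]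
      rfl
    rw [Finset.sum_congr rfl (fun j _ => h5 j), Finset.sum_add_distrib, ← h3, ← h1]
    show _ + (∑ a ∈ S, φ ⟨0, hk⟩ a a - ∑ j, ∑ a, ξ j a * ψ j a a) = _
    ring

theorem exists_additive (hn : 0 < n) (hk : 2 ≤ k) (τ : Fin k → Fin n → ℕ) (r : Fin k → ℕ) (ξ : Fin k → Fin n → ℂ)
    (hτ : ∀ j i, (Finset.univ.filter fun a => τ j a = i).card + r j ≤ n) (hr : 2 * n ≤ ∑ j, r j)
    (hξ : ∀ j a b, τ j a = τ j b → ξ j a = ξ j b)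
    (S : Finset (Fin n)) (hS : ∑ j, ∑ a, ξ j a = S.card)
    (hgen : ∀ (B : Fin k → Finset (Fin n)) (b : ℕ), 0 < b → b < n → (∀ j, (B j).card = b) → ∀ m : ℤ, ∑ j, ∑ a ∈ B j, ξ j a ≠ m) :
    ∃ (u : Fin k → Matrix (Fin n) (Fin n) ℂ) (g : Fin k → (Matrix (Fin n) (Fin n) ℂ)ˣ),
      (∀ j a b, ¬ τ j b < τ j a → u j a b = 0) ∧ ∃ A : Fin k → Matrix (Fin n) (Fin n) ℂ,
      (∀ j, A j = (g j).val * (Matrix.diagonal (ξ j) + u j) * ((g j)⁻¹).val) ∧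
      (∀ a b, (a ∈ S ↔ b ∈ S) → ∑ j, A j a b = if a = b ∧ a ∈ S then 1 else 0) ∧
      (∀ a b, a ∉ S → b ∈ S → ∑ j, A j a b = 0) ∧
      (∀ a b, a ∉ S → b ∈ S → ∑ j : Fin k, ((j:ℕ):ℂ) * A j a b = 0) := by
  obtain ⟨g, hg⟩ := exists_good hn hk τ r ξ hτ hr hξ S hS hgen
  obtain ⟨u, hu, ht⟩ := trace_eq hn (by omega) τ ξ hξ S hS g hg
  refine ⟨u, fun j => ⟨g.val j, (g⁻¹ : (RR k n)ˣ).val j, by rw [← Pi.mul_apply, Units.mul_inv, Pi.one_apply],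
    by rw [← Pi.mul_apply, Units.inv_mul, Pi.one_apply]⟩, hu,
    fun j => (g.val j) * (Matrix.diagonal (ξ j) + u j) * (g⁻¹ : (RR k n)ˣ).val j, fun j => rfl, ?_⟩
  generalize hA : (fun j => (g.val j) * (Matrix.diagonal (ξ j) + u j) * (g⁻¹ : (RR k n)ˣ).val j) = A
  have ht' : ∀ φ ∈ AA k S, ∑ j, (A j * φ j).trace = ∑ a ∈ S, φ ⟨0, by omega⟩ a a := by
    intro φ hφ; rw [← ht φ hφ, ← hA]
  have htr : ∀ (M : Matrix (Fin n) (Fin n) ℂ) (a b : Fin n) (c : ℂ), (M * Matrix.single b a c).trace = c * M a b := by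
    intro M a b c; rw [Matrix.trace_mul_single]; simp [mul_comm]
  have hc1 : ∀ a b, ¬ (b ∉ S ∧ a ∈ S) → ∑ j, A j a b = ∑ x ∈ S, Matrix.single b a (1:ℂ) x x := by
    intro a b h
    rw [← ht' (fun _ => Matrix.single b a 1)]
    · refine Finset.sum_congr rfl fun j _ => ?_
      rw [htr, one_mul]
    · refine ⟨Matrix.single b a 1, 0, fun j => by simp, ?_, by simp⟩
      intro x y hx hy
      rw [Matrix.single_apply_of_ne]
      rintro ⟨rfl, rfl⟩; exact h ⟨hx, hy⟩
  refine ⟨?_, ?_, ?_⟩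
  · intro a b h
    rw [hc1 a b (by tauto)]
    by_cases hab : a = b
    · subst hab
      by_cases ha : a ∈ S
      · simp [Matrix.single_apply, ha]
      · rw [if_neg (by tauto)]
        refine Finset.sum_eq_zero fun x hx => ?_
        rw [Matrix.single_apply_of_ne]; rintro ⟨rfl, _⟩; exact ha hx
    · rw [if_neg (by tauto)]
      refine Finset.sum_eq_zero fun x hx => ?_
      rw [Matrix.single_apply_of_ne]; rintro ⟨rfl, h⟩; exact hab h
  · intro a b ha hb
    rw [hc1 a b (by tauto)]
    refine Finset.sum_eq_zero fun x hx => ?_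
    rw [Matrix.single_apply_of_ne]; rintro ⟨_, rfl⟩; exact ha hx
  · intro a b ha hb
    have := ht' (fun j => ((j:ℕ):ℂ) • Matrix.single b a 1) ⟨0, Matrix.single b a 1, fun j => by simp, by simp, by
      intro x y hxy
      rw [Matrix.single_apply_of_ne]; rintro ⟨rfl, rfl⟩; exact hxy ⟨hb, ha⟩⟩
    simp only [Nat.cast_zero, zero_smul, Matrix.zero_apply, Finset.sum_const_zero] at this
    rw [← this]
    refine Finset.sum_congr rfl fun j _ => ?_
    rw [Matrix.mul_smul, Matrix.trace_smul, htr, one_mul, smul_eq_mul]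
end nil
end RH
end

section
open Set Filter Topology
namespace RH
section conj

theorem exists_factor {X Y Z : Type*} [AddCommGroup X] [Module ℂ X] [AddCommGroup Y] [Module ℂ Y] [AddCommGroup Z] [Module ℂ Z]
    (f : X →ₗ[ℂ] Y) (l : X →ₗ[ℂ] Z) (h : ∀ v, f v = 0 → l v = 0) : ∃ m : Y →ₗ[ℂ] Z, ∀ v, m (f v) = l v := by
  obtain ⟨m, hm⟩ := LinearMap.exists_extend (((LinearMap.ker f).liftQ l (fun v hv => h v hv)) ∘ₗ f.quotKerEquivRange.symm.toLinearMap)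
  refine ⟨m, fun v => ?_⟩
  have := LinearMap.congr_fun hm ⟨f v, ⟨v, rfl⟩⟩
  simp only [LinearMap.comp_apply, Submodule.subtype_apply, LinearEquiv.coe_coe] at this
  rw [this]
  have h2 : f.quotKerEquivRange.symm ⟨f v, ⟨v, rfl⟩⟩ = Submodule.Quotient.mk v := by
    rw [LinearEquiv.symm_apply_eq]; rfl
  rw [h2]; rfl

theorem exists_equiv_ext {K K' : Type*} [AddCommGroup K] [Module ℂ K] [AddCommGroup K'] [Module ℂ K'] [FiniteDimensional ℂ K] [FiniteDimensional ℂ K']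
    (hd : Module.finrank ℂ K = Module.finrank ℂ K') (A : Submodule ℂ K) (α : A →ₗ[ℂ] K') (hα : Function.Injective α) :
    ∃ β : K ≃ₗ[ℂ] K', ∀ a : A, β a = α a := by
  obtain ⟨C, hC⟩ := Submodule.exists_isCompl A
  obtain ⟨C', hC'⟩ := Submodule.exists_isCompl (LinearMap.range α)
  have h1 := Submodule.finrank_add_eq_of_isCompl hC
  have h2 := Submodule.finrank_add_eq_of_isCompl hC'
  have h3 := LinearMap.finrank_range_of_inj hα
  let e : C ≃ₗ[ℂ] C' := LinearEquiv.ofFinrankEq _ _ (by omega)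
  refine ⟨(Submodule.prodEquivOfIsCompl A C hC).symm ≪≫ₗ ((LinearEquiv.ofInjective α hα).prodCongr e) ≪≫ₗ Submodule.prodEquivOfIsCompl _ C' hC', fun a => ?_⟩
  simp

theorem glue {V V' : Type*} [AddCommGroup V] [Module ℂ V] [AddCommGroup V'] [Module ℂ V'] [FiniteDimensional ℂ V] [FiniteDimensional ℂ V']
    (h : V →ₗ[ℂ] V) (h' : V' →ₗ[ℂ] V') (hd : Module.finrank ℂ V = Module.finrank ℂ V')
    (θ : LinearMap.range h ≃ₗ[ℂ] LinearMap.range h') (hθ : ∀ u : LinearMap.range h, (θ ⟨h u, ⟨u, rfl⟩⟩ : V') = h' (θ u)) :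
    ∃ Θ : V ≃ₗ[ℂ] V', ∀ v, Θ (h v) = h' (Θ v) := by
  have hK : Module.finrank ℂ (LinearMap.ker h) = Module.finrank ℂ (LinearMap.ker h') := by
    have h1 := LinearMap.finrank_range_add_finrank_ker h
    have h2 := LinearMap.finrank_range_add_finrank_ker h'
    have h3 := θ.finrank_eq
    omega
  let A : Submodule ℂ (LinearMap.ker h) := (LinearMap.range h).comap (LinearMap.ker h).subtype
  let α : A →ₗ[ℂ] LinearMap.ker h' :=
    LinearMap.codRestrict _ ((LinearMap.range h').subtype ∘ₗ θ.toLinearMap ∘ₗ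
      LinearMap.codRestrict (LinearMap.range h) ((LinearMap.ker h).subtype ∘ₗ A.subtype) (fun a => a.2)) (by
      intro a
      rw [LinearMap.mem_ker]
      simp only [LinearMap.comp_apply, Submodule.subtype_apply, LinearEquiv.coe_coe]
      rw [← hθ]
      have : h (a.1 : V) = 0 := a.1.2
      have h0 : (⟨h ((LinearMap.codRestrict (LinearMap.range h) ((LinearMap.ker h).subtype ∘ₗ A.subtype) (fun a => a.2) a : LinearMap.range h) : V), ⟨_, rfl⟩⟩ : LinearMap.range h) = 0 := Subtype.ext this
      rw [h0]; simp)
  have hαv : ∀ a : A, (α a : V') = θ ⟨a.1.1, a.2⟩ := fun a => rfl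
  have hα : Function.Injective α := by
    intro a b hab
    have := congrArg (Subtype.val : LinearMap.ker h' → V') hab
    rw [hαv, hαv] at this
    have h2 := θ.injective (Subtype.ext this)
    have h3 : a.1.1 = b.1.1 := Subtype.mk_eq_mk.1 h2
    exact Subtype.ext (Subtype.ext h3)
  obtain ⟨κ, hκ⟩ := exists_equiv_ext hK A α hα
  obtain ⟨m, hm⟩ := exists_factor (X := LinearMap.range h × LinearMap.ker h) (Y := V) (Z := V')
    ((LinearMap.range h).subtype.coprod (LinearMap.ker h).subtype)
    (((LinearMap.range h').subtype ∘ₗ θ.toLinearMap).coprod ((LinearMap.ker h').subtype ∘ₗ κ.toLinearMap)) (by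
    rintro ⟨u, w⟩ huw
    simp only [LinearMap.coprod_apply, Submodule.subtype_apply, LinearMap.comp_apply, LinearEquiv.coe_coe] at huw ⊢
    have hw : (w : V) = ((-u : LinearMap.range h) : V) := by
      rw [Submodule.coe_neg]; exact eq_neg_of_add_eq_zero_right huw
    have hwA : w ∈ A := by show (w : V) ∈ LinearMap.range h; rw [hw]; exact (-u).2
    have h1 := hκ ⟨w, hwA⟩
    have h2 : (κ w : V') = θ (-u) := by
      rw [show κ w = α ⟨w, hwA⟩ from h1, hαv]
      congr 2
      exact Subtype.ext hw
    rw [h2, map_neg, Submodule.coe_neg, add_neg_cancel])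
  have hmU : ∀ u : LinearMap.range h, m u = θ u := fun u => by simpa using hm (u, 0)
  have hmK : ∀ w : LinearMap.ker h, m w = κ w := fun w => by simpa using hm (0, w)
  obtain ⟨ρ, hρ⟩ := h'.rangeRestrict.exists_rightInverse_of_surjective h'.range_rangeRestrict
  have hρ' : ∀ x : LinearMap.range h', h' (ρ x) = x := fun x => congrArg Subtype.val (LinearMap.congr_fun hρ x)
  let ε : V →ₗ[ℂ] LinearMap.range h' := θ.toLinearMap ∘ₗ h.rangeRestrict - h'.rangeRestrict ∘ₗ m
  have hε : ∀ v, (ε v : V') = θ ⟨h v, ⟨v, rfl⟩⟩ - h' (m v) := fun v => rfl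
  have hεU : ∀ u : LinearMap.range h, ε u = 0 := fun u => Subtype.ext (by rw [hε, hmU, hθ]; simp)
  have hεK : ∀ w : LinearMap.ker h, ε w = 0 := fun w => Subtype.ext (by
    have h0 : (⟨h w, ⟨_, rfl⟩⟩ : LinearMap.range h) = 0 := Subtype.ext w.2
    have h1 : h' (κ w) = 0 := (κ w).2
    rw [hε, hmK, h0, h1]; simp)
  let Θ : V →ₗ[ℂ] V' := m + ρ ∘ₗ ε
  have hΘU : ∀ u : LinearMap.range h, Θ u = θ u := fun u => by simp [Θ, hεU, hmU]
  have hΘK : ∀ w : LinearMap.ker h, Θ w = κ w := fun w => by simp [Θ, hεK, hmK]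
  have hΘ : ∀ v, Θ (h v) = h' (Θ v) := by
    intro v
    have := hΘU ⟨h v, ⟨v, rfl⟩⟩
    simp only at this
    rw [this]
    simp only [Θ, LinearMap.add_apply, LinearMap.comp_apply, map_add, hρ', hε]
    abel
  have hinj : Function.Injective Θ := by
    rw [injective_iff_map_eq_zero]
    intro v hv
    have h1 := hΘ v
    rw [hv, map_zero] at h1
    have h2 := hΘU ⟨h v, ⟨v, rfl⟩⟩
    simp only [h1] at h2
    have h3 : (⟨h v, ⟨v, rfl⟩⟩ : LinearMap.range h) = 0 := by
      apply θ.injective; rw [map_zero]; exact Subtype.ext h2.symm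
    have h4 : h v = 0 := congrArg Subtype.val h3
    have h5 := hΘK ⟨v, h4⟩
    simp only [hv] at h5
    have h6 : (⟨v, h4⟩ : LinearMap.ker h) = 0 := by
      apply κ.injective; rw [map_zero]; exact Subtype.ext h5.symm
    exact congrArg Subtype.val h6
  exact ⟨LinearEquiv.ofInjectiveOfFinrankEq Θ hinj hd, fun v => hΘ v⟩

/-- iterated product of `f - s` -/
def PL {R : Type*} [Ring R] [Algebra ℂ R] (f : R) : List ℂ → R
  | [] => 1
  | s :: L => PL f L * (f - algebraMap ℂ R s)

theorem PL_res {V : Type*} [AddCommGroup V] [Module ℂ V] (f : Module.End ℂ V) (U : Submodule ℂ V) (g : Module.End ℂ U)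
    (hg : ∀ u : U, (g u : V) = f u) (L : List ℂ) : ∀ u : U, (PL g L u : V) = PL f L u := by
  induction L with
  | nil => intro u; rfl
  | cons s L ih =>
    intro u
    simp only [PL, Module.End.mul_apply]
    rw [ih]
    congr 1
    simp [hg, Module.algebraMap_end_apply]

theorem conj_end (L : List ℂ) : ∀ (V V' : Type) [AddCommGroup V] [Module ℂ V] [AddCommGroup V'] [Module ℂ V'] [FiniteDimensional ℂ V] [FiniteDimensional ℂ V']
    (f : Module.End ℂ V) (f' : Module.End ℂ V')
    (_ : ∀ m, Module.finrank ℂ (LinearMap.range (PL f (L.take m))) = Module.finrank ℂ (LinearMap.range (PL f' (L.take m)))) (_ : PL f L = 0),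
    ∃ Θ : V ≃ₗ[ℂ] V', ∀ v, Θ (f v) = f' (Θ v) := by
  induction L with
  | nil =>
    intro V V' _ _ _ _ _ _ f f' h1 h2
    have h3 : (1 : Module.End ℂ V) = 0 := h2
    have hd : Module.finrank ℂ V = Module.finrank ℂ V' := by
      have := h1 0
      change Module.finrank ℂ (LinearMap.range (LinearMap.id : V →ₗ[ℂ] V)) = Module.finrank ℂ (LinearMap.range (LinearMap.id : V' →ₗ[ℂ] V')) at this
      rwa [LinearMap.range_id, LinearMap.range_id, _root_.finrank_top, _root_.finrank_top] at this
    have h4 : ∀ v : V, v = 0 := fun v => LinearMap.congr_fun h3 v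
    have : Subsingleton V := ⟨fun a b => by rw [h4 a, h4 b]⟩
    have h5 : Module.finrank ℂ V' = 0 := by rw [← hd]; exact Module.finrank_zero_of_subsingleton
    have : Subsingleton V' := Module.finrank_zero_iff.1 h5
    exact ⟨LinearEquiv.ofFinrankEq _ _ hd, fun v => Subsingleton.elim _ _⟩
  | cons s L ih =>
    intro V V' _ _ _ _ _ _ f f' h1 h2
    have hd : Module.finrank ℂ V = Module.finrank ℂ V' := by
      have := h1 0
      change Module.finrank ℂ (LinearMap.range (LinearMap.id : V →ₗ[ℂ] V)) = Module.finrank ℂ (LinearMap.range (LinearMap.id : V' →ₗ[ℂ] V')) at this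
      rwa [LinearMap.range_id, LinearMap.range_id, _root_.finrank_top, _root_.finrank_top] at this
    have key : ∀ (W : Type) [AddCommGroup W] [Module ℂ W] [FiniteDimensional ℂ W] (φ : Module.End ℂ W), 
        ∃ g : Module.End ℂ (LinearMap.range (φ - algebraMap ℂ (Module.End ℂ W) s)), (∀ u, (g u : W) = φ u) ∧
          ∀ T, Module.finrank ℂ (LinearMap.range (PL φ (s :: T))) = Module.finrank ℂ (LinearMap.range (PL g T)) := by
      intro W _ _ _ φ
      have hmap : ∀ u ∈ LinearMap.range (φ - algebraMap ℂ (Module.End ℂ W) s), φ u ∈ LinearMap.range (φ - algebraMap ℂ (Module.End ℂ W) s) := by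
        rintro _ ⟨w, rfl⟩
        refine ⟨φ w, ?_⟩
        simp [Module.algebraMap_end_apply]
      refine ⟨φ.restrict hmap, fun u => rfl, fun T => ?_⟩
      set g := φ.restrict hmap
      have hg := PL_res φ _ g (fun u => rfl) T
      have : LinearMap.range (PL φ (s :: T)) = (LinearMap.range (PL g T)).map (Submodule.subtype _) := by
        ext x
        constructor
        · rintro ⟨w, rfl⟩
          exact ⟨_, ⟨⟨_, ⟨w, rfl⟩⟩, rfl⟩, hg _⟩
        · rintro ⟨_, ⟨⟨_, ⟨w, rfl⟩⟩, rfl⟩, rfl⟩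
          exact ⟨w, (hg ⟨_, ⟨w, rfl⟩⟩).symm⟩
      rw [this]
      exact Submodule.finrank_map_subtype_eq _ _
    obtain ⟨g, hg, hgr⟩ := key V f
    obtain ⟨g', hg', hgr'⟩ := key V' f'
    obtain ⟨θ, hθ⟩ := ih _ _ g g' (fun m => by rw [← hgr, ← hgr']; exact h1 (m + 1)) (by
      ext ⟨_, ⟨w, rfl⟩⟩
      rw [PL_res f _ g hg]
      exact LinearMap.congr_fun h2 w)
    obtain ⟨Θ, hΘ⟩ := glue (f - algebraMap ℂ (Module.End ℂ V) s) (f' - algebraMap ℂ (Module.End ℂ V') s) hd θ (by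
      intro u
      have h3 : (⟨(f - algebraMap ℂ (Module.End ℂ V) s) u, ⟨u, rfl⟩⟩ : LinearMap.range (f - algebraMap ℂ (Module.End ℂ V) s)) = g u - s • u := by
        apply Subtype.ext; simp [hg, Module.algebraMap_end_apply]
      rw [h3, map_sub, hθ, map_smul]
      simp [hg', Module.algebraMap_end_apply])
    refine ⟨Θ, fun v => ?_⟩
    have := hΘ v
    simp only [LinearMap.sub_apply, Module.algebraMap_end_apply, map_sub, map_smul] at this
    exact sub_left_injective this
end conj
end RH
end

section
open Set Filter Topology
namespace RH
section flag
variable {n : ℕ}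

theorem PL_map {R R' : Type*} [Ring R] [Algebra ℂ R] [Ring R'] [Algebra ℂ R'] (F : R →ₐ[ℂ] R') (f : R) (L : List ℂ) : F (PL f L) = PL (F f) L := by
  induction L with
  | nil => simp [PL]
  | cons s L ih => simp [PL, ih]

theorem PL_append {R : Type*} [Ring R] [Algebra ℂ R] (f : R) (L : List ℂ) (s : ℂ) : PL f (L ++ [s]) = (f - algebraMap ℂ R s) * PL f L := by
  induction L with
  | nil => simp [PL]
  | cons t L ih => rw [List.cons_append, PL, ih, PL, mul_assoc]

theorem PL_aeval {R : Type*} [Ring R] [Algebra ℂ R] (f : R) (L : List ℂ) :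
    PL f L = Polynomial.aeval f ((L.map fun s => Polynomial.X - Polynomial.C s).prod) := by
  induction L with
  | nil => simp [PL]
  | cons t L ih => rw [PL, ih, List.map_cons, List.prod_cons, mul_comm, map_mul]; simp

theorem PL_comm {R : Type*} [Ring R] [Algebra ℂ R] (f : R) (L : List ℂ) (s : ℂ) : (f - algebraMap ℂ R s) * PL f L = PL f L * (f - algebraMap ℂ R s) := by
  have h : f - algebraMap ℂ R s = Polynomial.aeval f (Polynomial.X - Polynomial.C s) := by simp
  rw [PL_aeval, h, ← map_mul, mul_comm, map_mul]

theorem PL_take {R : Type*} [Ring R] [Algebra ℂ R] (f : R) (L : List ℂ) (m : ℕ) (hm : m < L.length) :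
    PL f (L.take (m + 1)) = (f - algebraMap ℂ R (L.getD m 0)) * PL f (L.take m) := by
  rw [← PL_append, List.getD_eq_getElem _ _ hm, List.take_append_getElem]

theorem PL_take' {R : Type*} [Ring R] [Algebra ℂ R] (f : R) (L : List ℂ) (m : ℕ) (hm : L.length ≤ m) :
    PL f (L.take m) = PL f L := by
  rw [List.take_of_length_le hm]

theorem adapted {V : Type*} [AddCommGroup V] [Module ℂ V] (W : ℕ → Submodule ℂ V) (N : ℕ) (ha : Antitone W) (hN : W N = ⊥) (i : ℕ) (hi : i ≤ N) :
    ∃ B : Set V, LinearIndepOn ℂ id B ∧ B ⊆ W (N - i) ∧ ∀ m, N - i ≤ m → Submodule.span ℂ (B ∩ W m) = W m := by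
  induction i with
  | zero =>
    refine ⟨∅, by simp, by simp, fun m hm => ?_⟩
    have : W m = ⊥ := by rw [eq_bot_iff, ← hN]; exact ha (by omega)
    simp [this]
  | succ i ih =>
    obtain ⟨B, h1, h2, h3⟩ := ih (by omega)
    obtain ⟨B', h4, h5, h6, h7⟩ := exists_linearIndepOn_extension h1 (h2.trans (ha (by omega : N - (i + 1) ≤ N - i)))
    simp only [image_id] at h6
    refine ⟨B', h7, h4, fun m hm => ?_⟩
    apply le_antisymm
    · rw [Submodule.span_le]; exact inter_subset_right
    · rcases hm.lt_or_eq with hlt | heq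
      · exact (h3 m (by omega)).ge.trans (Submodule.span_mono (inter_subset_inter_left _ h5))
      · rw [← heq, inter_eq_left.2 h4]
        exact h6

theorem adapted_basis (W : ℕ → Submodule ℂ (Fin n → ℂ)) (N : ℕ) (ha : Antitone W) (h0 : W 0 = ⊤) (hN : W N = ⊥) :
    ∃ (b : Module.Basis (Fin n) ℂ (Fin n → ℂ)) (τ : Fin n → ℕ), (∀ a, τ a < N) ∧ (∀ a m, m ≤ τ a ↔ b a ∈ W m) ∧
      ∀ m, W m = Submodule.span ℂ (range fun a : {a // m ≤ τ a} => b a) := by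
  obtain ⟨B, h1, -, h3⟩ := adapted W N ha hN N le_rfl
  have hli : LinearIndependent ℂ (fun x : B => (x : Fin n → ℂ)) := h1
  have hsp : ⊤ ≤ Submodule.span ℂ (range (fun x : B => (x : Fin n → ℂ))) := by
    have := h3 0 (by omega)
    rw [h0] at this
    rw [Subtype.range_coe, ← this]
    exact Submodule.span_mono inter_subset_left
  let b0 := Module.Basis.mk hli hsp
  let e := b0.indexEquiv (Pi.basisFun ℂ (Fin n))
  let b := b0.reindex e
  have hb : ∀ x : B, b (e x) = x := by intro x; simp [b, b0]
  have hbB : ∀ a, b a ∈ B := by intro a; rw [← e.apply_symm_apply a, hb]; exact (e.symm a).2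
  classical
  let τ : Fin n → ℕ := fun a => Nat.findGreatest (fun m => b a ∈ W m) N
  have hτ : ∀ a m, m ≤ τ a ↔ b a ∈ W m := by
    intro a m
    constructor
    · intro h
      have : b a ∈ W (τ a) := Nat.findGreatest_spec (P := fun m => b a ∈ W m) (Nat.zero_le N) (by show b a ∈ W 0; rw [h0]; trivial)
      exact ha h this
    · intro h
      by_cases hm : m ≤ N
      · exact Nat.le_findGreatest hm h
      · exfalso
        have h2 := ha (by omega : N ≤ m) h
        rw [hN, Submodule.mem_bot] at h2
        exact b.ne_zero a h2
  refine ⟨b, τ, ?_, hτ, ?_⟩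
  · intro a
    by_contra hcon
    have := (hτ a N).1 (by omega)
    rw [hN, Submodule.mem_bot] at this
    exact b.ne_zero a this
  · intro m
    apply le_antisymm
    · conv_lhs => rw [← h3 m (by omega)]
      refine Submodule.span_mono ?_
      rintro x ⟨hx1, hx2⟩
      exact ⟨⟨e ⟨x, hx1⟩, (hτ _ _).2 (by rw [hb]; exact hx2)⟩, hb _⟩
    · rw [Submodule.span_le]
      rintro _ ⟨⟨a, ha'⟩, rfl⟩
      exact (hτ a m).1 ha'

def Tri (τ : Fin n → ℕ) (σ : Fin n → ℂ) (N : Matrix (Fin n) (Fin n) ℂ) : Prop :=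
  ∀ a b, ¬ τ b < τ a → N a b = if a = b then σ a else 0

theorem tri_rank (τ : Fin n → ℕ) (L : List ℂ) (hτ : ∀ a, τ a < L.length) (N : Matrix (Fin n) (Fin n) ℂ)
    (hN : Tri τ (fun a => L.getD (τ a) 0) N) (m : ℕ) : (PL N (L.take m)).rank ≤ (Finset.univ.filter fun a => m ≤ τ a).card := by
  have key : ∀ m a b, ¬ m ≤ τ a → PL N (L.take m) a b = 0 := by
    intro m
    induction m with
    | zero => intro a b h; omega
    | succ m ih =>
      intro a b h
      by_cases hm : m < L.length
      · rw [PL_take _ _ _ hm, Matrix.mul_apply]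
        refine Finset.sum_eq_zero fun c _ => ?_
        by_cases hc : m ≤ τ c
        · rw [Matrix.sub_apply, hN a c (by omega), Matrix.algebraMap_matrix_apply]
          by_cases hac : a = c
          · subst hac
            have : τ a = m := by omega
            simp [this]
          · simp [hac]
        · rw [ih c b hc, mul_zero]
      · rw [PL_take' _ _ _ (by omega), ← PL_take' N L m (by omega)]
        exact ih a b (by have := hτ a; omega)
  have h1 : PL N (L.take m) = Matrix.diagonal (fun a => if m ≤ τ a then 1 else 0) * PL N (L.take m) := by
    ext a b
    rw [Matrix.diagonal_mul]
    by_cases h : m ≤ τ a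
    · simp [h]
    · simp [h, key m a b h]
  rw [h1]
  refine (Matrix.rank_mul_le_left _ _).trans ?_
  rw [Matrix.rank_diagonal]
  rw [Fintype.card_subtype]
  refine Finset.card_le_card ?_
  intro a
  simp

theorem charpoly_tri (τ : Fin n → ℕ) (σ : Fin n → ℂ) (hσ : ∀ a b, τ a = τ b → σ a = σ b) (N : Matrix (Fin n) (Fin n) ℂ) (hN : Tri τ σ N) :
    N.charpoly.roots = Finset.univ.val.map σ := by
  have hb : N.BlockTriangular (fun a => OrderDual.toDual (τ a)) := by
    intro a b hab
    have : τ a < τ b := hab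
    rw [hN a b (by omega), if_neg]
    rintro rfl; omega
  have h1 : N.charpoly = ∏ a, (Polynomial.X - Polynomial.C (σ a)) := by
    rw [hb.charpoly]
    have h2 : ∀ i, (N.toSquareBlock (fun a => OrderDual.toDual (τ a)) i).charpoly = ∏ a ∈ Finset.univ.filter (fun a => OrderDual.toDual (τ a) = i), (Polynomial.X - Polynomial.C (σ a)) := by
      intro i
      have h3 : N.toSquareBlock (fun a => OrderDual.toDual (τ a)) i = Matrix.diagonal (fun a => σ a.1) := by
        ext ⟨a, ha⟩ ⟨b, hb⟩
        have hab : τ a = τ b := by have := ha.trans hb.symm; exact this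
        rw [Matrix.toSquareBlock_def, Matrix.of_apply, hN a b (by omega), Matrix.diagonal_apply]
        simp
      rw [h3, Matrix.charpoly_diagonal]
      rw [Finset.prod_subtype (Finset.univ.filter (fun a => OrderDual.toDual (τ a) = i)) (p := fun a => OrderDual.toDual (τ a) = i) (by simp)]
    simp only [h2]
    exact Finset.prod_fiberwise_of_maps_to (fun a _ => Finset.mem_image_of_mem _ (Finset.mem_univ a)) _
  rw [h1, Polynomial.roots_prod _ _ (Finset.prod_ne_zero_iff.2 fun a _ => Polynomial.X_sub_C_ne_zero _)]
  simp [Multiset.bind_singleton]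

end flag
end RH
end

section
open Set Filter Topology
namespace RH
section flag
variable {n : ℕ}

theorem conj_of_rank (L : List ℂ) (Y N : Matrix (Fin n) (Fin n) ℂ) (h : ∀ m, (PL N (L.take m)).rank = (PL Y (L.take m)).rank) (h0 : PL Y L = 0) :
    ∃ u : (Matrix (Fin n) (Fin n) ℂ)ˣ, N = u.val * Y * (u⁻¹).val := by
  let F := (Matrix.toLinAlgEquiv' (R := ℂ) (n := Fin n))
  have hF : ∀ M L, PL (F M) L = F (PL M L) := fun M L => (PL_map F.toAlgHom M L).symm
  obtain ⟨Θ, hΘ⟩ := conj_end L (Fin n → ℂ) (Fin n → ℂ) (F Y) (F N) (by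
    intro m
    rw [hF, hF]
    exact (h m).symm) (by rw [hF, h0, map_zero])
  let P : Matrix (Fin n) (Fin n) ℂ := F.symm Θ.toLinearMap
  let Q : Matrix (Fin n) (Fin n) ℂ := F.symm Θ.symm.toLinearMap
  have hP : F P = Θ.toLinearMap := F.apply_symm_apply _
  have hQ : F Q = Θ.symm.toLinearMap := F.apply_symm_apply _
  have h1 : P * Q = 1 := by
    apply F.injective
    rw [map_mul, hP, hQ, map_one]; ext v; simp
  have h2 : Q * P = 1 := by
    apply F.injective
    rw [map_mul, hP, hQ, map_one]; ext v; simp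
  refine ⟨⟨P, Q, h1, h2⟩, ?_⟩
  have h3 : P * Y = N * P := by
    apply F.injective
    rw [map_mul, map_mul, hP]
    apply LinearMap.ext
    intro v
    exact hΘ v
  show N = P * Y * Q
  rw [h3, mul_assoc, h1, mul_one]

theorem rank_generic (L : List ℂ) (N Y : Matrix (Fin n) (Fin n) ℂ) :
    ∀ᶠ t in 𝓝[≠] (0:ℂ), (PL Y L).rank ≤ (PL (N + t • (Y - N)) L).rank := by
  set R := (PL Y L).rank with hR
  obtain ⟨A, B, hAB⟩ : ∃ (A : Matrix (Fin R) (Fin n) ℂ) (B : Matrix (Fin n) (Fin R) ℂ), A * PL Y L * B = 1 := by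
    let f := Matrix.toLin' (PL Y L)
    have hfr : Module.finrank ℂ (LinearMap.range f) = R := rfl
    let e : (Fin R → ℂ) ≃ₗ[ℂ] LinearMap.range f := LinearEquiv.ofFinrankEq _ _ (by simp [hfr])
    obtain ⟨ρ, hρ⟩ := f.rangeRestrict.exists_rightInverse_of_surjective f.range_rangeRestrict
    obtain ⟨π, hπ⟩ := LinearMap.exists_extend (e.symm.toLinearMap : LinearMap.range f →ₗ[ℂ] (Fin R → ℂ))
    refine ⟨LinearMap.toMatrix' π, LinearMap.toMatrix' (ρ ∘ₗ e.toLinearMap), ?_⟩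
    have h1 : PL Y L = LinearMap.toMatrix' f := by simp [f]
    rw [h1, ← LinearMap.toMatrix'_comp, ← LinearMap.toMatrix'_comp, ← LinearMap.toMatrix'_id]
    congr 1
    apply LinearMap.ext
    intro v
    have h2 : f (ρ (e v)) = e v := congrArg Subtype.val (LinearMap.congr_fun hρ (e v))
    have h3 := LinearMap.congr_fun hπ (e v)
    simp only [LinearMap.comp_apply, Submodule.subtype_apply, LinearEquiv.coe_coe, LinearEquiv.symm_apply_apply] at h3
    simp only [LinearMap.comp_apply, LinearEquiv.coe_coe, LinearMap.id_apply]
    rw [h2, h3]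
  have hPL : ∀ L : List ℂ, ∀ a b, Differentiable ℂ fun t : ℂ => PL (N + t • (Y - N)) L a b := by
    intro L
    induction L with
    | nil => intro a b; exact differentiable_const _
    | cons s L ih =>
      intro a b
      simp only [PL, Matrix.mul_apply, Matrix.sub_apply, Matrix.add_apply, Matrix.smul_apply, smul_eq_mul]
      have := ih
      fun_prop
  let d : ℂ → ℂ := fun t => (A * PL (N + t • (Y - N)) L * B).det
  have hd : Differentiable ℂ d := by
    have := hPL L
    simp only [d, Matrix.det_apply, Matrix.mul_apply]
    fun_prop
  have hd1 : d 1 = 1 := by simp [d, hAB]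
  have hev : ∀ᶠ t in 𝓝[≠] (0:ℂ), d t ≠ 0 := by
    by_contra hcon
    have hfr : ∃ᶠ t in 𝓝[≠] (0:ℂ), d t = 0 := by
      rw [Filter.not_eventually] at hcon
      simpa using hcon
    have han : AnalyticOnNhd ℂ d univ := fun t _ => hd.analyticAt t
    have := han.eqOn_zero_of_preconnected_of_frequently_eq_zero isPreconnected_univ (mem_univ 0) hfr (mem_univ 1)
    rw [hd1] at this
    exact one_ne_zero this
  filter_upwards [hev] with t ht
  have h1 : (A * PL (N + t • (Y - N)) L * B).rank = R := by
    rw [Matrix.rank_of_isUnit _ ((Matrix.isUnit_iff_isUnit_det _).2 (isUnit_iff_ne_zero.2 ht))]; simp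
  rw [← h1]
  exact (Matrix.rank_mul_le_left _ _).trans (Matrix.rank_mul_le_right _ _)

theorem flag (Y : Matrix (Fin n) (Fin n) ℂ) (r : ℕ) (hr : ∀ c : ℂ, r ≤ (Y - algebraMap ℂ _ c).rank) :
    ∃ (τ : Fin n → ℕ) (σ : Fin n → ℂ) (Y0 : Matrix (Fin n) (Fin n) ℂ), (∀ a b, τ a = τ b → σ a = σ b) ∧ Tri τ σ Y0 ∧
      (∀ i, (Finset.univ.filter fun a => τ a = i).card + r ≤ n) ∧ (∃ u : (Matrix (Fin n) (Fin n) ℂ)ˣ, Y0 = u.val * Y * (u⁻¹).val) ∧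
      ∀ N, Tri τ σ N → ∀ᶠ t in 𝓝[≠] (0:ℂ), ∃ u : (Matrix (Fin n) (Fin n) ℂ)ˣ, N + t • (Y0 - N) = u.val * Y * (u⁻¹).val := by
  let L := Y.charpoly.roots.toList
  have hPL0 : PL Y L = 0 := by
    rw [PL_aeval]
    have h1 : ((L.map fun s => Polynomial.X - Polynomial.C s).prod) = Y.charpoly := by
      have h2 := (IsAlgClosed.splits Y.charpoly).eq_prod_roots_of_monic Y.charpoly_monic
      conv_rhs => rw [h2]
      rw [← Multiset.prod_coe, ← Multiset.map_coe, Multiset.coe_toList]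
    rw [h1, Matrix.aeval_self_charpoly]
  let F := (Matrix.toLinAlgEquiv' (R := ℂ) (n := Fin n))
  have hF : ∀ M L, PL (F M) L = F (PL M L) := fun M L => (PL_map F.toAlgHom M L).symm
  let f := F Y
  let W : ℕ → Submodule ℂ (Fin n → ℂ) := fun m => LinearMap.range (PL f (L.take m))
  have hWr : ∀ m, Module.finrank ℂ (W m) = (PL Y (L.take m)).rank := by
    intro m
    show Module.finrank ℂ (LinearMap.range (PL (F Y) (L.take m))) = _
    rw [hF]; rfl
  have hWlen : ∀ m, L.length ≤ m → W m = ⊥ := by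
    intro m hm
    simp only [W]
    rw [PL_take' _ _ _ hm, show PL f L = 0 by rw [show f = F Y from rfl, hF, hPL0, map_zero], LinearMap.range_zero]
  have hWs : ∀ m, m < L.length → W (m + 1) = (W m).map (f - algebraMap ℂ _ (L.getD m 0)) := by
    intro m hm
    simp only [W]
    rw [PL_take _ _ _ hm, Module.End.mul_eq_comp, LinearMap.range_comp]
  have hanti : Antitone W := by
    refine antitone_nat_of_succ_le fun m => ?_
    by_cases hm : m < L.length
    · simp only [W]
      rw [PL_take _ _ _ hm, PL_comm, Module.End.mul_eq_comp]
      exact LinearMap.range_comp_le_range _ _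
    · rw [hWlen (m + 1) (by omega)]; exact bot_le
  obtain ⟨b, τ, hτN, hτ, hspan⟩ := adapted_basis W L.length hanti (by
    show LinearMap.range (LinearMap.id : (Fin n → ℂ) →ₗ[ℂ] _) = ⊤
    exact LinearMap.range_id) (hWlen _ le_rfl)
  let σ : Fin n → ℂ := fun a => L.getD (τ a) 0
  have hcard : ∀ m, (Finset.univ.filter fun a => m ≤ τ a).card = Module.finrank ℂ (W m) := by
    intro m
    have h := finrank_span_eq_card (b.linearIndependent.comp (Subtype.val : {a // m ≤ τ a} → Fin n) Subtype.val_injective)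
    rw [hspan m]
    exact (Fintype.card_subtype _).symm.trans h.symm
  have hrepr : ∀ m w a, w ∈ W m → ¬ m ≤ τ a → b.repr w a = 0 := by
    intro m w a hw hma
    have : W m ≤ LinearMap.ker (b.coord a) := by
      rw [hspan m, Submodule.span_le]
      rintro _ ⟨⟨c, hc⟩, rfl⟩
      show b.coord a (b c) = 0
      rw [Module.Basis.coord_apply, Module.Basis.repr_self, Finsupp.single_apply, if_neg]
      rintro rfl; exact hma hc
    exact this hw
  let Y0 := LinearMap.toMatrix b b f
  have hY0 : Tri τ σ Y0 := by
    intro a c hac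
    have h1 : f (b c) = σ c • b c + (f - algebraMap ℂ _ (σ c)) (b c) := by simp [Module.algebraMap_end_apply]
    have h2 : (f - algebraMap ℂ _ (σ c)) (b c) ∈ W (τ c + 1) := by
      rw [hWs _ (hτN c)]
      exact Submodule.mem_map_of_mem ((hτ c _).1 le_rfl)
    show LinearMap.toMatrix b b f a c = _
    rw [LinearMap.toMatrix_apply, h1, map_add, Finsupp.add_apply, hrepr _ _ a h2 (by omega), add_zero, map_smul, Finsupp.smul_apply,
      Module.Basis.repr_self, Finsupp.single_apply]
    by_cases h : a = c
    · subst h; simp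
    · simp [h, Ne.symm h]
  have hconj : ∃ u : (Matrix (Fin n) (Fin n) ℂ)ˣ, Y0 = u.val * Y * (u⁻¹).val := by
    let e := Pi.basisFun ℂ (Fin n)
    refine ⟨⟨b.toMatrix e, e.toMatrix b, Module.Basis.toMatrix_mul_toMatrix_flip _ _, Module.Basis.toMatrix_mul_toMatrix_flip _ _⟩, ?_⟩
    show Y0 = b.toMatrix e * Y * e.toMatrix b
    have hY : Y = LinearMap.toMatrix e e f := by
      rw [LinearMap.toMatrix_eq_toMatrix']
      exact (LinearMap.toMatrix'_toLin' Y).symm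
    conv_rhs => rw [hY]
    rw [basis_toMatrix_mul_linearMap_toMatrix_mul_basis_toMatrix]
  have hrk : ∀ m, (PL Y0 (L.take m)).rank = (PL Y (L.take m)).rank := by
    obtain ⟨u, hu⟩ := hconj
    intro m
    let G := LinearMap.toMatrixAlgEquiv b
    have h1 : PL Y0 (L.take m) = LinearMap.toMatrix b b (PL f (L.take m)) := (PL_map G.toAlgHom f (L.take m)).symm
    rw [← hWr, Matrix.rank_eq_finrank_range_toLin _ b b, h1, Matrix.toLin_toMatrix]
  refine ⟨τ, σ, Y0, fun a c h => by simp only [σ, h], hY0, ?_, hconj, ?_⟩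
  · intro i
    by_cases hi : i < L.length
    · have h1 : Module.finrank ℂ (W i) ≤ Module.finrank ℂ (W (i + 1)) + Module.finrank ℂ (LinearMap.ker (f - algebraMap ℂ (Module.End ℂ (Fin n → ℂ)) (L.getD i 0))) := by
        rw [hWs i hi]
        have h2 := LinearMap.finrank_range_add_finrank_ker ((f - algebraMap ℂ (Module.End ℂ (Fin n → ℂ)) (L.getD i 0)).domRestrict (W i))
        rw [LinearMap.range_domRestrict] at h2
        rw [← h2]
        gcongr
        refine LinearMap.finrank_le_finrank_of_injective (f := LinearMap.codRestrict _ ((W i).subtype ∘ₗ (LinearMap.ker ((f - algebraMap ℂ (Module.End ℂ (Fin n → ℂ)) (L.getD i 0)).domRestrict (W i))).subtype) (fun x => x.2)) ?_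
        intro x y hxy
        exact Subtype.ext (Subtype.ext (congrArg Subtype.val hxy :))
      have h3 := LinearMap.finrank_range_add_finrank_ker (f - algebraMap ℂ (Module.End ℂ (Fin n → ℂ)) (L.getD i 0))
      have h4 : Module.finrank ℂ (LinearMap.range (f - algebraMap ℂ (Module.End ℂ (Fin n → ℂ)) (L.getD i 0))) = (Y - algebraMap ℂ _ (L.getD i 0)).rank := by
        rw [show f - algebraMap ℂ (Module.End ℂ (Fin n → ℂ)) (L.getD i 0) = F (Y - algebraMap ℂ _ (L.getD i 0)) by rw [map_sub, AlgEquiv.commutes]]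
        rfl
      have h5 := hr (L.getD i 0)
      simp only [Module.finrank_fin_fun] at h3
      have h6 : (Finset.univ.filter fun a => i ≤ τ a).card = (Finset.univ.filter fun a => i + 1 ≤ τ a).card + (Finset.univ.filter fun a => τ a = i).card := by
        rw [← Finset.card_union_of_disjoint]
        · congr 1; ext a; simp; omega
        · rw [Finset.disjoint_filter]; intro a _ h; omega
      rw [hcard, hcard] at h6
      omega
    · have : (Finset.univ.filter fun a => τ a = i) = ∅ := by
        rw [Finset.filter_eq_empty_iff]; intro a _ h; have := hτN a; omega
      rw [this, Finset.card_empty, zero_add]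
      exact (hr 0).trans ((Matrix.rank_le_card_width _).trans (by simp))
  · intro N hN
    have h1 : ∀ᶠ t in 𝓝[≠] (0:ℂ), ∀ m ∈ Finset.range (L.length + 1), (PL Y0 (L.take m)).rank ≤ (PL (N + t • (Y0 - N)) (L.take m)).rank := by
      rw [Filter.eventually_all_finset]
      exact fun m _ => rank_generic (L.take m) N Y0
    filter_upwards [h1] with t ht
    have hT : Tri τ σ (N + t • (Y0 - N)) := by
      intro a c hac
      simp [hN a c hac, hY0 a c hac]
    refine conj_of_rank L Y _ (fun m => ?_) hPL0
    have hle : ∀ m, (PL (N + t • (Y0 - N)) (L.take m)).rank ≤ (PL Y (L.take m)).rank := by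
      intro m
      rw [← hWr, ← hcard]
      exact tri_rank τ L hτN _ hT m
    refine le_antisymm (hle m) ?_
    rw [← hrk]
    by_cases hm : m ≤ L.length
    · exact ht m (Finset.mem_range.2 (by omega))
    · have := ht L.length (Finset.mem_range.2 (by omega))
      rw [List.take_of_length_le (by omega)]
      rwa [List.take_of_length_le le_rfl] at this
end flag
end RH
end

section
open Set Filter Topology
namespace RH
section glue
variable {n : ℕ}

/-- Strictly triangular perturbations of a diagonal matrix are non-resonant. -/
theorem nonres_aux (τ : Fin n → ℕ) (ξ : Fin n → ℂ) (B : Matrix (Fin n) (Fin n) ℂ) (hB : Tri τ ξ B)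
    (m : ℂ) (hm : ∀ a b, ξ a - ξ b ≠ m) (X : Matrix (Fin n) (Fin n) ℂ) (hX : B * X - X * B = m • X) : X = 0 := by
  have key : ∀ N a b, τ a + (Finset.univ.sup τ - τ b) < N → X a b = 0 := by
    intro N
    induction N with
    | zero => intro a b h; omega
    | succ N ih =>
      intro a b hab
      have hb : τ b ≤ Finset.univ.sup τ := Finset.le_sup (f := τ) (Finset.mem_univ b)
      have h1 : (B * X) a b = ξ a * X a b := by
        rw [Matrix.mul_apply, Finset.sum_eq_single a]
        · rw [hB a a (lt_irrefl _), if_pos rfl]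
        · intro c _ hc
          by_cases h : τ c < τ a
          · rw [ih c b (by omega), mul_zero]
          · rw [hB a c h, if_neg (Ne.symm hc), zero_mul]
        · simp
      have h2 : (X * B) a b = ξ b * X a b := by
        rw [Matrix.mul_apply, Finset.sum_eq_single b]
        · rw [hB b b (lt_irrefl _), if_pos rfl, mul_comm]
        · intro c _ hc
          have hc' : τ c ≤ Finset.univ.sup τ := Finset.le_sup (f := τ) (Finset.mem_univ c)
          by_cases h : τ b < τ c
          · rw [ih a c (by omega), zero_mul]
          · rw [hB c b h, if_neg hc, mul_zero]
        · simp
      have h3 := congrFun (congrFun hX a) b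
      rw [Matrix.sub_apply, h1, h2, Matrix.smul_apply, smul_eq_mul, ← sub_mul, ← sub_eq_zero, ← sub_mul] at h3
      exact (mul_eq_zero.1 h3).resolve_left (sub_ne_zero.2 (hm a b))
  ext a b
  exact key _ a b (Nat.lt_succ_self _)

theorem nonres (τ : Fin n → ℕ) (ξ : Fin n → ℂ) (B : Matrix (Fin n) (Fin n) ℂ) (hB : Tri τ ξ B)
    (m : ℂ) (hm : ∀ a b, ξ a - ξ b ≠ m) (g : (Matrix (Fin n) (Fin n) ℂ)ˣ) (A : Matrix (Fin n) (Fin n) ℂ)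
    (hA : A = g.val * B * (g⁻¹).val) (X : Matrix (Fin n) (Fin n) ℂ) (hX : A * X - X * A = m • X) : X = 0 := by
  have h := nonres_aux τ ξ B hB m hm ((g⁻¹).val * X * g.val) (by
    have e1 : B * ((g⁻¹).val * X * g.val) - (g⁻¹).val * X * g.val * B = (g⁻¹).val * (A * X - X * A) * g.val := by
      have h1 : (g⁻¹).val * g.val = 1 := by simp
      rw [hA]
      calc _ = ((g⁻¹).val * g.val) * B * (g⁻¹).val * X * g.val - (g⁻¹).val * X * g.val * B * ((g⁻¹).val * g.val) := by
            rw [h1]; noncomm_ring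
        _ = _ := by noncomm_ring
    rw [e1, hX]; simp)
  have h1 : g.val * (g⁻¹).val = 1 := by simp
  calc X = (g.val * (g⁻¹).val) * X * (g.val * (g⁻¹).val) := by rw [h1]; simp
    _ = g.val * ((g⁻¹).val * X * g.val) * (g⁻¹).val := by noncomm_ring
    _ = 0 := by rw [h]; simp

theorem tri_pow (τ : Fin n → ℕ) (ξ : Fin n → ℂ) (B : Matrix (Fin n) (Fin n) ℂ) (hB : Tri τ ξ B) (m : ℕ) :
    Tri τ (fun a => ξ a ^ m) (B ^ m) := by
  induction m with
  | zero => intro a b _; simp [Matrix.one_apply]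
  | succ m ih =>
    intro a b hab
    rw [pow_succ, Matrix.mul_apply, Finset.sum_eq_single b]
    · rw [ih a b hab, hB b b (lt_irrefl _), if_pos rfl]
      by_cases h : a = b
      · subst h; simp [pow_succ]
      · simp [h]
    · intro c _ hc
      by_cases h : τ b < τ c
      · rw [ih a c (by omega), if_neg (by rintro rfl; exact hab h), zero_mul]
      · rw [hB c b h, if_neg hc, mul_zero]
    · simp

open scoped Matrix.Norms.Operator in
theorem tri_exp (τ : Fin n → ℕ) (ξ : Fin n → ℂ) (B : Matrix (Fin n) (Fin n) ℂ) (hB : Tri τ ξ B) :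
    Tri τ (fun a => Complex.exp (ξ a)) (NormedSpace.exp B) := by
  intro a b hab
  have h1 := NormedSpace.exp_series_hasSum_exp' (𝕂 := ℂ) B
  have h2 : HasSum (fun m : ℕ => ((m.factorial : ℂ)⁻¹ • B ^ m) a b) (NormedSpace.exp B a b) :=
    (Pi.hasSum.1 ((Pi.hasSum.1 h1) a)) b
  have h3 : HasSum (fun m : ℕ => if a = b then (m.factorial : ℂ)⁻¹ • ξ a ^ m else 0) (if a = b then Complex.exp (ξ a) else 0) := by
    by_cases h : a = b
    · simp only [if_pos h]
      rw [Complex.exp_eq_exp_ℂ]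
      exact NormedSpace.exp_series_hasSum_exp' (𝕂 := ℂ) (ξ a)
    · simp only [if_neg h]; exact hasSum_zero
  refine h2.unique (h3.congr_fun ?_)
  intro m
  rw [Matrix.smul_apply, tri_pow τ ξ B hB m a b hab]
  by_cases h : a = b <;> simp [h]

open scoped Matrix.Norms.Operator in
theorem exp_conj_tri (τ : Fin n → ℕ) (ξ : Fin n → ℂ) (B : Matrix (Fin n) (Fin n) ℂ) (hB : Tri τ ξ B)
    (g : (Matrix (Fin n) (Fin n) ℂ)ˣ) (A : Matrix (Fin n) (Fin n) ℂ)
    (hA : A = g.val * B * (g⁻¹).val) (c : ℂ) :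
    ∃ N, Tri τ (fun a => Complex.exp (c * ξ a)) N ∧ NormedSpace.exp (c • A) = g.val * N * (g⁻¹).val := by
  refine ⟨NormedSpace.exp (c • B), tri_exp τ (fun a => c * ξ a) (c • B) ?_, ?_⟩
  · intro a b hab
    rw [Matrix.smul_apply, hB a b hab]
    by_cases h : a = b <;> simp [h]
  · rw [hA, show c • (g.val * B * (g⁻¹).val) = g.val * (c • B) * (g⁻¹).val by simp]
    exact NormedSpace.exp_units_conj g (c • B)
end glue
end RH
end

section
namespace RH
section irred
variable {n k : ℕ}

theorem charpoly_restrict {V : Type*} [AddCommGroup V] [Module ℂ V] [FiniteDimensional ℂ V] (W : Submodule ℂ V)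
    (f : V →ₗ[ℂ] V) (h : W ≤ W.comap f) : f.charpoly = (f.restrict h).charpoly * (W.mapQ W f h).charpoly := by
  apply Polynomial.funext
  intro t
  have h' : W ≤ W.comap (algebraMap ℂ (Module.End ℂ V) t - f) := by
    intro w hw
    have : t • w - f w ∈ W := W.sub_mem (W.smul_mem t hw) (h hw)
    simpa [Module.algebraMap_end_apply] using this
  rw [Polynomial.eval_mul, LinearMap.eval_charpoly, LinearMap.eval_charpoly, LinearMap.eval_charpoly,
    LinearMap.det_eq_det_mul_det W _ h']
  congr 2
  ext x
  simp [Module.algebraMap_end_apply]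

theorem restrict_prod (W : Submodule ℂ (Fin n → ℂ)) (M : Fin k → Matrix (Fin n) (Fin n) ℂ)
    (h : ∀ j, W ≤ W.comap (Matrix.mulVecLin (M j))) (l : List (Fin k)) (v : W) :
    (((l.map fun j => (Matrix.mulVecLin (M j)).restrict (h j)).prod v : W) : Fin n → ℂ) = Matrix.mulVec (l.map M).prod v := by
  induction l with
  | nil => simp
  | cons a l ih =>
    rw [List.map_cons, List.prod_cons, List.map_cons, List.prod_cons, ← Matrix.mulVec_mulVec, ← ih]
    rfl

theorem irred_of_generic (Y M : Fin k → Matrix (Fin n) (Fin n) ℂ) (hc : ∀ j, (M j).charpoly.roots = (Y j).charpoly.roots)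
    (hgen : GenericMulRoots Y) (hM : (List.ofFn M).prod = 1) : IrreducibleTuple M := by
  intro W hW
  by_contra hcon
  push Not at hcon
  obtain ⟨hb, ht⟩ := hcon
  have h : ∀ j, W ≤ W.comap (Matrix.mulVecLin (M j)) := fun j => Submodule.map_le_iff_le_comap.1 (hW j)
  have h1 : 1 ≤ Module.finrank ℂ W := by
    rw [Nat.one_le_iff_ne_zero]
    intro h0; exact hb (Submodule.finrank_eq_zero.1 h0)
  have h2 : Module.finrank ℂ W < n := by
    have := Submodule.finrank_lt ht
    simpa using this
  refine hgen (Module.finrank ℂ W) h1 (by omega) (fun j => ((Matrix.mulVecLin (M j)).restrict (h j)).charpoly.roots) ?_ ?_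
  · intro j
    constructor
    · rw [← hc j, ← Matrix.charpoly_mulVecLin]
      refine Polynomial.roots.le_of_dvd (LinearMap.charpoly_monic _).ne_zero ?_
      rw [charpoly_restrict W _ (h j)]
      exact dvd_mul_right _ _
    · rw [← LinearMap.charpoly_natDegree ((Matrix.mulVecLin (M j)).restrict (h j))]
      exact (IsAlgClosed.splits _).natDegree_eq_card_roots.symm
  · have h3 : ∀ j, ((Matrix.mulVecLin (M j)).restrict (h j)).charpoly.roots.prod = LinearMap.det ((Matrix.mulVecLin (M j)).restrict (h j)) :=
      fun j => (Module.End.det_eq_prod_roots_charpoly_of_splits (IsAlgClosed.splits _)).symm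
    have h4 : ((List.finRange k).map fun j => (Matrix.mulVecLin (M j)).restrict (h j)).prod = 1 := by
      ext v : 2
      rw [restrict_prod, ← List.ofFn_eq_map, hM]; simp
    have h5 := congrArg LinearMap.det h4
    rw [map_one, map_list_prod, List.map_map, ← List.ofFn_eq_map, List.prod_ofFn] at h5
    simp only [h3]
    exact h5
end irred
end RH
end

section
namespace RH
section xi
variable {n k : ℕ}

theorem log_diff (x y : ℂ) (hx : x ≠ 0) (hy : y ≠ 0) (m : ℤ) (h : Complex.log x / (2 * Real.pi * Complex.I) - Complex.log y / (2 * Real.pi * Complex.I) = m) : m = 0 := by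
  have h1 : Complex.log x - Complex.log y = m * (2 * Real.pi * Complex.I) := by
    rw [← sub_div, div_eq_iff Complex.two_pi_I_ne_zero] at h
    exact h
  have h2 : x = y := by
    have := congrArg Complex.exp h1
    rw [Complex.exp_sub, Complex.exp_log hx, Complex.exp_log hy, Complex.exp_int_mul_two_pi_mul_I, div_eq_one_iff_eq hy] at this
    exact this
  subst h2
  rw [sub_self] at h1
  rcases mul_eq_zero.1 h1.symm with h | h
  · exact_mod_cast h
  · exact absurd h Complex.two_pi_I_ne_zero

theorem choose_xi (hn : 0 < n) (hk : 0 < k) (τ : Fin k → Fin n → ℕ) (σ : Fin k → Fin n → ℂ) (h0 : ∀ j a, σ j a ≠ 0)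
    (hσ : ∀ j a b, τ j a = τ j b → σ j a = σ j b) (h1 : ∏ j, ∏ a, σ j a = 1) :
    ∃ (ξ : Fin k → Fin n → ℂ) (S : Finset (Fin n)), (∀ j a, Complex.exp ((2 * Real.pi * Complex.I) * ξ j a) = σ j a) ∧
      (∀ j a b, τ j a = τ j b → ξ j a = ξ j b) ∧ (∑ j, ∑ a, ξ j a = S.card) ∧ ∀ j a b (m : ℕ), 1 ≤ m → ξ j a - ξ j b ≠ (m : ℂ) := by
  let ξ0 : Fin k → Fin n → ℂ := fun j a => Complex.log (σ j a) / (2 * Real.pi * Complex.I)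
  have hξ0 : ∀ j a, Complex.exp ((2 * Real.pi * Complex.I) * ξ0 j a) = σ j a := by
    intro j a
    simp only [ξ0]
    rw [mul_div_cancel₀ _ Complex.two_pi_I_ne_zero, Complex.exp_log (h0 j a)]
  have h2 : Complex.exp ((2 * Real.pi * Complex.I) * ∑ j, ∑ a, ξ0 j a) = 1 := by
    simp only [Finset.mul_sum, Complex.exp_sum, hξ0, h1]
  obtain ⟨m, hm⟩ := Complex.exp_eq_one_iff.1 h2
  rw [mul_comm, mul_left_inj' Complex.two_pi_I_ne_zero] at hm
  have hn' : (0 : ℤ) < n := by exact_mod_cast hn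
  obtain ⟨d, hd⟩ := Int.eq_ofNat_of_zero_le (Int.emod_nonneg m hn'.ne')
  have hdn : d < n := by
    have := Int.emod_lt_of_pos m hn'
    rw [hd] at this; exact_mod_cast this
  have hdiv : m = d + n * (m / n) := by rw [← hd]; exact (Int.emod_add_mul_ediv m n).symm
  refine ⟨fun j a => ξ0 j a - if j = ⟨0, hk⟩ then ((m / n : ℤ) : ℂ) else 0, Finset.univ.filter fun a : Fin n => (a : ℕ) < d, ?_, ?_, ?_, ?_⟩
  · intro j a
    rw [mul_sub, Complex.exp_sub, hξ0]
    split_ifs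
    · rw [mul_comm, Complex.exp_int_mul_two_pi_mul_I]; simp
    · simp
  · intro j a b h
    simp only [ξ0, hσ j a b h]
  · have hc : (Finset.univ.filter fun a : Fin n => (a : ℕ) < d).card = d := by
      rw [Fin.card_filter_val_lt]; omega
    rw [hc]
    simp only [Finset.sum_sub_distrib, hm]
    rw [Finset.sum_eq_single (⟨0, hk⟩ : Fin k)]
    · rw [if_pos rfl, Finset.sum_const, Finset.card_univ, Fintype.card_fin, nsmul_eq_mul]
      have := congrArg (fun z : ℤ => (z : ℂ)) hdiv
      simp only [Int.cast_add, Int.cast_mul, Int.cast_natCast] at this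
      linear_combination this
    · intro b _ hb; simp [hb]
    · simp
  · intro j a b l hl h
    have h3 : ξ0 j a - ξ0 j b = ((l : ℤ) : ℂ) := by
      rw [Int.cast_natCast, ← h]; ring
    have := log_diff _ _ (h0 j a) (h0 j b) l h3
    omega

theorem xi_generic (Y : Fin k → Matrix (Fin n) (Fin n) ℂ) (σ ξ : Fin k → Fin n → ℂ) (hY : ∀ j, (Y j).charpoly.roots = Finset.univ.val.map (σ j))
    (hgen : GenericMulRoots Y) (hξ : ∀ j a, Complex.exp ((2 * Real.pi * Complex.I) * ξ j a) = σ j a)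
    (B : Fin k → Finset (Fin n)) (b : ℕ) (hb : 0 < b) (hbn : b < n) (hB : ∀ j, (B j).card = b) (m : ℤ) : ∑ j, ∑ a ∈ B j, ξ j a ≠ m := by
  intro h
  refine hgen b hb (by omega) (fun j => (B j).val.map (σ j)) (fun j => ⟨?_, by simpa using hB j⟩) ?_
  · rw [hY j]
    exact Multiset.map_le_map (Finset.val_le_iff.2 (Finset.subset_univ _))
  · have h2 : Complex.exp ((2 * Real.pi * Complex.I) * ∑ j, ∑ a ∈ B j, ξ j a) = 1 := by
      rw [h, mul_comm, Complex.exp_int_mul_two_pi_mul_I]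
    simp only [Finset.mul_sum, Complex.exp_sum, hξ] at h2
    exact h2
end xi
end RH
end

section
open Filter Topology
namespace RH
section ift
variable {k : ℕ} {𝔸 : Type*} [NormedRing 𝔸] [NormedAlgebra ℂ 𝔸] [CompleteSpace 𝔸]

theorem exp_strict {E : Type*} [NormedAddCommGroup E] [NormedSpace ℂ E] (L : E →L[ℂ] 𝔸) (p0 : E) (h : L p0 = 0) :
    HasStrictFDerivAt (fun q => NormedSpace.exp (L q)) L p0 := by
  have h0 : HasStrictFDerivAt (NormedSpace.exp : 𝔸 → 𝔸) (1 : 𝔸 →L[ℂ] 𝔸) (L p0) := by rw [h]; exact hasStrictFDerivAt_exp_zero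
  exact HasStrictFDerivAt.comp p0 (g := NormedSpace.exp) h0 L.hasStrictFDerivAt

theorem perturb_strict (M D : Fin k → 𝔸) (hM : ((List.finRange k).map M).prod = 1) :
    ∃ F' : (ℂ × (Fin k → 𝔸) × ℂ) →L[ℂ] (ℂ × 𝔸),
      HasStrictFDerivAt (fun q : ℂ × (Fin k → 𝔸) × ℂ =>
        (q.1, q.2.2 • ((List.finRange k).map fun j => NormedSpace.exp (q.2.1 j) * (M j + q.1 • D j) * NormedSpace.exp (-(q.2.1 j))).prod)) F' (0, 0, 1) ∧
      (∀ q, (F' q).1 = q.1) ∧ (∀ c, F' (0, 0, c) = (0, c • 1)) ∧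
      ∀ j X, F' (0, Pi.single j X, 0) = (0, (((List.finRange k).take j).map M).prod * (X * M j - M j * X) * (((List.finRange k).drop (j + 1)).map M).prod) := by
  let p0 : ℂ × (Fin k → 𝔸) × ℂ := (0, 0, 1)
  let T : (ℂ × (Fin k → 𝔸) × ℂ) →L[ℂ] ℂ := ContinuousLinearMap.fst ℂ ℂ ((Fin k → 𝔸) × ℂ)
  let C : (ℂ × (Fin k → 𝔸) × ℂ) →L[ℂ] ℂ := (ContinuousLinearMap.snd ℂ (Fin k → 𝔸) ℂ).comp (ContinuousLinearMap.snd ℂ ℂ ((Fin k → 𝔸) × ℂ))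
  have hG : ∀ j : Fin k, ∃ G' : (ℂ × (Fin k → 𝔸) × ℂ) →L[ℂ] 𝔸,
      HasStrictFDerivAt (fun q : ℂ × (Fin k → 𝔸) × ℂ => NormedSpace.exp (q.2.1 j) * (M j + q.1 • D j) * NormedSpace.exp (-(q.2.1 j))) G' p0 ∧
      ∀ q, G' q = q.1 • D j + (q.2.1 j * M j - M j * q.2.1 j) := by
    intro j
    let L : (ℂ × (Fin k → 𝔸) × ℂ) →L[ℂ] 𝔸 := (ContinuousLinearMap.proj (R := ℂ) (φ := fun _ : Fin k => 𝔸) j).comp ((ContinuousLinearMap.fst ℂ (Fin k → 𝔸) ℂ).comp (ContinuousLinearMap.snd ℂ ℂ ((Fin k → 𝔸) × ℂ)))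
    have h1 := exp_strict L p0 (by simp [L, p0])
    have h2 := exp_strict (-L) p0 (by simp [L, p0])
    have h3 : HasStrictFDerivAt (fun q : ℂ × (Fin k → 𝔸) × ℂ => M j + q.1 • D j) (T.smulRight (D j)) p0 :=
      (T.smulRight (D j)).hasStrictFDerivAt.const_add (M j)
    refine ⟨_, (h1.mul' h3).mul' h2, fun q => ?_⟩
    simp [L, p0, T]
    abel
  choose G' hG' hG'v using hG
  have hP : HasStrictFDerivAt (fun (q : ℂ × (Fin k → 𝔸) × ℂ) => fun j : Fin k => NormedSpace.exp (q.2.1 j) * (M j + q.1 • D j) * NormedSpace.exp (-(q.2.1 j)))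
      (ContinuousLinearMap.pi G') p0 := hasStrictFDerivAt_pi.2 hG'
  have hM0 : (fun j : Fin k => NormedSpace.exp (p0.2.1 j) * (M j + p0.1 • D j) * NormedSpace.exp (-(p0.2.1 j))) = M := by
    funext j; simp [p0]
  have hQ := HasStrictFDerivAt.comp p0 (g := fun x : Fin k → 𝔸 => ((List.finRange k).map x).prod) (by rw [hM0]; exact hasStrictFDerivAt_list_prod_finRange' (𝕜 := ℂ)) hP
  have hR := T.hasStrictFDerivAt (x := p0) |>.prodMk ((C.hasStrictFDerivAt (x := p0)).smul hQ)
  refine ⟨_, hR, ?_, ?_, ?_⟩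
  · intro q; rfl
  · intro c
    ext
    · rfl
    · simp [T, C, p0, hG'v, hM]
  · intro j X
    ext
    · rfl
    · simp [T, C, p0, hG'v, hM]
      rw [Finset.sum_eq_single j]
      · simp [mul_assoc]
      · intro b _ hb; simp [Pi.single_eq_of_ne hb]
      · simp
end ift
end RH
end

section
open Filter Topology
namespace RH
section ift2
variable {k n : ℕ}

theorem schur (hn : 0 < n) (M : Fin k → Matrix (Fin n) (Fin n) ℂ) (hM : IrreducibleTuple M) (Z : Matrix (Fin n) (Fin n) ℂ)
    (hZ : ∀ j, M j * Z = Z * M j) (htr : Z.trace = 0) : Z = 0 := by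
  haveI : Nonempty (Fin n) := ⟨⟨0, hn⟩⟩
  obtain ⟨μ, hμ⟩ := Module.End.exists_eigenvalue (Matrix.mulVecLin Z : Module.End ℂ (Fin n → ℂ))
  have hinv : ∀ v, v ∈ Module.End.eigenspace (Matrix.mulVecLin Z : Module.End ℂ (Fin n → ℂ)) μ ↔ Matrix.mulVec Z v = μ • v := by
    intro v; rw [Module.End.mem_eigenspace_iff]; rfl
  have h1 := hM (Module.End.eigenspace (Matrix.mulVecLin Z) μ) (by
    intro j
    rw [Submodule.map_le_iff_le_comap]
    intro v hv
    rw [hinv] at hv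
    rw [Submodule.mem_comap, hinv, Matrix.mulVecLin_apply, Matrix.mulVec_mulVec, ← hZ j, ← Matrix.mulVec_mulVec, hv, Matrix.mulVec_smul])
  have h2 := h1.resolve_left hμ
  have h3 : Z = μ • 1 := by
    ext a b
    have h4 := congrFun ((hinv (Pi.single b 1)).1 (by rw [h2]; trivial)) a
    rw [Matrix.mulVec_single_one] at h4
    simpa [Matrix.one_apply, Pi.single_apply, eq_comm] using h4
  rw [h3, Matrix.trace_smul, Matrix.trace_one, Fintype.card_fin, smul_eq_mul] at htr
  have : (n : ℂ) ≠ 0 := by exact_mod_cast hn.ne'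
  rw [h3, (mul_eq_zero.1 htr).resolve_right this, zero_smul]

theorem exists_trace (f : Matrix (Fin n) (Fin n) ℂ →ₗ[ℂ] ℂ) : ∃ Z : Matrix (Fin n) (Fin n) ℂ, ∀ W, f W = (Z * W).trace := by
  refine ⟨Matrix.of fun b a => f (Matrix.single a b 1), fun W => ?_⟩
  conv_lhs => rw [Matrix.matrix_eq_sum_single W]
  simp only [map_sum, Matrix.trace, Matrix.diag, Matrix.mul_apply, Matrix.of_apply]
  rw [Finset.sum_comm]
  refine Finset.sum_congr rfl fun a _ => Finset.sum_congr rfl fun b _ => ?_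
  rw [show Matrix.single b a (W b a) = W b a • Matrix.single b a (1 : ℂ) by simp [Matrix.smul_single], map_smul, smul_eq_mul, mul_comm]

theorem commute_of_trace (M : Fin k → Matrix (Fin n) (Fin n) ℂ) (hM : ((List.finRange k).map M).prod = 1) (Z : Matrix (Fin n) (Fin n) ℂ)
    (h : ∀ (j : Fin k) X, (Z * ((((List.finRange k).take j).map M).prod * (X * M j - M j * X) * (((List.finRange k).drop (j + 1)).map M).prod)).trace = 0) (j : Fin k) :
    M j * Z = Z * M j := by
  let P : ℕ → Matrix (Fin n) (Fin n) ℂ := fun j => (((List.finRange k).take j).map M).prod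
  let Q : ℕ → Matrix (Fin n) (Fin n) ℂ := fun j => (((List.finRange k).drop j).map M).prod
  have hPQ : ∀ i, P i * Q i = 1 := by
    intro i
    simp only [P, Q]
    rw [← List.prod_append, ← List.map_append, List.take_append_drop, hM]
  have hQP : ∀ i, Q i * P i = 1 := fun i => mul_eq_one_comm.1 (hPQ i)
  have hP1 : ∀ j : Fin k, P (j + 1) = P j * M j := by
    intro j
    simp only [P]
    rw [List.take_add_one]
    simp
  have hQ1 : ∀ j : Fin k, Q j = M j * Q (j + 1) := by
    intro j
    simp only [Q]
    rw [List.drop_eq_getElem_cons (i := j) (by simp)]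
    simp
  have hstep : ∀ j : Fin k, Q j * Z * P j = Q (j + 1) * Z * P (j + 1) := by
    intro j
    have : ∀ X, ((Q j * Z * P j - Q (j + 1) * Z * P (j + 1)) * X).trace = 0 := by
      intro X
      have h1 := h j X
      have e1 : Z * (P j * (X * M j - M j * X) * Q (j + 1)) = (Z * P j * X) * (M j * Q (j + 1)) - (Z * (P j * M j) * X) * Q (j + 1) := by noncomm_ring
      change (Z * (P j * (X * M j - M j * X) * Q (j + 1))).trace = 0 at h1
      rw [e1, ← hQ1, ← hP1, Matrix.trace_sub, Matrix.trace_mul_comm, Matrix.trace_mul_comm _ (Q (j + 1)), ← Matrix.trace_sub] at h1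
      rw [← h1]; congr 1; noncomm_ring
    have h2 := (Matrix.ext_iff_trace_mul_right (A := Q j * Z * P j - Q (j + 1) * Z * P (j + 1)) (B := 0)).2 (fun X => by rw [this]; simp)
    exact sub_eq_zero.1 h2
  have hall : ∀ i, i ≤ k → Q i * Z * P i = Z := by
    intro i
    induction i with
    | zero => intro _; simp [P, Q, hM]
    | succ i ih => intro hi; rw [← hstep ⟨i, hi⟩]; exact ih (by omega)
  have hcomm : ∀ i, i ≤ k → Z * P i = P i * Z := by
    intro i hi
    calc Z * P i = (P i * Q i) * Z * P i := by rw [hPQ, one_mul]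
      _ = P i * (Q i * Z * P i) := by noncomm_ring
      _ = _ := by rw [hall i hi]
  have h1 := hcomm j j.2.le
  have h2 := hcomm (j + 1) j.2
  rw [hP1] at h2
  have h3 : P j * (M j * Z) = P j * (Z * M j) := by
    rw [← mul_assoc, ← h2, ← mul_assoc, ← mul_assoc, h1]
  calc M j * Z = Q j * (P j * (M j * Z)) := by rw [← mul_assoc, hQP, one_mul]
    _ = Z * M j := by rw [h3, ← mul_assoc, hQP, one_mul]


theorem perturb_abs {𝔸 : Type*} [NormedRing 𝔸] [NormedAlgebra ℂ 𝔸] [CompleteSpace 𝔸] (M D : Fin k → 𝔸) (hM : (List.ofFn M).prod = 1)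
    (hs : ∀ R : Submodule ℂ 𝔸, (1 : 𝔸) ∈ R → (∀ (j : Fin k) X, (((List.finRange k).take j).map M).prod * (X * M j - M j * X) * (((List.finRange k).drop (j + 1)).map M).prod ∈ R) → R = ⊤)
    (U : Set ℂ) (hU : U ∈ 𝓝 (1 : ℂ)) : ∀ᶠ t in 𝓝 (0 : ℂ), ∃ c ∈ U, ∃ u : Fin k → 𝔸ˣ,
      c • (List.ofFn fun j => (u j).val * (M j + t • D j) * ((u j)⁻¹).val).prod = 1 := by
  rw [List.ofFn_eq_map] at hM
  letI : NormedAlgebra ℚ 𝔸 := NormedAlgebra.restrictScalars ℚ ℂ 𝔸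
  obtain ⟨F', hF, hF1, hF2, hF3⟩ := perturb_strict M D hM
  have hsurj : F'.range = ⊤ := by
    have hR : ∀ W : 𝔸, ((0 : ℂ), W) ∈ LinearMap.range F'.toLinearMap := by
      intro W
      have := hs ((LinearMap.range F'.toLinearMap).comap (LinearMap.inr ℂ ℂ 𝔸)) ⟨(0, 0, 1), by simpa using hF2 1⟩
        (fun j X => ⟨_, hF3 j X⟩)
      exact (show W ∈ (LinearMap.range F'.toLinearMap).comap (LinearMap.inr ℂ ℂ 𝔸) by rw [this]; trivial)
    rw [eq_top_iff]
    rintro ⟨t, W⟩ -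
    obtain ⟨q, hq⟩ := hR (W - (F' (t, 0, 0)).2)
    refine ⟨q + (t, 0, 0), ?_⟩
    have h1 : F' q = (0, W - (F' (t, 0, 0)).2) := hq
    show F' (q + (t, 0, 0)) = _
    rw [map_add, h1]
    ext1
    · simp [hF1]
    · simp
  have hmap := hF.map_nhds_eq_of_surj hsurj
  simp only at hmap
  have hU' : {q : ℂ × (Fin k → 𝔸) × ℂ | q.2.2 ∈ U} ∈ 𝓝 ((0 : ℂ), (0 : Fin k → 𝔸), (1 : ℂ)) := by
    have hc : ContinuousAt (fun q : ℂ × (Fin k → 𝔸) × ℂ => q.2.2) ((0 : ℂ), (0 : Fin k → 𝔸), (1 : ℂ)) := by fun_prop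
    exact hc hU
  have himg := image_mem_map (m := fun q : ℂ × (Fin k → 𝔸) × ℂ =>
        (q.1, q.2.2 • ((List.finRange k).map fun j => NormedSpace.exp (q.2.1 j) * (M j + q.1 • D j) * NormedSpace.exp (-(q.2.1 j))).prod)) hU'
  rw [hmap] at himg
  have hval : ((List.finRange k).map fun j => NormedSpace.exp ((0 : Fin k → 𝔸) j) * (M j + (0 : ℂ) • D j) * NormedSpace.exp (-((0 : Fin k → 𝔸) j))).prod = 1 := by
    rw [← hM]; simp
  rw [hval, one_smul] at himg
  have hct : ContinuousAt (fun t : ℂ => (t, (1 : 𝔸))) 0 := by fun_prop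
  filter_upwards [hct himg] with t ht
  obtain ⟨q, hq, hqe⟩ := ht
  have h1 := congrArg Prod.fst hqe
  have h2 := congrArg Prod.snd hqe
  simp only at h1 h2
  refine ⟨q.2.2, hq, fun j => ⟨NormedSpace.exp (q.2.1 j), NormedSpace.exp (-(q.2.1 j)), ?_, ?_⟩, ?_⟩
  · rw [← NormedSpace.exp_add_of_commute (Commute.neg_right (Commute.refl _))]; simp
  · rw [← NormedSpace.exp_add_of_commute (Commute.neg_left (Commute.refl _))]; simp
  · rw [List.ofFn_eq_map, ← h1]
    exact h2

open scoped Matrix.Norms.Operator in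
theorem perturb (hn : 0 < n) (M D : Fin k → Matrix (Fin n) (Fin n) ℂ) (hM : (List.ofFn M).prod = 1) (hirr : IrreducibleTuple M)
    (U : Set ℂ) (hU : U ∈ 𝓝 (1 : ℂ)) : ∀ᶠ t in 𝓝 (0 : ℂ), ∃ c ∈ U, ∃ u : Fin k → (Matrix (Fin n) (Fin n) ℂ)ˣ,
      c • (List.ofFn fun j => (u j).val * (M j + t • D j) * ((u j)⁻¹).val).prod = 1 := by
  refine perturb_abs M D hM ?_ U hU
  intro R h1 hR
  by_contra hcon
  obtain ⟨f, hf0, hf⟩ := Submodule.exists_le_ker_of_lt_top R (lt_top_iff_ne_top.2 hcon)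
  obtain ⟨Z, hZ⟩ := exists_trace f
  have hk : ∀ W, W ∈ R → (Z * W).trace = 0 := by
    intro W hW
    rw [← hZ]; exact hf hW
  have hZ0 : Z = 0 := by
    refine schur hn M hirr Z (commute_of_trace M (by rw [← List.ofFn_eq_map, hM]) Z ?_) ?_
    · intro j X
      exact hk _ (hR j X)
    · simpa using hk 1 h1
  apply hf0
  refine LinearMap.ext fun W => ?_
  rw [hZ, hZ0]; simp

theorem root_one (hn : 0 < n) : {c : ℂ | c ^ n = 1 → c = 1} ∈ 𝓝 (1 : ℂ) := by
  have h1 : HasDerivAt (fun c : ℂ => c ^ n) (n * 1 ^ (n - 1)) 1 := by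
    simpa using hasDerivAt_pow n (1 : ℂ)
  have h2 : ∀ᶠ z in 𝓝[≠] (1 : ℂ), z ^ n ≠ 1 := h1.eventually_ne (by simp; omega)
  rw [eventually_nhdsWithin_iff] at h2
  filter_upwards [h2] with z hz hz1
  by_contra hne
  exact hz hne hz1

/-- The deformation step. -/
theorem deform (hn : 0 < n) (M N Y Y0 : Fin k → Matrix (Fin n) (Fin n) ℂ) (hM : (List.ofFn M).prod = 1) (hirr : IrreducibleTuple M)
    (hMN : ∀ j, ∃ u : (Matrix (Fin n) (Fin n) ℂ)ˣ, M j = u.val * N j * (u⁻¹).val)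
    (hY : ∀ j, ∀ᶠ t in 𝓝[≠] (0 : ℂ), ∃ u : (Matrix (Fin n) (Fin n) ℂ)ˣ, N j + t • (Y0 j - N j) = u.val * Y j * (u⁻¹).val)
    (hdet : ∏ j, (Y j).det = 1) :
    ∃ M' : Fin k → Matrix (Fin n) (Fin n) ℂ, (∀ j, ∃ u : (Matrix (Fin n) (Fin n) ℂ)ˣ, M' j = u.val * Y j * (u⁻¹).val) ∧ (List.ofFn M').prod = 1 := by
  choose v hv using hMN
  have h1 := (perturb hn M (fun j => (v j).val * (Y0 j - N j) * ((v j)⁻¹).val) hM hirr _ (root_one hn)).filter_mono (nhdsWithin_le_nhds (s := {0}ᶜ))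
  obtain ⟨t, ⟨c, hc, u, hu⟩, ht⟩ := (h1.and (eventually_all.2 hY)).exists
  choose w hw using ht
  have h2 : ∀ j, (u j).val * (M j + t • ((v j).val * (Y0 j - N j) * ((v j)⁻¹).val)) * ((u j)⁻¹).val
      = (u j * v j * w j).val * Y j * ((u j * v j * w j)⁻¹).val := by
    intro j
    have e : M j + t • ((v j).val * (Y0 j - N j) * ((v j)⁻¹).val) = (v j).val * (N j + t • (Y0 j - N j)) * ((v j)⁻¹).val := by
      rw [hv j]; simp only [mul_add, add_mul, Matrix.mul_smul, Matrix.smul_mul]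
    rw [e, hw j]
    simp only [_root_.mul_inv_rev, Units.val_mul]
    noncomm_ring
  simp only [h2] at hu
  have h3 : c = 1 := by
    apply hc
    have := congrArg Matrix.det hu
    rw [Matrix.det_smul, Fintype.card_fin, Matrix.det_one, ← Matrix.coe_detMonoidHom, map_list_prod, List.map_ofFn, List.prod_ofFn] at this
    have e : ∀ j, (Matrix.detMonoidHom ∘ fun j => (u j * v j * w j).val * Y j * ((u j * v j * w j)⁻¹).val) j = (Y j).det := by
      intro j
      exact Matrix.det_units_conj _ _
    rw [Finset.prod_congr rfl fun j _ => e j, hdet, mul_one] at this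
    exact this
  rw [h3, one_smul] at hu
  exact ⟨_, fun j => ⟨_, rfl⟩, hu⟩
end ift2
end RH
end

/-- solution of the DSP for generic eigenvalues under `(ω_n)`, multiplicative
version. If the conjugacy classes (given by representatives `Y j`) have generic eigenvalues
and `r(C_1) + ⋯ + r(C_{p+1}) ≥ 2n`, then there is an irreducible tuple `M j ∈ C_j` with
`M 1 ⋯ M (p+1) = I`. -/
theorem stmt1 (n p : ℕ)
    (Y : Fin (p + 1) → Matrix (Fin n) (Fin n) ℂ)
    (hunit : ∀ j, IsUnit (Y j))
    (hdet : (∏ j, (Y j).det) = 1)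
    (hgen : GenericMulRoots Y)
    (hr : 2 * n ≤ ∑ j, minRank (Y j)) :
    ∃ M : Fin (p + 1) → Matrix (Fin n) (Fin n) ℂ,
      (∀ j, MatConj (Y j) (M j)) ∧ IrreducibleTuple M ∧ (List.ofFn M).prod = 1 := by
  rcases Nat.eq_zero_or_pos n with rfl | hn
  · refine ⟨Y, fun j => ⟨1, by simp⟩, fun V _ => Or.inl (Subsingleton.elim _ _), Subsingleton.elim _ _⟩
  have hflag := fun j => RH.flag (Y j) (minRank (Y j)) (fun c => by
    rw [Algebra.algebraMap_eq_smul_one]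
    exact Nat.sInf_le ⟨c, rfl⟩)
  choose τ σ Y0 hσ hY0 hcard hconj hpert using hflag
  have hroots : ∀ j, (Y j).charpoly.roots = Finset.univ.val.map (σ j) := by
    intro j
    obtain ⟨u, hu⟩ := hconj j
    rw [← RH.charpoly_tri (τ j) (σ j) (hσ j) (Y0 j) (hY0 j), hu, Matrix.coe_units_inv, Matrix.charpoly_units_conj]
  have hdetσ : ∀ j, ∏ a, σ j a = (Y j).det := by
    intro j
    rw [Matrix.det_eq_prod_roots_charpoly, hroots j]; rfl
  have hk : 2 ≤ p + 1 := by
    by_contra hlt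
    have hp : p = 0 := by omega
    subst hp
    have h1 := hcard 0 0
    simp at hr
    omega
  have hσ0 : ∀ j a, σ j a ≠ 0 := by
    intro j
    have h1 : ∏ a, σ j a ≠ 0 := by
      rw [hdetσ]; exact ((Matrix.isUnit_iff_isUnit_det _).1 (hunit j)).ne_zero
    intro a
    exact Finset.prod_ne_zero_iff.1 h1 a (Finset.mem_univ a)
  obtain ⟨ξ, S, hexp, hξ, hsum, hdiff⟩ := RH.choose_xi hn (by omega) τ σ hσ0 hσ (by simp only [hdetσ, hdet])
  obtain ⟨u, g, hu, A, hA, h1, h2, h3⟩ := RH.exists_additive hn hk τ (fun j => minRank (Y j)) ξ hcard hr hξ S hsum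
    (fun B b hb hbn hB m => RH.xi_generic Y σ ξ hroots hgen hexp B b hb hbn hB m)
  have htri : ∀ j, RH.Tri (τ j) (ξ j) (Matrix.diagonal (ξ j) + u j) := by
    intro j a b hab
    rw [Matrix.add_apply, hu j a b hab, add_zero, Matrix.diagonal_apply]
  obtain ⟨M, hM, hM1⟩ := RH.rh n (p + 1) hn hk A (fun a => a ∈ S)
    (fun j m hm X hX => RH.nonres (τ j) (ξ j) _ (htri j) m (fun a b => hdiff j a b m hm) (g j) (A j) (hA j) X hX) h1 h2 h3
  have hex := fun j => RH.exp_conj_tri (τ j) (ξ j) _ (htri j) (g j) (A j) (hA j) (2 * Real.pi * Complex.I)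
  choose N hN hNe using hex
  have hN' : ∀ j, RH.Tri (τ j) (σ j) (N j) := by
    intro j
    have := hN j
    simp only [hexp] at this
    exact this
  have hMN : ∀ j, ∃ u : (Matrix (Fin n) (Fin n) ℂ)ˣ, M j = u.val * N j * (u⁻¹).val := by
    intro j
    obtain ⟨w, hw⟩ := hM j
    refine ⟨w * g j, ?_⟩
    rw [hw, hNe j]
    simp only [_root_.mul_inv_rev, Units.val_mul]
    noncomm_ring
  have hirr : IrreducibleTuple M := by
    refine RH.irred_of_generic Y M (fun j => ?_) hgen hM1
    obtain ⟨w, hw⟩ := hMN j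
    rw [hw, Matrix.coe_units_inv, Matrix.charpoly_units_conj, RH.charpoly_tri (τ j) (σ j) (hσ j) (N j) (hN' j), hroots]
  obtain ⟨M', hM', hM1'⟩ := RH.deform hn M N Y Y0 hM1 hirr hMN (fun j => hpert j (N j) (hN' j)) hdet
  refine ⟨M', hM', RH.irred_of_generic Y M' (fun j => ?_) hgen hM1', hM1'⟩
  obtain ⟨w, hw⟩ := hM' j
  rw [hw, Matrix.coe_units_inv, Matrix.charpoly_units_conj]
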